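/- Let g be a root-reductive Lie algebra with Cartan subalgebra h and splitting Borel subalgebra b = h ⊕ n⁺ ⊇ h. The following conditions are equivalent: (i) every element of Γ⁺ is a finite sum of simple roots; (ii) g can be written as a direct limit of nested finite-dimensional reductive subalgebras g̃_n (each reductive in the next, with compatible Cartan subalgebras and root vectors) such that g̃_n + b is a subalgebra of g for each n; (iii) the partial order ≤ on h* is interval finite (every interval {ν : μ ≤ ν ≤ λ} is finite); (iv) g is generated by h together with the root spaces for the simple positive and negative roots; (v) for each λ ∈ h*, the Verma module Δ(λ) is locally U(b)-finite; (vi) for each λ ∈ h*, the Verma module Δ(λ) has finite-dimensional weight spaces. (A Borel subalgebra satisfying these conditions is called a Dynkin Borel subalgebra.) -/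

import Mathlib

set_option linter.unusedSectionVars false

open UniversalEnvelopingAlgebra

noncomputable section

universe u

variable (K : Type) [Field K] [IsAlgClosed K] [CharZero K]
variable (g : Type) [LieRing g] [LieAlgebra K g]

/-- The weight space of a Lie module for a weight `χ` of a subalgebra `h`. -/
def wtSpace (h : LieSubalgebra K g) (M : Type) [AddCommGroup M] [Module K M]
    [LieRingModule g M] [LieModule K g M] (χ : Module.Dual K h) : Submodule K M where
  carrier := {m | ∀ H : h, ⁅(H : g), m⁆ = χ H • m}
  add_mem' := by intro a b ha hb H; rw [lie_add, ha H, hb H, smul_add]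
  zero_mem' := by intro H; rw [lie_zero, smul_zero]
  smul_mem' := by intro c m hm H; rw [lie_smul, hm H, smul_comm]

/-- The root space of `g` relative to `h` for the functional `α`. -/
abbrev rootSp (h : LieSubalgebra K g) (α : Module.Dual K h) : Submodule K g :=
  wtSpace K g h g α

/-- Notation for the universal enveloping algebra. -/
abbrev UEA (L : Type) [LieRing L] [LieAlgebra K L] : Type :=
  UniversalEnvelopingAlgebra K L

variable {K} in
/-- The Lie module structure on a quotient of the universal enveloping algebra
by a left ideal. -/
instance uqLRM (L : Type) [LieRing L] [LieAlgebra K L]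
    (I : Submodule (UEA K L) (UEA K L)) : LieRingModule L ((UEA K L) ⧸ I) where
  bracket x m := ι K x • m
  add_lie x y m := by
    show (ι K (x + y)) • m = (ι K x) • m + (ι K y) • m
    rw [map_add, add_smul]
  lie_add x m n := by
    show (ι K x) • (m + n) = (ι K x) • m + (ι K x) • n
    rw [smul_add]
  leibniz_lie x y m := by
    show (ι K x) • ((ι K y) • m) = (ι K ⁅x, y⁆) • m + (ι K y) • ((ι K x) • m)
    have hxy : ι K ⁅x, y⁆ = ι K x * ι K y - ι K y * ι K x := by
      letI : LieRing (UniversalEnvelopingAlgebra K L) := LieRing.ofAssociativeRing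
      exact LieHom.map_lie (ι K) x y
    rw [hxy, sub_smul, mul_smul, mul_smul,
      sub_add_cancel]

variable {K} in
instance uqLM (L : Type) [LieRing L] [LieAlgebra K L]
    (I : Submodule (UEA K L) (UEA K L)) : LieModule K L ((UEA K L) ⧸ I) where
  smul_lie c x m := by
    show (ι K (c • x)) • m = c • ((ι K x) • m)
    rw [map_smul]
    exact smul_assoc c (ι K x) m
  lie_smul c x m := by
    show (ι K x) • (c • m) = c • ((ι K x) • m)
    exact smul_comm _ _ _

/-- A root-reductive Lie algebra together with a splitting Borel subalgebra `b ⊇ h`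
containing a fixed splitting maximal toral (Cartan) subalgebra `h`.  The fields record:
an exhausting chain `gc n` of nested finite-dimensional reductive subalgebras, each
reductive in the next, with compatible Cartan subalgebras and root vectors; the root
decomposition of `g` with respect to `h` with one-dimensional root spaces; a positive
system `Φp` closed under addition and the corresponding Borel subalgebra `b = h ⊕ n⁺`;
the anti-involution `τ`; coroots and the weight `ρ`. -/
structure RootReductive where
  h : LieSubalgebra K g
  gc : ℕ → LieSubalgebra K g
  gc_mono : Monotone gc
  gc_findim : ∀ n, FiniteDimensional K (gc n)
  gc_exhausts : ∀ x : g, ∃ n, x ∈ gc n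
  gc_reductive : ∀ n, LieAlgebra.radical K (gc n) = LieAlgebra.center K (gc n)
  gc_red_in : ∀ n, ∀ N : Submodule K g, N ≤ (gc (n+1)).toSubmodule →
      (∀ x ∈ gc n, ∀ v ∈ N, ⁅x, v⁆ ∈ N) →
      ∃ N' : Submodule K g, N' ≤ (gc (n+1)).toSubmodule ∧
        (∀ x ∈ gc n, ∀ v ∈ N', ⁅x, v⁆ ∈ N') ∧
        N ⊓ N' = ⊥ ∧ N ⊔ N' = (gc (n+1)).toSubmodule
  gc_cartan : ∀ n, ∃ hc : LieSubalgebra K (gc n),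
      ((hc : Set (gc n)) = ((↑) : (gc n) → g) ⁻¹' (h : Set g)) ∧ hc.IsCartanSubalgebra
  h_exhaust : ∀ x ∈ h, ∃ n, x ∈ gc n
  Φ : Set (Module.Dual K h)
  root_iff : ∀ α, α ∈ Φ ↔ α ≠ 0 ∧ rootSp K g h α ≠ ⊥
  root_dim : ∀ α ∈ Φ, Module.rank K (rootSp K g h α) = 1
  gc_rootdec : ∀ n, (gc n).toSubmodule =
      ((gc n).toSubmodule ⊓ h.toSubmodule) ⊔
        (⨆ α ∈ Φ, ((gc n).toSubmodule ⊓ rootSp K g h α))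
  rootdec : h.toSubmodule ⊔ (⨆ α ∈ Φ, rootSp K g h α) = ⊤
  Φp : Set (Module.Dual K h)
  pos_subset : Φp ⊆ Φ
  pos_union : Φ = Φp ∪ (-Φp)
  pos_disjoint : Disjoint Φp (-Φp)
  pos_add : ∀ α ∈ Φp, ∀ β ∈ Φp, α + β ∈ Φ → α + β ∈ Φp
  b : LieSubalgebra K g
  h_le_b : h ≤ b
  b_def : b.toSubmodule = h.toSubmodule ⊔ (⨆ α ∈ Φp, rootSp K g h α)
  np : LieSubalgebra K g
  np_def : np.toSubmodule = ⨆ α ∈ Φp, rootSp K g h α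
  nm : LieSubalgebra K g
  nm_def : nm.toSubmodule = ⨆ α ∈ Φp, rootSp K g h (-α)
  τ : g →ₗ[K] g
  τ_invol : ∀ x, τ (τ x) = x
  τ_anti : ∀ x y, τ ⁅x, y⁆ = ⁅τ y, τ x⁆
  τ_h : ∀ x ∈ h, τ x = x
  τ_root : ∀ (α : Module.Dual K h), ∀ x ∈ rootSp K g h α, τ x ∈ rootSp K g h (-α)
  coroot : Module.Dual K h → h
  coroot_two : ∀ α ∈ Φ, α (coroot α) = 2
  coroot_neg : ∀ α ∈ Φ, coroot (-α) = - coroot α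
  ρ : Module.Dual K h
  ρ_simple : ∀ α ∈ Φp, (¬ ∃ β ∈ Φp, ∃ γ ∈ Φp, β + γ = α) → ρ (coroot α) = 1

namespace RootReductive

variable {K g} (S : RootReductive K g)

/-- The nilradical `n⁺` of the Borel subalgebra, as a submodule. -/
def nplus : Submodule K g := ⨆ α ∈ S.Φp, rootSp K g S.h α

/-- `Γ⁺`: the additive monoid of sums of positive roots. -/
def Γp : AddSubmonoid (Module.Dual K S.h) := AddSubmonoid.closure S.Φp

/-- The order `μ ≤ λ` iff `λ - μ ∈ Γ⁺`. -/
def wle (μ lam : Module.Dual K S.h) : Prop := lam - μ ∈ S.Γp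

/-- The set of simple (positive) roots. -/
def simples : Set (Module.Dual K S.h) :=
  {α ∈ S.Φp | ¬ ∃ β ∈ S.Φp, ∃ γ ∈ S.Φp, β + γ = α}

/-- `b` is a Dynkin Borel subalgebra: every element of `Γ⁺` is a sum of simple roots. -/
def IsDynkin : Prop := ∀ α ∈ S.Φp, α ∈ AddSubmonoid.closure S.simples

/-- The finite-rank subalgebra `g_n = g̃_n + h`. -/
def gfull (n : ℕ) : LieSubalgebra K g := S.gc n ⊔ S.h

/-- The roots `Φ_n` of `g_n`. -/
def levelRoots (n : ℕ) : Set (Module.Dual K S.h) :=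
  {α ∈ S.Φ | rootSp K g S.h α ≤ (S.gfull n).toSubmodule}

/-- The root lattice `ℤΦ_n`. -/
def zrootsLevel (n : ℕ) : AddSubgroup (Module.Dual K S.h) :=
  AddSubgroup.closure (S.levelRoots n)

/-- The root lattice `ℤΦ`. -/
def zroots : AddSubgroup (Module.Dual K S.h) := AddSubgroup.closure S.Φ

/-- The partial order `≤_n` relative to the positive roots of `g_n`. -/
def wleLevel (n : ℕ) (μ lam : Module.Dual K S.h) : Prop :=
  lam - μ ∈ AddSubmonoid.closure (S.Φp ∩ S.levelRoots n)

/-- The defining left ideal of the Verma module `Δ(λ) = U(g)/I_λ`, where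
`I_λ` is generated by `n⁺` and the elements `H - λ(H)`, `H ∈ h`. -/
def vIdeal (lam : Module.Dual K S.h) : Submodule (UEA K g) (UEA K g) :=
  Submodule.span (UEA K g)
    ({u | ∃ x ∈ S.nplus, u = ι K x} ∪
     {u | ∃ H : S.h, u = ι K (H : g) - algebraMap K (UEA K g) (lam H)})

/-- The Verma module `Δ(λ)`. -/
abbrev Verma (lam : Module.Dual K S.h) : Type := (UEA K g) ⧸ S.vIdeal lam

/-- The left ideal corresponding to the maximal submodule of `Δ(λ)`. -/
def radIdeal (lam : Module.Dual K S.h) : Submodule (UEA K g) (UEA K g) :=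
  sSup {J | S.vIdeal lam ≤ J ∧ J ≠ ⊤}

/-- The simple highest weight module `L(λ)`, the unique simple quotient of `Δ(λ)`. -/
abbrev SimpleHW (lam : Module.Dual K S.h) : Type := (UEA K g) ⧸ S.radIdeal lam

/-- The defining left ideal of the Verma module of a subalgebra `h ≤ a`, relative to the
Borel subalgebra `a ∩ b`. -/
def vIdealSub (a : LieSubalgebra K g) (ha : S.h ≤ a) (lam : Module.Dual K S.h) :
    Submodule (UEA K a) (UEA K a) :=
  Submodule.span (UEA K a)
    ({u | ∃ x : a, (x : g) ∈ S.nplus ∧ u = ι K x} ∪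
     {u | ∃ H : S.h, u = ι K (⟨(H : g), ha H.2⟩ : a) - algebraMap K (UEA K a) (lam H)})

/-- The Verma module `Δ_a(λ)` of a subalgebra `h ≤ a ≤ g`. -/
abbrev VermaSub (a : LieSubalgebra K g) (ha : S.h ≤ a) (lam : Module.Dual K S.h) : Type :=
  (UEA K a) ⧸ S.vIdealSub a ha lam

def radIdealSub (a : LieSubalgebra K g) (ha : S.h ≤ a) (lam : Module.Dual K S.h) :
    Submodule (UEA K a) (UEA K a) :=
  sSup {J | S.vIdealSub a ha lam ≤ J ∧ J ≠ ⊤}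

/-- The simple highest weight module `L_a(λ)` of a subalgebra `h ≤ a ≤ g`. -/
abbrev SimpleHWSub (a : LieSubalgebra K g) (ha : S.h ≤ a) (lam : Module.Dual K S.h) : Type :=
  (UEA K a) ⧸ S.radIdealSub a ha lam

end RootReductive

/-- The subquotient `B/(A ∩ B)` of a module attached to two submodules `A ≤ B`. -/
abbrev subquot {R M : Type} [Ring R] [AddCommGroup M] [Module R M]
    (A B : Submodule R M) : Type :=
  B ⧸ (A.comap B.subtype)

/-- The multiplicity `[M : N]` of a module `N` in a module `M`: the supremum, over all
finite filtrations of `M`, of the number of subquotients isomorphic to `N`. -/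
noncomputable def jhMult (R M N : Type) [Ring R] [AddCommGroup M] [Module R M]
    [AddCommGroup N] [Module R N] : Cardinal.{0} :=
  ⨆ (n : ℕ), ⨆ (F : Fin (n+1) →o Submodule R M),
    ⨆ (_ : F 0 = ⊥ ∧ F (Fin.last n) = ⊤),
      (Nat.card {i : Fin n //
        Nonempty ((subquot (F i.castSucc) (F i.succ)) ≃ₗ[R] N)} : Cardinal)

/-- The `K`-vector space structure on the space of `U(L)`-module homomorphisms,
via the central embedding `K → U(L)`. -/
def homKModule (L : Type) [LieRing L] [LieAlgebra K L] (M N : Type)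
    [AddCommGroup M] [Module (UEA K L) M] [AddCommGroup N] [Module (UEA K L) N] :
    Module K (M →ₗ[UEA K L] N) :=
  letI : Module K N := Module.compHom N (algebraMap K (UEA K L))
  letI : SMulCommClass (UEA K L) K N :=
    ⟨fun u c n => by
      show u • ((algebraMap K (UEA K L) c) • n) = (algebraMap K (UEA K L) c) • (u • n)
      rw [smul_smul, smul_smul, Algebra.commutes]⟩
  inferInstance

/-- The dimension over `K` of the space of `U(L)`-module homomorphisms. -/
noncomputable def homDim (L : Type) [LieRing L] [LieAlgebra K L] (M N : Type)
    [AddCommGroup M] [Module (UEA K L) M] [AddCommGroup N] [Module (UEA K L) N] :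
    Cardinal :=
  letI := homKModule K L M N
  Module.rank K (M →ₗ[UEA K L] N)

namespace RootReductive

variable {K g} (S : RootReductive K g)

/-- The weight set of weight `χ` of a `U(g)`-module. -/
def wtSet (M : Type) [AddCommGroup M] [Module (UEA K g) M]
    (χ : Module.Dual K S.h) : Set M :=
  {m | ∀ H : S.h, (ι K (H : g)) • m = (algebraMap K (UEA K g) (χ H)) • m}

/-- A `U(g)`-module is a weight module (i.e. semisimple as an `h`-module) if it is the
sum of its weight spaces. -/
def IsWeightMod (M : Type) [AddCommGroup M] [Module (UEA K g) M] : Prop :=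
  ∀ m : M, m ∈ AddSubgroup.closure (⋃ χ : Module.Dual K S.h, S.wtSet M χ)

/-- The support of a module: the set of weights whose weight space is non-zero. -/
def suppSet (M : Type) [AddCommGroup M] [Module (UEA K g) M] :
    Set (Module.Dual K S.h) :=
  {χ | ∃ m ∈ S.wtSet M χ, m ≠ 0}

/-- Local finiteness of the action of the Borel subalgebra `b`:
every vector lies in a finite-dimensional `b`-stable subspace. -/
def IsLocFin (M : Type) [AddCommGroup M] [Module (UEA K g) M] : Prop :=
  letI : Module K M := Module.compHom M (algebraMap K (UEA K g))
  ∀ m : M, ∃ N : Submodule K M, m ∈ N ∧ FiniteDimensional K N ∧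
    ∀ x ∈ S.b, ∀ v ∈ N, (ι K x) • v ∈ N

/-- The module has finite-dimensional weight spaces. -/
def HasFinDimWt (M : Type) [AddCommGroup M] [Module (UEA K g) M] : Prop :=
  letI : Module K M := Module.compHom M (algebraMap K (UEA K g))
  ∀ χ : Module.Dual K S.h, ∃ s : Finset M,
    ↑s ⊆ S.wtSet M χ ∧ S.wtSet M χ ⊆ (Submodule.span K (s : Set M) : Set M)

/-- Membership in category `O`: a weight module with locally finite `b`-action. -/
def InO (M : Type) [AddCommGroup M] [Module (UEA K g) M] : Prop :=
  S.IsWeightMod M ∧ S.IsLocFin M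

/-- A subset of `h^*` is an ideal for the order `≤`. -/
def IsIdeal (A : Set (Module.Dual K S.h)) : Prop :=
  ∀ lam ∈ A, ∀ μ, S.wle μ lam → μ ∈ A

/-- A subset of `h^*` is upper finite. -/
def UpperFinite (A : Set (Module.Dual K S.h)) : Prop :=
  ∀ μ ∈ A, {lam ∈ A | S.wle μ lam}.Finite

/-- The dot action of a linear automorphism of `h^*`: `w · λ = w(λ+ρ) - ρ`. -/
def dot (w : Module.Dual K S.h ≃ₗ[K] Module.Dual K S.h)
    (lam : Module.Dual K S.h) : Module.Dual K S.h :=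
  w (lam + S.ρ) - S.ρ

/-- The dot action of the reflection `r_α`: `r_α · λ = λ - (λ+ρ)(Hα) α`. -/
def rdot (α lam : Module.Dual K S.h) : Module.Dual K S.h :=
  lam - ((lam + S.ρ) (S.coroot α)) • α

/-- One step of the Bruhat order: `μ = r_α · λ ≤ λ` for a positive root `α`. -/
def bruhatStep (μ lam : Module.Dual K S.h) : Prop :=
  ∃ α ∈ S.Φp, μ = S.rdot α lam ∧ S.wle μ lam

/-- The Bruhat order on `h^*`. -/
def bruhat : Module.Dual K S.h → Module.Dual K S.h → Prop :=
  Relation.ReflTransGen (fun μ lam => S.bruhatStep μ lam)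

/-- The set of reflections `r_α`, `α ∈ Φ`, as linear automorphisms of `h^*`. -/
def reflSet : Set (Module.Dual K S.h ≃ₗ[K] Module.Dual K S.h) :=
  {w | ∃ α ∈ S.Φ, ∀ lam, w lam = lam - (lam (S.coroot α)) • α}

/-- The Weyl group `W`, generated by all reflections. -/
def weylGroup : Subgroup (Module.Dual K S.h ≃ₗ[K] Module.Dual K S.h) :=
  Subgroup.closure S.reflSet

/-- The integral Weyl group `W[λ]` of a weight. -/
def intWeyl (lam : Module.Dual K S.h) :
    Set (Module.Dual K S.h ≃ₗ[K] Module.Dual K S.h) :=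
  {w | w ∈ S.weylGroup ∧ S.dot w lam - lam ∈ S.zroots}

/-- The orbit `[[λ]] = W[λ] · λ`. -/
def orbit (lam : Module.Dual K S.h) : Set (Module.Dual K S.h) :=
  {μ | ∃ w ∈ S.intWeyl lam, μ = S.dot w lam}

/-- An integral weight. -/
def IsIntegral (lam : Module.Dual K S.h) : Prop :=
  ∀ w ∈ S.weylGroup, S.dot w lam - lam ∈ S.zroots

/-- A dominant weight. -/
def IsDominant (lam : Module.Dual K S.h) : Prop :=
  ∀ w ∈ S.intWeyl lam, S.wle (S.dot w lam) lam

/-- An antidominant weight. -/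
def IsAntidominant (lam : Module.Dual K S.h) : Prop :=
  ∀ w ∈ S.intWeyl lam, S.wle lam (S.dot w lam)

/-- A regular weight. -/
def IsRegular (lam : Module.Dual K S.h) : Prop :=
  ∀ w ∈ S.intWeyl lam, S.dot w lam = lam → w = 1

/-- A Verma flag with highest weights in a prescribed set. -/
def HasVermaFlagIn (A : Set (Module.Dual K S.h)) (M : Type) [AddCommGroup M]
    [Module (UEA K g) M] : Prop :=
  ∃ (n : ℕ) (F : Fin (n+1) →o Submodule (UEA K g) M), F 0 = ⊥ ∧ F (Fin.last n) = ⊤ ∧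
    ∀ i : Fin n, ∃ lam ∈ A,
      Nonempty ((subquot (F i.castSucc) (F i.succ)) ≃ₗ[UEA K g] S.Verma lam)

/-- A (finite) Verma flag. -/
def HasVermaFlag (M : Type) [AddCommGroup M] [Module (UEA K g) M] : Prop :=
  S.HasVermaFlagIn Set.univ M

end RootReductive

section JointWeights

variable {F M T ι : Type*} [Field F] [AddCommGroup M] [Module F M]

/-- The joint eigenspace of a family of operators. -/
def jointEig (D : T → Module.End F M) (w : T → F) : Submodule F M where
  carrier := {m | ∀ t, D t m = w t • m}
  add_mem' := by intro a b ha hb t; rw [map_add, ha t, hb t, smul_add]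
  zero_mem' := by intro t; rw [map_zero, smul_zero]
  smul_mem' := by intro c m hm t; rw [map_smul, hm t, smul_comm]

/-- A subspace stable under a family of operators contains the weight components of its
elements. -/
theorem jointEig_component_mem {D : T → Module.End F M} (N : Submodule F M)
    (hN : ∀ t, ∀ m ∈ N, D t m ∈ N) {w : ι → T → F} (hw : Function.Injective w) (s : Finset ι) :
    ∀ x : ι → M, (∀ i ∈ s, x i ∈ jointEig D (w i)) → ∑ i ∈ s, x i ∈ N →
      ∀ i ∈ s, x i ∈ N := by
  classical
  induction s using Finset.induction_on with
  | empty => simp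
  | insert j s hj ih =>
    intro x hx hsum
    have key : ∀ i ∈ s, x i ∈ N := by
      intro i hi
      have hij : w i ≠ w j := fun h => hj (hw h ▸ hi)
      obtain ⟨t, ht⟩ := Function.ne_iff.1 hij
      have h1 : ∑ i ∈ s, (w i t - w j t) • x i ∈ N := by
        have h2 : D t (∑ i ∈ insert j s, x i) - w j t • ∑ i ∈ insert j s, x i ∈ N :=
          N.sub_mem (hN t _ hsum) (N.smul_mem _ hsum)
        have h3 : D t (∑ i ∈ insert j s, x i) - w j t • ∑ i ∈ insert j s, x i
            = ∑ i ∈ insert j s, (w i t - w j t) • x i := by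
          rw [map_sum, Finset.smul_sum, ← Finset.sum_sub_distrib]
          exact Finset.sum_congr rfl fun i hi => by rw [hx i hi t, sub_smul]
        rw [h3, Finset.sum_insert hj, sub_self, zero_smul, zero_add] at h2
        exact h2
      have h4 := ih (fun i => (w i t - w j t) • x i)
        (fun i hi => Submodule.smul_mem _ _ (hx i (Finset.mem_insert_of_mem hi))) h1 i hi
      exact (N.smul_mem_iff (sub_ne_zero.2 ht)).1 h4
    intro i hi
    rcases Finset.mem_insert.1 hi with rfl | hi
    · rw [Finset.sum_insert hj] at hsum
      exact (N.add_mem_iff_left (N.sum_mem key)).1 hsum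
    · exact key i hi

theorem iSupIndep_jointEig (D : T → Module.End F M) {w : ι → T → F}
    (hw : Function.Injective w) : iSupIndep fun i => jointEig D (w i) := by
  classical
  intro i
  rw [Submodule.disjoint_def]
  intro x hx hx'
  obtain ⟨f, hf, hfx⟩ := (Submodule.mem_iSup_iff_exists_finsupp _ _).1 hx'
  have hfi : f i = 0 := by simpa using hf i
  have hfj : ∀ j, j ≠ i → f j ∈ jointEig D (w j) := fun j hj => by simpa [hj] using hf j
  have hsum : ∑ j ∈ insert i f.support, (if j = i then -x else f j) ∈ (⊥ : Submodule F M) := by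
    rw [Finset.sum_insert (by simp [hfi]), if_pos rfl, Submodule.mem_bot, ← hfx,
      Finsupp.sum, neg_add_eq_zero]
    refine Finset.sum_congr rfl fun j hj => ?_
    rw [if_neg]
    rintro rfl
    simp [hfi] at hj
  have := jointEig_component_mem (D := D) ⊥ (by simp) hw (insert i f.support)
    (fun j => if j = i then -x else f j) (by
      intro j _
      by_cases h : j = i
      · subst h; simpa using hx
      · simpa [h] using hfj j h) hsum i (Finset.mem_insert_self _ _)
  simpa using this

/-- A homogeneous element of the span of homogeneous vectors is in the span of those of
the same degree. -/
theorem mem_span_inter_of_iSupIndep {A : ι → Submodule F M} (hA : iSupIndep A) {s : Set M}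
    (hs : ∀ v ∈ s, ∃ i, v ∈ A i) {i : ι} {x : M} (hx : x ∈ A i)
    (hxs : x ∈ Submodule.span F s) : x ∈ Submodule.span F (s ∩ A i) := by
  have h1 : Submodule.span F s ≤ Submodule.span F (s ∩ A i) ⊔ ⨆ (j) (_ : j ≠ i), A j := by
    rw [Submodule.span_le]
    intro v hv
    obtain ⟨j, hj⟩ := hs v hv
    by_cases hji : j = i
    · subst hji
      exact Submodule.mem_sup_left (Submodule.subset_span ⟨hv, hj⟩)
    · exact Submodule.mem_sup_right (Submodule.mem_iSup_of_mem j (Submodule.mem_iSup_of_mem hji hj))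
  obtain ⟨y, hy, z, hz, hyz⟩ := Submodule.mem_sup.1 (h1 hxs)
  have hyA : y ∈ A i := (Submodule.span_le.2 Set.inter_subset_right) hy
  have hzA : z ∈ A i := by
    have : z = x - y := by rw [← hyz]; abel
    rw [this]; exact (A i).sub_mem hx hyA
  have : z = 0 := Submodule.disjoint_def.1 (hA i) z hzA hz
  rw [this, add_zero] at hyz
  rwa [← hyz]

/-- A finite-dimensional space spanned by homogeneous vectors has a homogeneous basis. -/
theorem exists_homogeneous_basis [FiniteDimensional F M] {A : ι → Submodule F M}
    (hA : ⨆ i, A i = ⊤) : ∃ (n : ℕ) (b : Module.Basis (Fin n) F M) (ω : Fin n → ι),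
      ∀ k, b k ∈ A (ω k) := by
  have hs : ⊤ ≤ Submodule.span F (⋃ i, (A i : Set M)) := by
    rw [← hA, iSup_le_iff]
    intro i x hx
    exact Submodule.subset_span (Set.mem_iUnion.2 ⟨i, hx⟩)
  let b := Module.Basis.ofSpan hs
  have : Fintype ((linearIndepOn_empty F id).extend (Set.empty_subset (⋃ i, (A i : Set M)))) :=
    FiniteDimensional.fintypeBasisIndex b
  have hb : ∀ k, ∃ i, b k ∈ A i := fun k => by
    have := Module.Basis.ofSpan_subset hs (Set.mem_range_self k)
    exact Set.mem_iUnion.1 this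
  choose ω hω using hb
  refine ⟨_, b.reindex (Fintype.equivFin _), fun k => ω ((Fintype.equivFin _).symm k), fun k => ?_⟩
  rw [Module.Basis.reindex_apply]
  exact hω _

end JointWeights

namespace RootReductive

variable {K g} (S : RootReductive K g)

/-- The weight spaces of the adjoint representation. -/
abbrev W (χ : Module.Dual K S.h) : Submodule K g := rootSp K g S.h χ

theorem mem_W {χ : Module.Dual K S.h} {x : g} :
    x ∈ S.W χ ↔ ∀ H : S.h, ⁅(H : g), x⁆ = χ H • x := Iff.rfl

theorem h_abelian {x y : g} (hx : x ∈ S.h) (hy : y ∈ S.h) : ⁅x, y⁆ = 0 := by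
  have h1 := S.τ_h _ (S.h.lie_mem hx hy)
  rw [S.τ_anti, S.τ_h x hx, S.τ_h y hy, ← lie_skew] at h1
  have h2 : (2 : K) • ⁅x, y⁆ = 0 := by
    rw [two_smul]; nth_rewrite 1 [← h1]; exact neg_add_cancel _
  exact (smul_eq_zero.1 h2).resolve_left two_ne_zero

theorem h_le_W_zero : S.h.toSubmodule ≤ S.W 0 := fun x hx H => by
  rw [S.h_abelian H.2 hx]; simp

variable {S} in
theorem lie_mem_W {χ ψ : Module.Dual K S.h} {x y : g} (hx : x ∈ S.W χ) (hy : y ∈ S.W ψ) :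
    ⁅x, y⁆ ∈ S.W (χ + ψ) := fun H => by
  rw [leibniz_lie, hx H, hy H, lie_smul, smul_lie, LinearMap.add_apply, add_smul]

theorem iSupIndep_W : iSupIndep S.W :=
  iSupIndep_jointEig (fun H : S.h => (LieAlgebra.ad K g (H : g)))
    (w := fun χ : Module.Dual K S.h => ⇑χ) DFunLike.coe_injective

theorem W_inter {χ ψ : Module.Dual K S.h} {x : g} (hx : x ∈ S.W χ) (hy : x ∈ S.W ψ)
    (h : χ ≠ ψ) : x = 0 :=
  Submodule.disjoint_def.1 (S.iSupIndep_W.pairwiseDisjoint h) x hx hy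

theorem eq_of_mem_W {χ ψ : Module.Dual K S.h} {x : g} (hx : x ∈ S.W χ) (hy : x ∈ S.W ψ)
    (h : x ≠ 0) : χ = ψ := by
  by_contra hne
  exact h (S.W_inter hx hy hne)

theorem iSup_W : ⨆ χ, S.W χ = ⊤ := by
  rw [eq_top_iff, ← S.rootdec]
  refine sup_le (S.h_le_W_zero.trans (le_iSup S.W 0)) (iSup₂_le fun α _ => le_iSup S.W α)

theorem root_ne_zero {α : Module.Dual K S.h} (h : α ∈ S.Φ) : α ≠ 0 := ((S.root_iff α).1 h).1

/-- The homogeneous elements appearing in the root decomposition. -/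
theorem span_rootdec : Submodule.span K ((S.h : Set g) ∪ ⋃ α ∈ S.Φ, (S.W α : Set g)) = ⊤ := by
  rw [eq_top_iff, ← S.rootdec]
  refine sup_le (fun x hx => Submodule.subset_span (Or.inl hx)) (iSup₂_le fun α hα x hx =>
    Submodule.subset_span (Or.inr (Set.mem_biUnion hα hx)))

theorem W_zero : S.W 0 = S.h.toSubmodule := by
  refine le_antisymm (fun x hx => ?_) S.h_le_W_zero
  have h1 := mem_span_inter_of_iSupIndep S.iSupIndep_W
    (s := (S.h : Set g) ∪ ⋃ α ∈ S.Φ, (S.W α : Set g)) (by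
      rintro v (hv | hv)
      · exact ⟨0, S.h_le_W_zero hv⟩
      · obtain ⟨α, _, hv⟩ := Set.mem_iUnion₂.1 hv
        exact ⟨α, hv⟩) hx (by rw [S.span_rootdec]; trivial)
  refine (Submodule.span_le.2 ?_) h1
  rintro v ⟨hv | hv, hv0⟩
  · exact hv
  · obtain ⟨α, hα, hv⟩ := Set.mem_iUnion₂.1 hv
    rw [S.W_inter hv hv0 (S.root_ne_zero hα)]
    exact Submodule.zero_mem _

theorem mem_h_of_W_zero {x : g} (hx : x ∈ S.W 0) : x ∈ S.h := by
  rw [S.W_zero] at hx; exact hx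

theorem root_of_mem {χ : Module.Dual K S.h} {x : g} (hx : x ∈ S.W χ) (h0 : x ≠ 0)
    (hχ : χ ≠ 0) : χ ∈ S.Φ :=
  (S.root_iff χ).2 ⟨hχ, fun h => h0 (by simpa [h] using hx)⟩

theorem pos_or_neg {α : Module.Dual K S.h} (h : α ∈ S.Φ) : α ∈ S.Φp ∨ -α ∈ S.Φp := by
  rw [S.pos_union] at h; exact h

theorem neg_pos_root {α : Module.Dual K S.h} (h : α ∈ S.Φp) : -α ∈ S.Φ := by
  rw [S.pos_union]; exact Or.inr (by simpa using h)

theorem neg_root {α : Module.Dual K S.h} (h : α ∈ S.Φ) : -α ∈ S.Φ := by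
  rcases S.pos_or_neg h with h | h
  · exact S.neg_pos_root h
  · exact S.pos_subset h

theorem not_pos_neg {α : Module.Dual K S.h} (h : α ∈ S.Φp) : -α ∉ S.Φp := fun h' =>
  Set.disjoint_left.1 S.pos_disjoint h (by simpa using h')

theorem exists_level {s : Set g} (hs : s.Finite) : ∃ n, s ⊆ S.gc n := by
  induction s, hs using Set.Finite.induction_on with
  | empty => exact ⟨0, Set.empty_subset _⟩
  | @insert a s _ _ ih =>
    obtain ⟨n, hn⟩ := ih
    obtain ⟨m, hm⟩ := S.gc_exhausts a
    refine ⟨max n m, Set.insert_subset (S.gc_mono (le_max_right _ _) hm)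
      (hn.trans (S.gc_mono (le_max_left _ _)))⟩

theorem exists_W_generator {α : Module.Dual K S.h} (h : α ∈ S.Φ) :
    ∃ x ∈ S.W α, x ≠ 0 ∧ ∀ y ∈ S.W α, ∃ c : K, y = c • x := by
  obtain ⟨v, hv, hv'⟩ := rank_eq_one_iff.1 (S.root_dim α h)
  refine ⟨v, v.2, by simpa using hv, fun y hy => ?_⟩
  obtain ⟨c, hc⟩ := hv' ⟨y, hy⟩
  exact ⟨c, by simpa using (congrArg Subtype.val hc).symm⟩

theorem W_eq_smul {α : Module.Dual K S.h} (h : α ∈ S.Φ) {x y : g} (hx : x ∈ S.W α)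
    (h0 : x ≠ 0) (hy : y ∈ S.W α) : ∃ c : K, y = c • x := by
  obtain ⟨z, _, _, hz⟩ := S.exists_W_generator h
  obtain ⟨a, rfl⟩ := hz x hx
  obtain ⟨b, rfl⟩ := hz y hy
  have ha : a ≠ 0 := fun ha => h0 (by simp [ha])
  exact ⟨b / a, by rw [smul_smul, div_mul_cancel₀ _ ha]⟩

/-- A subspace is homogeneous if it is spanned by its weight vectors. -/
def IsHomog (N : Submodule K g) : Prop := N ≤ ⨆ χ, N ⊓ S.W χ

theorem isHomog_iff_stable {N : Submodule K g} :
    S.IsHomog N ↔ ∀ H ∈ S.h, ∀ x ∈ N, ⁅H, x⁆ ∈ N := by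
  constructor
  · intro hN H hH x hx
    replace hx := hN hx
    induction hx using Submodule.iSup_induction' with
    | mem χ y hy => rw [hy.2 ⟨H, hH⟩]; exact N.smul_mem _ hy.1
    | zero => simp
    | add y z _ _ h1 h2 => rw [lie_add]; exact N.add_mem h1 h2
  · intro hN x hx
    have hx' : x ∈ ⨆ χ, S.W χ := by rw [S.iSup_W]; trivial
    obtain ⟨f, hf, rfl⟩ := (Submodule.mem_iSup_iff_exists_finsupp _ _).1 hx'
    have := jointEig_component_mem (D := fun H : S.h => (LieAlgebra.ad K g (H : g))) N
      (fun t m hm => hN t t.2 m hm) (w := fun χ : Module.Dual K S.h => ⇑χ)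
      DFunLike.coe_injective f.support f (fun i _ => hf i) hx
    exact Submodule.sum_mem _ fun i hi => Submodule.mem_iSup_of_mem i ⟨this i hi, hf i⟩

theorem isHomog_gc (n : ℕ) : S.IsHomog (S.gc n).toSubmodule := by
  rw [IsHomog]
  conv_lhs => rw [S.gc_rootdec n]
  refine sup_le ?_ (iSup₂_le fun α _ => le_iSup (fun χ => (S.gc n).toSubmodule ⊓ S.W χ) α)
  rw [← S.W_zero]
  exact le_iSup (fun χ => (S.gc n).toSubmodule ⊓ S.W χ) 0

end RootReductive

section Generic

/-- Only finitely many members of an independent family meet a finite-dimensional subspace. -/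
theorem finite_setOf_inter_ne {F M ι : Type*} [Field F] [AddCommGroup M] [Module F M]
    {A : ι → Submodule F M} (hA : iSupIndep A) (N : Submodule F M) [FiniteDimensional F N] :
    {i | ∃ v ∈ N, v ∈ A i ∧ v ≠ 0}.Finite := by
  set s := {i | ∃ v ∈ N, v ∈ A i ∧ v ≠ 0} with hs
  have h : ∀ i : s, ∃ v ∈ N, v ∈ A i ∧ v ≠ 0 := fun i => i.2
  choose v hv1 hv2 hv3 using h
  have h1 : LinearIndependent F v :=
    (hA.comp (Subtype.val_injective (p := (· ∈ s)))).linearIndependent _ hv2 hv3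
  have h2 : LinearIndependent F (fun i => (⟨v i, hv1 i⟩ : N)) :=
    LinearIndependent.of_comp N.subtype h1
  have := h2.finite
  exact Set.toFinite s

/-- A scalar commutator on a nonzero finite-dimensional space vanishes. -/
theorem commutator_scalar_eq_zero {F M : Type*} [Field F] [CharZero F] [AddCommGroup M]
    [Module F M] (U : Submodule F M) [FiniteDimensional F U] (a b : Module.End F M)
    (ha : ∀ u ∈ U, a u ∈ U) (hb : ∀ u ∈ U, b u ∈ U) (c : F)
    (hc : ∀ u ∈ U, a (b u) - b (a u) = c • u) (hU : U ≠ ⊥) : c = 0 := by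
  have h1 : (a.restrict ha) * (b.restrict hb) - (b.restrict hb) * (a.restrict ha)
      = c • (1 : Module.End F U) := by
    ext u
    simpa using hc u u.2
  have h2 := congrArg (LinearMap.trace F U) h1
  rw [map_sub, LinearMap.trace_mul_comm, sub_self, map_smul, LinearMap.trace_one, smul_eq_mul] at h2
  rcases mul_eq_zero.1 h2.symm with h | h
  · exact h
  · exfalso
    rw [Nat.cast_eq_zero, Submodule.finrank_eq_zero] at h
    exact hU h

variable {F L M : Type*} [Field F] [CharZero F] [LieRing L] [LieAlgebra F L] [AddCommGroup M]
    [Module F M] [LieRingModule L M] [LieModule F L M]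

/-- A primitive vector killed by a power of the lowering operator has weight a natural number. -/
theorem IsSl2Triple.primitive_weight_nat {h e f : L} (t : IsSl2Triple h e f) {m : M} {μ : F}
    (P : IsSl2Triple.HasPrimitiveVectorWith t m μ)
    (hk : ∃ k, ((LieModule.toEnd F L M f) ^ k) m = 0) : ∃ n : ℕ, μ = n := by
  classical
  have hspec := Nat.find_spec hk
  obtain ⟨n, hn⟩ : ∃ n, Nat.find hk = n + 1 := by
    refine Nat.exists_eq_succ_of_ne_zero fun h0 => ?_
    rw [h0] at hspec
    exact P.ne_zero (by simpa using hspec)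
  have hmin := Nat.find_min hk (m := n) (by omega)
  rw [hn] at hspec
  have h1 := P.lie_e_pow_succ_toEnd_f n
  rw [hspec, lie_zero, eq_comm, smul_eq_zero] at h1
  have h2 := h1.resolve_right hmin
  have h3 : ((n : F) + 1) ≠ 0 := by exact_mod_cast Nat.succ_ne_zero n
  refine ⟨n, ?_⟩
  have := (mul_eq_zero.1 h2).resolve_left h3
  exact sub_eq_zero.1 this

end Generic

namespace RootReductive

variable {K g} (S : RootReductive K g)

/-- A homogeneous finite-dimensional subspace has a basis of weight vectors. -/
theorem exists_weight_basis {N : Submodule K g} [FiniteDimensional K N] (hN : S.IsHomog N) :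
    ∃ (n : ℕ) (b : Module.Basis (Fin n) K N) (ω : Fin n → Module.Dual K S.h),
      ∀ k, (b k : g) ∈ S.W (ω k) := by
  refine exists_homogeneous_basis (A := fun χ => (S.W χ).comap N.subtype) ?_
  rw [eq_top_iff]
  rintro ⟨x, hx⟩ -
  have h1 := hN hx
  induction h1 using Submodule.iSup_induction' with
  | mem χ y hy => exact Submodule.mem_iSup_of_mem χ hy.2
  | zero => exact Submodule.zero_mem _
  | add y z hy hz h1 h2 =>
    have key : (⨆ χ, N ⊓ S.W χ) ≤ N := iSup_le fun _ => inf_le_left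
    exact Submodule.add_mem _ (h1 (key hy)) (h2 (key hz))

theorem exists_weight_eq {N : Submodule K g} {n : ℕ}
    (b : Module.Basis (Fin n) K N) (ω : Fin n → Module.Dual K S.h)
    (hb : ∀ k, (b k : g) ∈ S.W (ω k)) {χ : Module.Dual K S.h} {x : g} (hx : x ∈ N)
    (hxχ : x ∈ S.W χ) (h0 : x ≠ 0) : ∃ i, ω i = χ := by
  by_contra! hne
  have hspan : x ∈ Submodule.span K (Set.range fun k => (b k : g)) := by
    have h1 : (⟨x, hx⟩ : N) ∈ Submodule.span K (Set.range b) := by rw [b.span_eq]; trivial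
    have h2 := Submodule.mem_map_of_mem (f := N.subtype) h1
    rw [Submodule.map_span, ← Set.range_comp] at h2
    exact h2
  have h3 := mem_span_inter_of_iSupIndep S.iSupIndep_W
    (by rintro _ ⟨k, rfl⟩; exact ⟨_, hb k⟩) hxχ hspan
  rw [Set.eq_empty_of_forall_notMem (s := (Set.range fun k => (b k : g)) ∩ S.W χ), 
    Submodule.span_empty] at h3
  · exact h0 h3
  · rintro _ ⟨⟨k, rfl⟩, hk⟩
    refine hne k (S.eq_of_mem_W (hb k) hk ?_)
    simpa using b.ne_zero k

section Killing

variable (a : LieSubalgebra K g) [FiniteDimensional K a]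

theorem killing_eq_zero (ha : S.IsHomog a.toSubmodule) {χ δ : Module.Dual K S.h} {x y : a}
    (hx : (x : g) ∈ S.W χ) (hy : (y : g) ∈ S.W δ) (hne : χ + δ ≠ 0) :
    killingForm K a x y = 0 := by
  obtain ⟨H, hH⟩ : ∃ H, (χ + δ) H ≠ 0 := by
    by_contra! h
    exact hne (LinearMap.ext h)
  rw [killingForm_apply_apply]
  have hst := S.isHomog_iff_stable.1 ha H H.2
  let D : Module.End K a := (LieAlgebra.ad K g (H : g)).restrict hst
  let T : Module.End K a := LieAlgebra.ad K a x ∘ₗ LieAlgebra.ad K a y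
  have h1 : D * T - T * D = ((χ + δ) H) • T := by
    ext z
    have hx' := hx H
    have hy' := hy H
    change (⁅(H : g), ⁅(x : g), ⁅(y : g), (z : g)⁆⁆⁆ : g) - ⁅(x : g), ⁅(y : g), ⁅(H : g), (z : g)⁆⁆⁆
      = (χ H + δ H) • ⁅(x : g), ⁅(y : g), (z : g)⁆⁆
    rw [leibniz_lie (H : g) (x : g), hx', leibniz_lie (H : g) (y : g), hy', lie_add, smul_lie,
      smul_lie, lie_smul, add_smul]
    abel
  have h2 := congrArg (LinearMap.trace K a) h1
  rw [map_sub, LinearMap.trace_mul_comm, sub_self, map_smul, smul_eq_mul] at h2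
  exact (mul_eq_zero.1 h2.symm).resolve_left hH

theorem exists_killing_weights (ha : S.IsHomog a.toSubmodule) :
    ∃ (n : ℕ) (ω : Fin n → Module.Dual K S.h),
      (∀ i, ∃ x ∈ a, x ∈ S.W (ω i) ∧ x ≠ 0) ∧
      (∀ χ, ∀ x ∈ a, x ∈ S.W χ → x ≠ 0 → ∃ i, ω i = χ) ∧
      ∀ (H H' : S.h) (hH : (H : g) ∈ a) (hH' : (H' : g) ∈ a),
        killingForm K a ⟨H, hH⟩ ⟨H', hH'⟩ = ∑ i, ω i H * ω i H' := by
  have : FiniteDimensional K a.toSubmodule := ‹_›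
  obtain ⟨n, b, ω, hb⟩ := S.exists_weight_basis ha
  change Module.Basis (Fin n) K a at b
  refine ⟨n, ω, fun i => ⟨b i, (b i).2, hb i, ?_⟩, fun χ x hx hχ h0 =>
    S.exists_weight_eq b ω hb hx hχ h0, fun H H' hH hH' => ?_⟩
  · simpa using b.ne_zero i
  · rw [killingForm_apply_apply, LinearMap.trace_eq_matrix_trace K b, Matrix.trace]
    refine Finset.sum_congr rfl fun i _ => ?_
    rw [Matrix.diag_apply, LinearMap.toMatrix_apply]
    have h1 : (LieAlgebra.ad K a ⟨H, hH⟩ ∘ₗ LieAlgebra.ad K a ⟨H', hH'⟩) (b i)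
        = (ω i H * ω i H') • b i := by
      apply Subtype.ext
      have e1 := hb i H
      have e2 := hb i H'
      simp only [LinearMap.comp_apply, LieAlgebra.ad_apply, LieSubalgebra.coe_bracket]
      rw [e2, lie_smul, e1, smul_smul, mul_comm]
      rfl
    erw [h1]
    simp

end Killing

end RootReductive

namespace RootReductive

variable {K g} (S : RootReductive K g)

theorem root_apply_lie_ne_zero {α : Module.Dual K S.h} (hα : α ∈ S.Φ) {e f : g}
    (he : e ∈ S.W α) (hf : f ∈ S.W (-α)) (he0 : e ≠ 0) (hf0 : f ≠ 0) (H : S.h)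
    (hH : (H : g) = ⁅e, f⁆) : α H ≠ 0 := by
  intro hα0
  obtain ⟨H', hH'⟩ : ∃ H', α H' ≠ 0 := by
    by_contra! h
    exact S.root_ne_zero hα (LinearMap.ext h)
  obtain ⟨n, hn⟩ := S.exists_level (s := {e, f, (H' : g)}) (by simp)
  have hen : e ∈ S.gc n := hn (by simp)
  have hfn : f ∈ S.gc n := hn (by simp)
  have hHn : (H' : g) ∈ S.gc n := hn (by simp)
  have := S.gc_findim n
  have step1 : ∀ χ, ∀ x ∈ S.gc n, x ∈ S.W χ → x ≠ 0 → χ H = 0 := by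
    intro χ x hx hxχ hx0
    let U : Submodule K g := (S.gc n).toSubmodule ⊓
      Module.End.eigenspace (LieAlgebra.ad K g (H : g)) (χ H)
    have hmem : ∀ u, u ∈ U ↔ u ∈ S.gc n ∧ ⁅(H : g), u⁆ = χ H • u := fun u => by
      simp [U]
    have : FiniteDimensional K (S.gc n).toSubmodule := ‹_›
    have : FiniteDimensional K U := Submodule.finiteDimensional_of_le inf_le_left
    refine commutator_scalar_eq_zero U (LieAlgebra.ad K g e) (LieAlgebra.ad K g f) ?_ ?_ (χ H)
      ?_ ?_
    · intro u hu
      rw [hmem] at hu ⊢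
      refine ⟨(S.gc n).lie_mem hen hu.1, ?_⟩
      rw [LieAlgebra.ad_apply, leibniz_lie, he H, hα0, zero_smul, zero_lie, zero_add, hu.2,
        lie_smul]
    · intro u hu
      rw [hmem] at hu ⊢
      refine ⟨(S.gc n).lie_mem hfn hu.1, ?_⟩
      rw [LieAlgebra.ad_apply, leibniz_lie, hf H, LinearMap.neg_apply, hα0, neg_zero, zero_smul,
        zero_lie, zero_add, hu.2, lie_smul]
    · intro u hu
      rw [hmem] at hu
      rw [← hu.2, hH, LieAlgebra.ad_apply, LieAlgebra.ad_apply, LieAlgebra.ad_apply,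
        LieAlgebra.ad_apply, lie_lie]
    · intro h
      have : x ∈ U := (hmem x).2 ⟨hx, hxχ H⟩
      rw [h] at this
      exact hx0 (by simpa using this)
  have step2 : ∀ x ∈ S.gc n, ⁅(H : g), x⁆ = 0 := by
    intro x hx
    have h1 := S.isHomog_gc n hx
    induction h1 using Submodule.iSup_induction' with
    | mem χ y hy =>
      rw [hy.2 H]
      by_cases h0 : y = 0
      · simp [h0]
      · rw [step1 χ y hy.1 hy.2 h0, zero_smul]
    | zero => simp
    | add y z hy hz h1 h2 =>
      have key : (⨆ χ, (S.gc n).toSubmodule ⊓ S.W χ) ≤ (S.gc n).toSubmodule :=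
        iSup_le fun _ => inf_le_left
      rw [lie_add, h1 (key hy), h2 (key hz), add_zero]
  have step3 : ∀ y (hy : y ∈ S.gc n), killingForm K (S.gc n) ⟨e, hen⟩ ⟨y, hy⟩ = 0 := by
    intro y hy
    have h1 := S.isHomog_gc n hy
    induction h1 using Submodule.iSup_induction' with
    | mem δ y hy' =>
      by_cases hδ : α + δ = 0
      · obtain rfl : δ = -α := (neg_eq_of_add_eq_zero_right hδ).symm
        obtain ⟨c, hc⟩ := S.W_eq_smul (S.neg_root hα) hf hf0 hy'.2
        have h2 : (⟨y, hy⟩ : S.gc n) = c • ⟨f, hfn⟩ := Subtype.ext hc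
        rw [h2, map_smul]
        have h3 : killingForm K (S.gc n) ⁅(⟨H', hHn⟩ : S.gc n), ⟨e, hen⟩⁆ ⟨f, hfn⟩ = 0 := by
          rw [LieModule.traceForm_apply_lie_apply, killingForm_apply_apply]
          have h4 : LieAlgebra.ad K (S.gc n) ⁅(⟨e, hen⟩ : S.gc n), ⟨f, hfn⟩⁆ = 0 := by
            ext z
            have := step2 z z.2
            rw [hH] at this
            simpa using this
          rw [h4, LinearMap.comp_zero, map_zero]
        have h5 : ⁅(⟨H', hHn⟩ : S.gc n), (⟨e, hen⟩ : S.gc n)⁆ = α H' • (⟨e, hen⟩ : S.gc n) :=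
          Subtype.ext (he H')
        rw [h5, map_smul, LinearMap.smul_apply, smul_eq_mul] at h3
        rw [(mul_eq_zero.1 h3).resolve_left hH', smul_zero]
      · exact S.killing_eq_zero _ (S.isHomog_gc n) he hy'.2 hδ
    | zero => exact map_zero _
    | add y z hy1 hz1 h1 h2 =>
      have key : (⨆ χ, (S.gc n).toSubmodule ⊓ S.W χ) ≤ (S.gc n).toSubmodule :=
        iSup_le fun _ => inf_le_left
      have h3 := map_add (killingForm K (S.gc n) ⟨e, hen⟩) ⟨y, key hy1⟩ ⟨z, key hz1⟩
      rw [h1 (key hy1), h2 (key hz1), add_zero] at h3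
      exact h3
  have h6 : (⟨e, hen⟩ : S.gc n) ∈ LieAlgebra.center K (S.gc n) := by
    rw [← S.gc_reductive n]
    refine LieAlgebra.killingCompl_top_le_radical K (S.gc n) ?_
    rw [LieIdeal.mem_killingCompl]
    rintro ⟨y, hy⟩ -
    rw [LieModule.traceForm_comm]
    exact step3 y hy
  have h7 := (LieModule.mem_maxTrivSubmodule _ _ _ _).1 h6 ⟨H', hHn⟩
  have h8 : ⁅(H' : g), e⁆ = 0 := congrArg Subtype.val h7
  rw [he H'] at h8
  exact (smul_ne_zero hH' he0) h8

theorem exists_triple {α : Module.Dual K S.h} (hα : α ∈ S.Φ) :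
    ∃ e ∈ S.W α, ∃ f ∈ S.W (-α), ∃ H : S.h, e ≠ 0 ∧ f ≠ 0 ∧ ⁅e, f⁆ = (H : g) ∧ α H = 2 := by
  obtain ⟨e, he, he0, -⟩ := S.exists_W_generator hα
  obtain ⟨f, hf, hf0, -⟩ := S.exists_W_generator (S.neg_root hα)
  have hmem : ⁅e, f⁆ ∈ S.h := S.mem_h_of_W_zero (by simpa using lie_mem_W he hf)
  have h0 := S.root_apply_lie_ne_zero hα he hf he0 hf0 ⟨_, hmem⟩ rfl
  set c := α ⟨_, hmem⟩ with hc
  refine ⟨e, he, (2 / c) • f, (S.W _).smul_mem _ hf, (2 / c) • ⟨_, hmem⟩, he0, 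
    smul_ne_zero (div_ne_zero two_ne_zero h0) hf0, by simp, ?_⟩
  rw [map_smul, ← hc, smul_eq_mul, div_mul_cancel₀ _ h0]

open Classical in
/-- A chosen root vector of weight `α`. -/
def e (α : Module.Dual K S.h) : g :=
  if hα : α ∈ S.Φ then (S.exists_triple hα).choose else 0

open Classical in
/-- The root vector of weight `-α` completing `S.e α` to an `sl₂`-triple. -/
def f (α : Module.Dual K S.h) : g :=
  if hα : α ∈ S.Φ then (S.exists_triple hα).choose_spec.2.choose else 0

open Classical in
/-- The neutral element of the `sl₂`-triple attached to `α`. -/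
def hc (α : Module.Dual K S.h) : S.h :=
  if hα : α ∈ S.Φ then (S.exists_triple hα).choose_spec.2.choose_spec.2.choose else 0

theorem e_mem (α : Module.Dual K S.h) : S.e α ∈ S.W α := by
  unfold e
  split_ifs with hα
  · exact (S.exists_triple hα).choose_spec.1
  · exact Submodule.zero_mem _

theorem f_mem (α : Module.Dual K S.h) : S.f α ∈ S.W (-α) := by
  unfold f
  split_ifs with hα
  · exact (S.exists_triple hα).choose_spec.2.choose_spec.1
  · exact Submodule.zero_mem _

theorem lie_e_f (α : Module.Dual K S.h) : ⁅S.e α, S.f α⁆ = (S.hc α : g) := by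
  unfold e f hc
  split_ifs with hα
  · exact (S.exists_triple hα).choose_spec.2.choose_spec.2.choose_spec.2.2.1
  · simp

variable {S} in
theorem e_ne {α : Module.Dual K S.h} (hα : α ∈ S.Φ) : S.e α ≠ 0 := by
  unfold e
  rw [dif_pos hα]
  exact (S.exists_triple hα).choose_spec.2.choose_spec.2.choose_spec.1

variable {S} in
theorem f_ne {α : Module.Dual K S.h} (hα : α ∈ S.Φ) : S.f α ≠ 0 := by
  unfold f
  rw [dif_pos hα]
  exact (S.exists_triple hα).choose_spec.2.choose_spec.2.choose_spec.2.1

variable {S} in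
theorem root_hc {α : Module.Dual K S.h} (hα : α ∈ S.Φ) : α (S.hc α) = 2 := by
  unfold hc
  rw [dif_pos hα]
  exact (S.exists_triple hα).choose_spec.2.choose_spec.2.choose_spec.2.2.2

variable {S} in
theorem W_eq_smul_e {α : Module.Dual K S.h} (hα : α ∈ S.Φ) {x : g} (hx : x ∈ S.W α) :
    ∃ c : K, x = c • S.e α := S.W_eq_smul hα (S.e_mem α) (e_ne hα) hx

variable {S} in
theorem W_eq_smul_f {α : Module.Dual K S.h} (hα : α ∈ S.Φ) {x : g} (hx : x ∈ S.W (-α)) :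
    ∃ c : K, x = c • S.f α := S.W_eq_smul (S.neg_root hα) (S.f_mem α) (f_ne hα) hx

variable {S} in
theorem triple {α : Module.Dual K S.h} (hα : α ∈ S.Φ) :
    IsSl2Triple (S.hc α : g) (S.e α) (S.f α) where
  h_ne_zero := fun h => by
    have h1 := root_hc hα
    rw [show S.hc α = 0 from Subtype.ext h] at h1
    simp at h1
  lie_e_f := S.lie_e_f α
  lie_h_e_nsmul := by rw [S.e_mem α (S.hc α), root_hc hα, ← Nat.cast_smul_eq_nsmul K]; simp
  lie_h_f_nsmul := by
    rw [S.f_mem α (S.hc α), LinearMap.neg_apply, root_hc hα, ← Nat.cast_smul_eq_nsmul K]; simp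

theorem ad_pow_mem_W {α γ : Module.Dual K S.h} {x v : g} (hx : x ∈ S.W α) (hv : v ∈ S.W γ)
    (k : ℕ) : ((LieModule.toEnd K g g x) ^ k) v ∈ S.W (γ + k • α) := by
  induction k with
  | zero => simpa using hv
  | succ k ih =>
    rw [pow_succ', Module.End.mul_apply, succ_nsmul', add_left_comm]
    exact lie_mem_W hx ih

theorem ad_pow_eq_zero {α γ : Module.Dual K S.h} (hα : α ≠ 0) {x v : g} (hx : x ∈ S.W α)
    (hv : v ∈ S.W γ) : ∃ k, ((LieModule.toEnd K g g x) ^ k) v = 0 := by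
  by_contra! h
  obtain ⟨n, hn⟩ := S.exists_level (s := {x, v}) (by simp)
  have := S.gc_findim n
  have : FiniteDimensional K (S.gc n).toSubmodule := ‹_›
  have hmem : ∀ k, ((LieModule.toEnd K g g x) ^ k) v ∈ S.gc n := by
    intro k
    induction k with
    | zero => exact hn (by simp)
    | succ k ih =>
      rw [pow_succ', Module.End.mul_apply]
      exact (S.gc n).lie_mem (hn (by simp)) ih
  have hfin := finite_setOf_inter_ne S.iSupIndep_W (S.gc n).toSubmodule
  refine Set.infinite_of_injective_forall_mem (f := fun k : ℕ => γ + k • α) ?_ ?_ hfin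
  · intro k l hkl
    have h1 : (k : K) • α = (l : K) • α := by
      simpa [Nat.cast_smul_eq_nsmul] using hkl
    exact_mod_cast smul_left_injective K hα h1
  · intro k
    exact ⟨_, hmem k, S.ad_pow_mem_W hx hv k, h k⟩

/-- A weight annihilated by the raising operator of a root takes a natural value. -/
theorem weight_hc_nat {α γ : Module.Dual K S.h} (hα : α ∈ S.Φ) {v : g} (hv : v ∈ S.W γ)
    (h0 : v ≠ 0) (he : ⁅S.e α, v⁆ = 0) : ∃ n : ℕ, γ (S.hc α) = n :=
  IsSl2Triple.primitive_weight_nat (triple hα) (F := K) (m := v) ⟨h0, hv _, he⟩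
    (S.ad_pow_eq_zero (neg_ne_zero.2 (S.root_ne_zero hα)) (S.f_mem α) hv)

theorem weight_hc_neg_nat {α γ : Module.Dual K S.h} (hα : α ∈ S.Φ) {v : g} (hv : v ∈ S.W γ)
    (h0 : v ≠ 0) (he : ⁅S.f α, v⁆ = 0) : ∃ n : ℕ, γ (S.hc α) = -n := by
  obtain ⟨n, hn⟩ := IsSl2Triple.primitive_weight_nat (triple hα).symm (F := K) (m := v)
    (μ := - γ (S.hc α)) ⟨h0, by rw [neg_lie, hv, neg_smul], he⟩
    (S.ad_pow_eq_zero (S.root_ne_zero hα) (S.e_mem α) hv)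
  exact ⟨n, by rw [← hn, neg_neg]⟩

theorem exists_top {α γ : Module.Dual K S.h} (hα : α ∈ S.Φ) {v : g} (hv : v ∈ S.W γ)
    (h0 : v ≠ 0) : ∃ q : ℕ, ∃ w ∈ S.W (γ + q • α), w ≠ 0 ∧ ⁅S.e α, w⁆ = 0 := by
  classical
  have hex := S.ad_pow_eq_zero (S.root_ne_zero hα) (S.e_mem α) hv
  have hspec := Nat.find_spec hex
  obtain ⟨n, hn⟩ : ∃ n, Nat.find hex = n + 1 := by
    refine Nat.exists_eq_succ_of_ne_zero fun h1 => ?_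
    rw [h1] at hspec
    exact h0 (by simpa using hspec)
  have hmin := Nat.find_min hex (m := n) (by omega)
  rw [hn, pow_succ', Module.End.mul_apply] at hspec
  exact ⟨n, _, S.ad_pow_mem_W (S.e_mem α) hv n, hmin, hspec⟩

theorem weight_hc_int {α γ : Module.Dual K S.h} (hα : α ∈ S.Φ) {v : g} (hv : v ∈ S.W γ)
    (h0 : v ≠ 0) : ∃ m : ℤ, γ (S.hc α) = m := by
  obtain ⟨q, w, hw, hw0, hew⟩ := S.exists_top hα hv h0
  obtain ⟨n, hn⟩ := S.weight_hc_nat hα hw hw0 hew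
  refine ⟨n - 2 * q, ?_⟩
  rw [LinearMap.add_apply, LinearMap.smul_apply, root_hc hα, nsmul_eq_mul] at hn
  push_cast
  rw [← hn]; ring

theorem root_hc_int {α γ : Module.Dual K S.h} (hα : α ∈ S.Φ) (hγ : γ ∈ S.Φ) :
    ∃ m : ℤ, γ (S.hc α) = m := S.weight_hc_int hα (S.e_mem γ) (e_ne hγ)

theorem root_hc_nat {α β : Module.Dual K S.h} (hα : α ∈ S.Φ) (hβ : β ∈ S.Φ)
    (h0 : α + β ≠ 0) (h : α + β ∉ S.Φ) : ∃ n : ℕ, β (S.hc α) = n := by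
  refine S.weight_hc_nat hα (S.e_mem β) (e_ne hβ) ?_
  by_contra hne
  exact h (S.root_of_mem (lie_mem_W (S.e_mem α) (S.e_mem β)) hne h0)

theorem root_hc_neg_nat {α β : Module.Dual K S.h} (hα : α ∈ S.Φ) (hβ : β ∈ S.Φ)
    (h0 : β ≠ α) (h : β - α ∉ S.Φ) : ∃ n : ℕ, β (S.hc α) = -n := by
  refine S.weight_hc_neg_nat hα (S.e_mem β) (e_ne hβ) ?_
  by_contra hne
  have h1 := lie_mem_W (S.f_mem α) (S.e_mem β)
  rw [neg_add_eq_sub] at h1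
  exact h (S.root_of_mem h1 hne (sub_ne_zero.2 h0))

end RootReductive

section Rational

/-- The image in a field of the nonnegative rational numbers. -/
def ratCone (F : Type*) [Field F] [CharZero F] : AddSubmonoid F where
  carrier := {c | ∃ q : ℚ, 0 ≤ q ∧ c = q}
  add_mem' := by
    rintro _ _ ⟨q, hq, rfl⟩ ⟨r, hr, rfl⟩
    exact ⟨q + r, add_nonneg hq hr, by push_cast; rfl⟩
  zero_mem' := ⟨0, le_rfl, by simp⟩

variable {F : Type*} [Field F] [CharZero F]

theorem eq_zero_of_mem_ratCone {c : F} (hc : c ∈ ratCone F) (hc' : -c ∈ ratCone F) : c = 0 := by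
  obtain ⟨q, hq, rfl⟩ := hc
  obtain ⟨r, hr, h⟩ := hc'
  have : -q = r := by exact_mod_cast h
  have : q = 0 := by linarith
  simp [this]

theorem mul_self_mem_ratCone {c : F} (hc : c ∈ (Rat.castHom F).range) : c * c ∈ ratCone F := by
  obtain ⟨q, rfl⟩ := hc
  exact ⟨q * q, mul_self_nonneg q, by simp⟩

theorem eq_zero_of_sum_mul_self {ι : Type*} {s : Finset ι} {x : ι → F}
    (hx : ∀ i ∈ s, x i ∈ (Rat.castHom F).range) (h : -∑ i ∈ s, x i * x i ∈ ratCone F) :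
    ∀ i ∈ s, x i = 0 := by
  intro i hi
  classical
  rw [← Finset.add_sum_erase s _ hi] at h
  have h1 := mul_self_mem_ratCone (hx i hi)
  have h2 : ∑ j ∈ s.erase i, x j * x j ∈ ratCone F :=
    AddSubmonoid.sum_mem _ fun j hj => mul_self_mem_ratCone (hx j (Finset.mem_of_mem_erase hj))
  have h3 : -(x i * x i) ∈ ratCone F := by
    have := AddSubmonoid.add_mem _ h h2
    rwa [neg_add, neg_add_cancel_right] at this
  exact mul_self_eq_zero.1 (eq_zero_of_mem_ratCone h1 h3)

end Rational

namespace RootReductive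

variable {K g} (S : RootReductive K g)

variable {S} in
theorem pos_root_hc_nat_or_add {α β : Module.Dual K S.h} (hα : α ∈ S.Φp) (hβ : β ∈ S.Φp) :
    (∃ n : ℕ, β (S.hc α) = n) ∨ α + β ∈ S.Φp := by
  by_cases h : α + β ∈ S.Φ
  · exact Or.inr (S.pos_add α hα β hβ h)
  · refine Or.inl (S.root_hc_nat (S.pos_subset hα) (S.pos_subset hβ) (fun h0 => ?_) h)
    rw [add_comm, add_eq_zero_iff_eq_neg] at h0
    exact S.not_pos_neg hα (h0 ▸ hβ)

theorem multiset_sum_apply (m : Multiset (Module.Dual K S.h)) (H : S.h) :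
    m.sum H = (m.map fun β => β H).sum :=
  map_multiset_sum (LinearMap.applyₗ H : Module.Dual K S.h →ₗ[K] K) m

/-- A nonempty sum of positive roots is nonzero. -/
theorem sum_pos_ne_zero (n : ℕ) : ∀ m : Multiset (Module.Dual K S.h), m.card = n →
    (∀ β ∈ m, β ∈ S.Φp) → m ≠ 0 → m.sum ≠ 0 := by
  induction n with
  | zero => intro m hm _ h0; exact absurd (Multiset.card_eq_zero.1 hm) h0
  | succ n ih =>
    intro m hm hpos h0 hsum
    obtain ⟨β, hβm⟩ := Multiset.exists_mem_of_ne_zero h0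
    obtain ⟨m', rfl⟩ := Multiset.exists_cons_of_mem hβm
    have hβ := hpos β (Multiset.mem_cons_self _ _)
    have hex : ∃ γ ∈ m', β + γ ∈ S.Φp := by
      by_contra! hne
      have h1 : ((m'.map fun γ => γ (S.hc β)).sum) ∈ ratCone K := by
        refine AddSubmonoid.multiset_sum_mem _ _ fun c hc => ?_
        obtain ⟨γ, hγ, rfl⟩ := Multiset.mem_map.1 hc
        obtain ⟨k, hk⟩ := (pos_root_hc_nat_or_add hβ (hpos γ (Multiset.mem_cons_of_mem hγ))).resolve_right
          (hne γ hγ)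
        exact ⟨k, k.cast_nonneg, by simp [hk]⟩
      have h2 := S.multiset_sum_apply (β ::ₘ m') (S.hc β)
      rw [hsum, LinearMap.zero_apply, Multiset.map_cons, Multiset.sum_cons,
        root_hc (S.pos_subset hβ)] at h2
      have h3 : (2 : K) ∈ ratCone K := ⟨2, by norm_num, by simp⟩
      have h4 : -(2 : K) ∈ ratCone K := by
        rw [neg_eq_of_add_eq_zero_right h2.symm]; exact h1
      exact two_ne_zero (eq_zero_of_mem_ratCone h3 h4)
    obtain ⟨γ, hγ, hβγ⟩ := hex
    obtain ⟨m'', rfl⟩ := Multiset.exists_cons_of_mem hγ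
    refine ih ((β + γ) ::ₘ m'') ?_ ?_ ?_ ?_
    · simpa using hm
    · intro δ hδ
      rcases Multiset.mem_cons.1 hδ with rfl | hδ
      · exact hβγ
      · exact hpos δ (by simp [hδ])
    · exact Multiset.cons_ne_zero
    · simpa [add_assoc] using hsum

variable {S} in
theorem multiset_sum_ne_zero {m : Multiset (Module.Dual K S.h)} (h : ∀ β ∈ m, β ∈ S.Φp)
    (h0 : m ≠ 0) : m.sum ≠ 0 := S.sum_pos_ne_zero _ m rfl h h0

variable {S} in
/-- Brackets of root vectors are nonzero as soon as the sum of the roots is a root. -/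
theorem lie_e_ne_zero {α β : Module.Dual K S.h} (hα : α ∈ S.Φ) (hβ : β ∈ S.Φ)
    (h : α + β ∈ S.Φ) : ⁅S.e α, S.e β⁆ ≠ 0 := by
  intro h0
  obtain ⟨n, hn⟩ := S.weight_hc_nat hα (S.e_mem β) (e_ne hβ) h0
  obtain ⟨q, w, hw, hw0, hew⟩ := S.exists_top hα (S.e_mem _) (e_ne h)
  have hM : (α + β + q • α) (S.hc α) = ((n + 2 * (q + 1) : ℕ) : K) := by
    simp only [LinearMap.add_apply, LinearMap.smul_apply, root_hc hα, hn, nsmul_eq_mul]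
    push_cast; ring
  have P : IsSl2Triple.HasPrimitiveVectorWith (triple hα) w ((n + 2 * (q + 1) : ℕ) : K) :=
    ⟨hw0, by rw [hw, hM], hew⟩
  have hmem := S.ad_pow_mem_W (S.f_mem α) hw (q + 1)
  have hwt : α + β + q • α + (q + 1) • -α = β := by
    rw [add_smul]; simp
  rw [hwt] at hmem
  obtain ⟨c, hc⟩ := W_eq_smul_e hβ hmem
  have h1 := P.lie_e_pow_succ_toEnd_f q
  rw [hc, lie_smul, h0, smul_zero] at h1
  have h2 : ((LieModule.toEnd K g g (S.f α)) ^ q) w ≠ 0 :=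
    P.pow_toEnd_f_ne_zero_of_eq_nat rfl (by omega)
  have h3 := (smul_eq_zero.1 h1.symm).resolve_right h2
  have h4 : ((q : K) + 1) * (((n + 2 * (q + 1) : ℕ) : K) - q) = (((q + 1) * (n + q + 2) : ℕ) : K) := by
    push_cast; ring
  rw [h4, Nat.cast_eq_zero] at h3
  simp at h3

variable {S} in
theorem lie_ne_zero {α β : Module.Dual K S.h} (hα : α ∈ S.Φ) (hβ : β ∈ S.Φ)
    (h : α + β ∈ S.Φ) {x y : g} (hx : x ∈ S.W α) (hy : y ∈ S.W β) (hx0 : x ≠ 0) (hy0 : y ≠ 0) :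
    ⁅x, y⁆ ≠ 0 := by
  obtain ⟨c, rfl⟩ := W_eq_smul_e hα hx
  obtain ⟨d, rfl⟩ := W_eq_smul_e hβ hy
  rw [smul_lie, lie_smul]
  refine smul_ne_zero ?_ (smul_ne_zero ?_ (lie_e_ne_zero hα hβ h))
  · rintro rfl; simp at hx0
  · rintro rfl; simp at hy0

/-- The Killing form of a homogeneous subalgebra on the Cartan subalgebra. -/
theorem exists_killing_form (a : LieSubalgebra K g) [FiniteDimensional K a]
    (ha : S.IsHomog a.toSubmodule) :
    ∃ (n : ℕ) (ω : Fin n → Module.Dual K S.h),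
      (∀ i, ∃ x ∈ a, x ∈ S.W (ω i) ∧ x ≠ 0) ∧
      (∀ χ, ∀ x ∈ a, x ∈ S.W χ → x ≠ 0 → ∃ i, ω i = χ) ∧
      (∀ (H H' : S.h) (hH : (H : g) ∈ a) (hH' : (H' : g) ∈ a),
        killingForm K a ⟨H, hH⟩ ⟨H', hH'⟩ = ∑ i, ω i H * ω i H') ∧
      ∀ α ∈ S.Φ, ∀ (he : S.e α ∈ a) (hf : S.f α ∈ a), ∃ q : ℚ, 0 < q ∧
        killingForm K a ⟨_, he⟩ ⟨_, hf⟩ = q ∧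
        ∀ H : S.h, (H : g) ∈ a → ∑ i, ω i H * ω i (S.hc α) = α H * q := by
  obtain ⟨n, ω, h1, h2, h3⟩ := S.exists_killing_weights a ha
  refine ⟨n, ω, h1, h2, h3, fun α hα he hf => ?_⟩
  have hh : (S.hc α : g) ∈ a := by rw [← S.lie_e_f]; exact a.lie_mem he hf
  have key : ∀ H : S.h, (H : g) ∈ a → ∑ i, ω i H * ω i (S.hc α)
      = α H * killingForm K a ⟨_, he⟩ ⟨_, hf⟩ := by
    intro H hH
    rw [← h3 H (S.hc α) hH hh]
    have e1 : (⟨S.hc α, hh⟩ : a) = ⁅(⟨_, he⟩ : a), (⟨_, hf⟩ : a)⁆ := Subtype.ext (S.lie_e_f α).symm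
    have e2 : ⁅(⟨H, hH⟩ : a), (⟨_, he⟩ : a)⁆ = α H • (⟨_, he⟩ : a) := Subtype.ext (S.e_mem α H)
    rw [e1, ← LieModule.traceForm_apply_lie_apply, e2, map_smul, LinearMap.smul_apply, smul_eq_mul]
  have hrat : ∀ i, ω i (S.hc α) ∈ (Rat.castHom K).range := fun i => by
    obtain ⟨x, _, hx, hx0⟩ := h1 i
    obtain ⟨m, hm⟩ := S.weight_hc_int hα hx hx0
    exact ⟨m, by simp [hm]⟩
  have h5 := key _ hh
  rw [root_hc hα] at h5
  obtain ⟨i, hi⟩ := h2 α _ he (S.e_mem α) (e_ne hα)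
  have hsum : ∑ i, ω i (S.hc α) * ω i (S.hc α) ∈ ratCone K :=
    AddSubmonoid.sum_mem _ fun i _ => mul_self_mem_ratCone (hrat i)
  obtain ⟨q, hq, hq'⟩ := hsum
  have hq0 : q ≠ 0 := by
    rintro rfl
    have := eq_zero_of_sum_mul_self (s := Finset.univ) (fun i _ => hrat i)
      (by rw [hq']; simp) i (Finset.mem_univ i)
    rw [hi, root_hc hα] at this
    exact two_ne_zero this
  have h6 : killingForm K a ⟨_, he⟩ ⟨_, hf⟩ = ((q / 2 : ℚ) : K) := by
    push_cast
    rw [eq_div_iff two_ne_zero, mul_comm, ← h5, hq']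
  refine ⟨q / 2, by positivity, h6, fun H hH => ?_⟩
  rw [key H hH, h6]

variable {S} in
theorem simple_sub_not_root {σ τ : Module.Dual K S.h} (hσ : σ ∈ S.simples) (hτ : τ ∈ S.simples) :
    σ - τ ∉ S.Φ := by
  intro h
  rcases S.pos_or_neg h with h | h
  · exact hσ.2 ⟨τ, hτ.1, _, h, by abel⟩
  · exact hτ.2 ⟨σ, hσ.1, _, h, by abel⟩

variable {S} in
theorem simple_hc_neg_nat {σ τ : Module.Dual K S.h} (hσ : σ ∈ S.simples) (hτ : τ ∈ S.simples)
    (hne : σ ≠ τ) : ∃ n : ℕ, σ (S.hc τ) = -n :=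
  S.root_hc_neg_nat (S.pos_subset hτ.1) (S.pos_subset hσ.1) hne (simple_sub_not_root hσ hτ)

theorem disjoint_simple_sum_ne {m₁ m₂ : Multiset (Module.Dual K S.h)}
    (h₁ : ∀ σ ∈ m₁, σ ∈ S.simples) (h₂ : ∀ σ ∈ m₂, σ ∈ S.simples)
    (hd : ∀ σ ∈ m₁, σ ∉ m₂) (hsum : m₁.sum = m₂.sum) : m₁.sum = 0 := by
  classical
  refine LinearMap.ext fun H => ?_
  obtain ⟨N, hN⟩ := S.exists_level (s := insert (H : g)
    ((fun σ => S.e σ) '' (m₁.toFinset : Set _) ∪ (fun σ => S.f σ) '' (m₁.toFinset : Set _)))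
    (((m₁.toFinset.finite_toSet.image _).union (m₁.toFinset.finite_toSet.image _)).insert _)
  have hHN : (H : g) ∈ S.gc N := hN (by simp)
  have heN : ∀ σ ∈ m₁, S.e σ ∈ S.gc N := fun σ hσ =>
    hN (Or.inr (Or.inl ⟨σ, by simpa using hσ, rfl⟩))
  have hfN : ∀ σ ∈ m₁, S.f σ ∈ S.gc N := fun σ hσ =>
    hN (Or.inr (Or.inr ⟨σ, by simpa using hσ, rfl⟩))
  have := S.gc_findim N
  obtain ⟨n, ω, hω, -, -, hκ⟩ := S.exists_killing_form (S.gc N) (S.isHomog_gc N)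
  have hκ' : ∀ σ, ∃ q : ℚ, σ ∈ m₁ → 0 < q ∧
      ∀ H : S.h, (H : g) ∈ S.gc N → ∑ i, ω i H * ω i (S.hc σ) = σ H * q := fun σ => by
    by_cases hσ : σ ∈ m₁
    · obtain ⟨q, hq, -, hq'⟩ := hκ σ (S.pos_subset (h₁ σ hσ).1) (heN σ hσ) (hfN σ hσ)
      exact ⟨q, fun _ => ⟨hq, hq'⟩⟩
    · exact ⟨0, fun h => absurd h hσ⟩
  choose q hq using hκ'
  let t : Module.Dual K S.h → S.h := fun σ => (q σ : K)⁻¹ • S.hc σ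
  let X : S.h := (m₁.map t).sum
  have happ : ∀ ψ : Module.Dual K S.h, ψ X = (m₁.map fun σ => (q σ : K)⁻¹ * ψ (S.hc σ)).sum := by
    intro ψ
    rw [map_multiset_sum, Multiset.map_map]
    simp [t]
  have hφ : ∀ H' : S.h, (H' : g) ∈ S.gc N → ∑ i, ω i H' * ω i X = m₁.sum H' := by
    intro H' hH'
    have h3 := happ (∑ i, ω i H' • ω i)
    simp only [LinearMap.sum_apply, LinearMap.smul_apply, smul_eq_mul] at h3
    rw [h3, S.multiset_sum_apply]
    refine congrArg _ (Multiset.map_congr rfl fun σ hσ => ?_)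
    have h4 : (q σ : K) ≠ 0 := by exact_mod_cast (hq σ hσ).1.ne'
    rw [(hq σ hσ).2 H' hH', mul_comm, mul_assoc, mul_inv_cancel₀ h4, mul_one]
  have hX : (X : g) ∈ S.gc N := by
    have : X ∈ (S.gc N).toSubmodule.comap S.h.toSubmodule.subtype := by
      refine multiset_sum_mem _ fun y hy => ?_
      obtain ⟨σ, hσ, rfl⟩ := Multiset.mem_map.1 hy
      refine Submodule.smul_mem _ _ ?_
      change (S.hc σ : g) ∈ S.gc N
      rw [← S.lie_e_f]
      exact (S.gc N).lie_mem (heN σ hσ) (hfN σ hσ)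
    exact this
  have hrat : ∀ i, ω i X ∈ (Rat.castHom K).range := by
    intro i
    rw [happ]
    refine Subring.multiset_sum_mem _ _ fun c hc => ?_
    obtain ⟨σ, hσ, rfl⟩ := Multiset.mem_map.1 hc
    obtain ⟨x, _, hx, hx0⟩ := hω i
    obtain ⟨m, hm⟩ := S.weight_hc_int (S.pos_subset (h₁ σ hσ).1) hx hx0
    exact ⟨(q σ)⁻¹ * m, by simp [hm]⟩
  have hneg : -(m₁.sum X) ∈ ratCone K := by
    rw [hsum, S.multiset_sum_apply, ← Multiset.sum_map_neg]
    refine AddSubmonoid.multiset_sum_mem _ _ fun c hc => ?_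
    obtain ⟨τ, hτ, rfl⟩ := Multiset.mem_map.1 hc
    rw [happ, ← Multiset.sum_map_neg]
    refine AddSubmonoid.multiset_sum_mem _ _ fun c hc => ?_
    obtain ⟨σ, hσ, rfl⟩ := Multiset.mem_map.1 hc
    obtain ⟨k, hk⟩ := simple_hc_neg_nat (h₂ τ hτ) (h₁ σ hσ) (fun h => hd σ hσ (h ▸ hτ))
    refine ⟨(q σ)⁻¹ * k, mul_nonneg (inv_nonneg.2 (hq σ hσ).1.le) k.cast_nonneg, ?_⟩
    rw [hk]; push_cast; ring
  rw [← hφ X hX] at hneg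
  have hzero := eq_zero_of_sum_mul_self (fun i _ => hrat i) hneg
  rw [← hφ H hHN, LinearMap.zero_apply]
  exact Finset.sum_eq_zero fun i hi => by rw [hzero i hi, mul_zero]

/-- Multisets of simple roots are determined by their sums. -/
theorem simple_multiset_unique (n : ℕ) : ∀ m₁ m₂ : Multiset (Module.Dual K S.h), m₁.card = n →
    (∀ σ ∈ m₁, σ ∈ S.simples) → (∀ σ ∈ m₂, σ ∈ S.simples) → m₁.sum = m₂.sum → m₁ = m₂ := by
  induction n with
  | zero =>
    intro m₁ m₂ hc _ h₂ hsum
    rw [Multiset.card_eq_zero] at hc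
    subst hc
    by_contra hne
    exact multiset_sum_ne_zero (fun σ hσ => (h₂ σ hσ).1) (Ne.symm hne) hsum.symm
  | succ n ih =>
    intro m₁ m₂ hc h₁ h₂ hsum
    by_cases hex : ∃ σ ∈ m₁, σ ∈ m₂
    · obtain ⟨σ, hσ1, hσ2⟩ := hex
      obtain ⟨m₁, rfl⟩ := Multiset.exists_cons_of_mem hσ1
      obtain ⟨m₂, rfl⟩ := Multiset.exists_cons_of_mem hσ2
      congr 1
      refine ih m₁ m₂ (by simpa using hc) (fun τ hτ => h₁ τ (by simp [hτ]))
        (fun τ hτ => h₂ τ (by simp [hτ])) (by simpa using hsum)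
    · push Not at hex
      have h0 := S.disjoint_simple_sum_ne h₁ h₂ hex hsum
      have hm₁ : m₁ = 0 := by
        by_contra hne
        exact multiset_sum_ne_zero (fun σ hσ => (h₁ σ hσ).1) hne h0
      simp [hm₁] at hc

/-- A finite set of positive roots closed under decompositions consists of sums of simple
roots. -/
theorem subset_closure_simples {D : Set (Module.Dual K S.h)} (hD : D.Finite) (hpos : D ⊆ S.Φp)
    (hdec : ∀ β ∈ S.Φp, ∀ γ ∈ S.Φp, β + γ ∈ D → β ∈ D) :
    D ⊆ AddSubmonoid.closure S.simples := by
  let r : Module.Dual K S.h → Module.Dual K S.h → Prop := fun β α =>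
    ∃ m : Multiset (Module.Dual K S.h), m ≠ 0 ∧ (∀ γ ∈ m, γ ∈ S.Φp) ∧ α = β + m.sum
  have hr : IsStrictOrder _ r :=
    { irrefl := by
        rintro α ⟨m, h0, hm, h⟩
        exact multiset_sum_ne_zero hm h0 (left_eq_add.1 h)
      trans := by
        rintro α β γ ⟨m, h0, hm, rfl⟩ ⟨m', h0', hm', rfl⟩
        refine ⟨m + m', by simp [h0], fun γ hγ => ?_, by simp [add_assoc]⟩
        rcases Multiset.mem_add.1 hγ with h | h
        exacts [hm _ h, hm' _ h] }
  intro α hα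
  refine Set.WellFoundedOn.induction (r := r) (P := fun α => α ∈ AddSubmonoid.closure S.simples)
    hD.wellFoundedOn hα fun α hα ih => ?_
  by_cases hs : ∃ β ∈ S.Φp, ∃ γ ∈ S.Φp, β + γ = α
  · obtain ⟨β, hβ, γ, hγ, rfl⟩ := hs
    exact add_mem (ih β (hdec β hβ γ hγ hα) ⟨{γ}, by simp, by simpa using hγ, by simp⟩)
      (ih γ (hdec γ hγ β hβ (add_comm β γ ▸ hα)) ⟨{β}, by simp, by simpa using hβ, by simp [add_comm]⟩)
  · exact AddSubmonoid.subset_closure ⟨hpos hα, hs⟩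

theorem isDynkin_iff : S.IsDynkin ↔ S.Γp = AddSubmonoid.closure S.simples := by
  constructor
  · intro h
    exact le_antisymm (AddSubmonoid.closure_le.2 h) (AddSubmonoid.closure_mono fun α hα => hα.1)
  · intro h α hα
    rw [← h]
    exact AddSubmonoid.subset_closure hα

/-- A positive root which is not a sum of simple roots has decompositions of any length. -/
theorem exists_long_decomposition {α : Module.Dual K S.h} (hα : α ∈ S.Φp)
    (h : α ∉ AddSubmonoid.closure S.simples) (k : ℕ) :
    ∃ (l : List (Module.Dual K S.h)), l.length = k ∧ (∀ β ∈ l, β ∈ S.Φp) ∧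
      α - l.sum ∈ S.Φp ∧ α - l.sum ∉ AddSubmonoid.closure S.simples := by
  induction k with
  | zero => exact ⟨[], by simp [hα, h]⟩
  | succ k ih =>
    obtain ⟨l, hl, hlp, h1, h2⟩ := ih
    have hs : ∃ β ∈ S.Φp, ∃ γ ∈ S.Φp, β + γ = α - l.sum := by
      by_contra hs
      exact h2 (AddSubmonoid.subset_closure ⟨h1, hs⟩)
    obtain ⟨β, hβ, γ, hγ, hs⟩ := hs
    have key : ∀ β ∈ S.Φp, ∀ γ ∈ S.Φp, β + γ = α - l.sum →
        γ ∉ AddSubmonoid.closure S.simples → _ := fun β hβ γ hγ hs hn => by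
      have e : α - (β :: l).sum = γ := by
        rw [List.sum_cons, add_comm, ← sub_sub, ← hs]; abel
      exact (⟨β :: l, by simp [hl], by simpa using ⟨hβ, hlp⟩, e ▸ hγ, e ▸ hn⟩ :
        ∃ (l : List (Module.Dual K S.h)), l.length = k + 1 ∧ (∀ β ∈ l, β ∈ S.Φp) ∧
          α - l.sum ∈ S.Φp ∧ α - l.sum ∉ AddSubmonoid.closure S.simples)
    by_cases hγ' : γ ∈ AddSubmonoid.closure S.simples
    · refine key γ hγ β hβ (by rw [add_comm, hs]) fun hβ' => h2 ?_
      rw [← hs]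
      exact add_mem hβ' hγ'
    · exact key β hβ γ hγ hs hγ'

theorem intervalFinite_of_isDynkin (h : S.IsDynkin) (μ lam : Module.Dual K S.h) :
    {ν | S.wle μ ν ∧ S.wle ν lam}.Finite := by
  classical
  rw [isDynkin_iff] at h
  rcases Set.eq_empty_or_nonempty {ν | S.wle μ ν ∧ S.wle ν lam} with he | ⟨ν₀, hν₀⟩
  · rw [he]; exact Set.finite_empty
  have key : ∀ ν, S.wle μ ν ∧ S.wle ν lam → ∃ m₁ m₂ : Multiset (Module.Dual K S.h),
      (∀ σ ∈ m₁, σ ∈ S.simples) ∧ (∀ σ ∈ m₂, σ ∈ S.simples) ∧ ν = μ + m₁.sum ∧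
      (m₁ + m₂).sum = lam - μ := by
    rintro ν ⟨h1, h2⟩
    rw [wle, h] at h1 h2
    obtain ⟨m₁, hm₁, hs₁⟩ := AddSubmonoid.exists_multiset_of_mem_closure h1
    obtain ⟨m₂, hm₂, hs₂⟩ := AddSubmonoid.exists_multiset_of_mem_closure h2
    exact ⟨m₁, m₂, hm₁, hm₂, by rw [hs₁]; abel, by rw [Multiset.sum_add, hs₁, hs₂]; abel⟩
  have hadd : ∀ {m₁ m₂ : Multiset (Module.Dual K S.h)}, (∀ σ ∈ m₁, σ ∈ S.simples) →
      (∀ σ ∈ m₂, σ ∈ S.simples) → ∀ σ ∈ m₁ + m₂, σ ∈ S.simples := fun h1 h2 σ hσ => by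
    rcases Multiset.mem_add.1 hσ with h | h
    exacts [h1 _ h, h2 _ h]
  obtain ⟨n₁, n₂, hn₁, hn₂, -, hn⟩ := key ν₀ hν₀
  refine ((Set.finite_Iic (n₁ + n₂)).image fun m => μ + m.sum).subset fun ν hν => ?_
  obtain ⟨m₁, m₂, hm₁, hm₂, rfl, hm⟩ := key ν hν
  refine ⟨m₁, ?_, rfl⟩
  rw [Set.mem_Iic, ← S.simple_multiset_unique _ (m₁ + m₂) (n₁ + n₂) rfl (hadd hm₁ hm₂)
    (hadd hn₁ hn₂) (hm.trans hn.symm)]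
  exact Multiset.le_add_right _ _

theorem isDynkin_of_intervalFinite
    (h : ∀ μ lam : Module.Dual K S.h, {ν | S.wle μ ν ∧ S.wle ν lam}.Finite) : S.IsDynkin := by
  intro α hα
  refine S.subset_closure_simples (D := {γ | γ ∈ S.Φp ∧ S.wle γ α})
    ((h 0 α).subset ?_) (fun γ hγ => hγ.1) ?_ ⟨hα, ?_⟩
  · rintro γ ⟨h1, h2⟩
    refine ⟨?_, h2⟩
    rw [wle, sub_zero]
    exact AddSubmonoid.subset_closure h1
  · rintro β hβ γ hγ ⟨-, h2⟩
    refine ⟨hβ, ?_⟩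
    rw [wle] at h2 ⊢
    have : α - β = α - (β + γ) + γ := by abel
    rw [this]
    exact add_mem h2 (AddSubmonoid.subset_closure hγ)
  · rw [wle, sub_self]; exact zero_mem _

end RootReductive

section GrassmannianDerivations

open MvPolynomial

variable {F m : Type*} [Field F] [Fintype m] [DecidableEq m]

theorem Derivation.matrix_map_mul {R A : Type*} [CommRing R] [CommRing A] [Algebra R A]
    (D : Derivation R A A) (M N : Matrix m m A) :
    (M * N).map D = M.map D * N + M * N.map D := by
  ext i j
  simp only [Matrix.map_apply, Matrix.mul_apply, Matrix.add_apply, map_sum, Derivation.leibniz,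
    smul_eq_mul, Finset.sum_add_distrib]
  rw [add_comm]
  congr 1
  exact Finset.sum_congr rfl fun k _ => mul_comm _ _

/-- The matrix of the vector field `(1 - X) A X` on the space of matrices. -/
def fieldMatrix (A : Matrix m m F) : Matrix m m (MvPolynomial (m × m) F) :=
  (1 - Matrix.of fun i j => X (i, j)) * A.map C * (Matrix.of fun i j => X (i, j))

/-- The vector field `(1 - X) A X` on the space of matrices. -/
def matrixField (A : Matrix m m F) :
    Derivation F (MvPolynomial (m × m) F) (MvPolynomial (m × m) F) :=
  mkDerivation F fun ij => fieldMatrix A ij.1 ij.2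

theorem matrixField_X (A : Matrix m m F) (i j : m) :
    matrixField A (X (i, j)) = fieldMatrix A i j := by
  rw [matrixField, mkDerivation_X]

theorem map_matrixField (A B : Matrix m m F) :
    (fieldMatrix A).map (matrixField B) = (1 - Matrix.of fun i j => X (i, j)) *
      (A.map C * B.map C - A.map C * (Matrix.of fun i j => X (i, j)) * B.map C
        - B.map C * (Matrix.of fun i j => X (i, j)) * A.map C) *
        (Matrix.of fun i j => X (i, j)) := by
  have hX : (Matrix.of fun i j => X (i, j) : Matrix m m (MvPolynomial (m × m) F)).map
      (matrixField B) = fieldMatrix B := by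
    ext i j : 2
    simp [matrixField_X]
  have hC : (A.map C : Matrix m m (MvPolynomial (m × m) F)).map (matrixField B) = 0 := by
    ext i j : 2
    simp [matrixField]
  have h1 : (1 - Matrix.of fun i j => X (i, j) : Matrix m m (MvPolynomial (m × m) F)).map
      (matrixField B) = - fieldMatrix B := by
    rw [← hX]
    ext i j : 2
    by_cases hij : i = j <;> simp [hij]
  rw [fieldMatrix, Derivation.matrix_map_mul, Derivation.matrix_map_mul, hX, hC, h1, fieldMatrix]
  noncomm_ring

theorem matrixField_lie (A B : Matrix m m F) (p : MvPolynomial (m × m) F) :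
    matrixField (A * B - B * A) p
      = matrixField B (matrixField A p) - matrixField A (matrixField B p) := by
  have h : matrixField (A * B - B * A) = ⁅matrixField B, matrixField A⁆ := by
    refine derivation_ext fun ⟨i, j⟩ => ?_
    rw [Derivation.commutator_apply, matrixField_X, matrixField_X, matrixField_X]
    have h1 := congrFun (congrFun (map_matrixField A B) i) j
    have h2 := congrFun (congrFun (map_matrixField B A) i) j
    rw [Matrix.map_apply] at h1 h2
    rw [h1, h2, ← Matrix.sub_apply, ← sub_mul, ← mul_sub, fieldMatrix]
    have : ((A * B - B * A).map C : Matrix m m (MvPolynomial (m × m) F))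
        = A.map C * B.map C - B.map C * A.map C := by
      rw [← Matrix.map_mul, ← Matrix.map_mul, Matrix.map_sub]
      exact fun a b => map_sub _ a b
    rw [this]
    refine congrFun (congrFun (congrArg₂ _ (congrArg₂ _ rfl ?_) rfl) i) j
    abel
  rw [h, Derivation.commutator_apply]

theorem matrixField_linear (c : F) (A B : Matrix m m F) (p : MvPolynomial (m × m) F) :
    matrixField (c • A + B) p = c • matrixField A p + matrixField B p := by
  have h : matrixField (c • A + B) = c • matrixField A + matrixField B := by
    refine derivation_ext fun ⟨i, j⟩ => ?_
    rw [Derivation.add_apply, Derivation.smul_apply, matrixField_X, matrixField_X, matrixField_X,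
      fieldMatrix, fieldMatrix, fieldMatrix]
    have : ((c • A + B).map C : Matrix m m (MvPolynomial (m × m) F))
        = c • A.map C + B.map C := by
      ext i j : 2
      simp [smul_eq_C_mul]
    rw [this, mul_add, add_mul, Matrix.mul_smul, Matrix.smul_mul, Matrix.add_apply,
      Matrix.smul_apply]
  rw [h, Derivation.add_apply, Derivation.smul_apply]

/-- Evaluation at a matrix. -/
def evalMatrix (P : Matrix m m F) : MvPolynomial (m × m) F →ₐ[F] F := aeval fun ij => P ij.1 ij.2

theorem evalMatrix_fieldMatrix (P A : Matrix m m F) (i j : m) :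
    evalMatrix P (fieldMatrix A i j) = ((1 - P) * A * P) i j := by
  have h : (fieldMatrix A).map (evalMatrix P) = (1 - P) * A * P := by
    have hX : (Matrix.of fun i j => X (i, j) : Matrix m m (MvPolynomial (m × m) F)).map
        (evalMatrix P) = P := by
      ext i j; simp [evalMatrix]
    have hA : (A.map C : Matrix m m (MvPolynomial (m × m) F)).map (evalMatrix P) = A := by
      ext i j; simp [evalMatrix]
    rw [fieldMatrix, Matrix.map_mul, Matrix.map_mul, hA, hX, Matrix.map_sub _ (map_sub _), hX,
      Matrix.map_one _ (map_zero _) (map_one _)]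
  exact congrFun (congrFun h i) j

/-- The iterated action of vector fields on the evaluation functional. -/
def evalWord (P : Matrix m m F) : List (Matrix m m F) → MvPolynomial (m × m) F → F
  | [], p => evalMatrix P p
  | A :: l, p => evalWord P l (matrixField A p)

theorem evalWord_pow (P : Matrix m m F) (ell : MvPolynomial (m × m) F)
    (h0 : evalMatrix P ell = 0) (l : List (Matrix m m F)) : ∀ q r : MvPolynomial (m × m) F,
    evalWord P l (ell ^ l.length * q + ell ^ (l.length + 1) * r)
      = (l.length.factorial : F) * (l.map fun A => evalMatrix P (matrixField A ell)).prod *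
        evalMatrix P q := by
  induction l with
  | nil => intro q r; simp [evalWord, h0]
  | cons A l ih =>
    intro q r
    have h1 : matrixField A (ell ^ (l.length + 1) * q + ell ^ (l.length + 1 + 1) * r)
        = ell ^ l.length * (((l.length + 1 : ℕ) : MvPolynomial (m × m) F) * matrixField A ell * q)
          + ell ^ (l.length + 1) * (matrixField A q
            + ((l.length + 2 : ℕ) : MvPolynomial (m × m) F) * matrixField A ell * r
            + ell * matrixField A r) := by
      simp only [map_add, Derivation.leibniz, Derivation.leibniz_pow, smul_eq_mul, nsmul_eq_mul,
        Nat.add_sub_cancel]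
      push_cast
      ring
    rw [List.length_cons, evalWord, h1, ih]
    simp only [map_mul, map_natCast, List.map_cons, List.prod_cons, Nat.factorial_succ]
    push_cast
    ring

theorem evalWord_pow_of_lt (P : Matrix m m F) (ell : MvPolynomial (m × m) F)
    (h0 : evalMatrix P ell = 0) (l : List (Matrix m m F)) {k : ℕ} (hk : l.length < k) :
    evalWord P l (ell ^ k) = 0 := by
  obtain ⟨j, rfl⟩ := Nat.exists_eq_add_of_lt hk
  have := evalWord_pow P ell h0 l 0 (ell ^ j)
  rw [map_zero, mul_zero, mul_zero, zero_add, ← pow_add] at this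
  rw [← this]; congr 2; omega

/-- A test function separating words by length. -/
theorem exists_evalWord_ne_zero [CharZero F] (P : Matrix m m F)
    (s : Set (Matrix m m F)) (hs : s.Finite) (hs0 : ∀ A ∈ s, (1 - P) * A * P ≠ 0) (k : ℕ) :
    ∃ p : MvPolynomial (m × m) F, (∀ l : List (Matrix m m F), l.length < k → evalWord P l p = 0) ∧
      ∀ l : List (Matrix m m F), l.length = k → (∀ A ∈ l, A ∈ s) → evalWord P l p ≠ 0 := by
  have := hs.to_subtype
  obtain ⟨φ, hφ⟩ := Module.exists_dual_forall_apply_ne_zero (K := F)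
    (fun A : s => (1 - P) * A.1 * P) (fun A => hs0 A A.2)
  let ell : MvPolynomial (m × m) F :=
    ∑ i, ∑ j, φ (Matrix.single i j 1) • (X (i, j) - C (P i j))
  have h0 : evalMatrix P ell = 0 := by
    simp [ell, evalMatrix]
  have h1 : ∀ A, evalMatrix P (matrixField A ell) = φ ((1 - P) * A * P) := by
    intro A
    conv_rhs => rw [Matrix.matrix_eq_sum_single ((1 - P) * A * P)]
    simp only [ell, map_sum]
    refine Finset.sum_congr rfl fun i _ => Finset.sum_congr rfl fun j _ => ?_
    have h2 : matrixField A (C (P i j)) = 0 := by simp [matrixField]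
    rw [Derivation.map_smul, map_sub, h2, sub_zero, matrixField_X, map_smul,
      evalMatrix_fieldMatrix, ← mul_one (((1 - P) * A * P) i j),
      ← smul_eq_mul (((1 - P) * A * P) i j) 1, ← Matrix.smul_single, map_smul,
      smul_eq_mul, smul_eq_mul, smul_eq_mul, mul_one, mul_comm]
  refine ⟨ell ^ k, fun l hl => evalWord_pow_of_lt P ell h0 l hl, ?_⟩
  rintro l rfl hl
  have h3 := evalWord_pow P ell h0 l 1 0
  rw [mul_one, mul_zero, add_zero, map_one, mul_one] at h3
  rw [h3]
  refine mul_ne_zero (by exact_mod_cast Nat.factorial_ne_zero _) (List.prod_ne_zero ?_)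
  intro hmem
  obtain ⟨A, hA, hA0⟩ := List.mem_map.1 hmem
  rw [h1] at hA0
  exact hφ ⟨A, hl A hA⟩ hA0

theorem evalMatrix_matrixField_eq_zero (P A : Matrix m m F) (h : (1 - P) * A * P = 0)
    (p : MvPolynomial (m × m) F) : evalMatrix P (matrixField A p) = 0 := by
  induction p using MvPolynomial.induction_on with
  | C a => simp [matrixField]
  | add p q hp hq => rw [map_add, map_add, hp, hq, add_zero]
  | mul_X p i hp =>
    rw [Derivation.leibniz, map_add, smul_eq_mul, smul_eq_mul, map_mul, map_mul, hp,
      matrixField_X A i.1 i.2, evalMatrix_fieldMatrix, h, Matrix.zero_apply, mul_zero, mul_zero,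
      add_zero]

end GrassmannianDerivations

section UniversalLift

variable {K g}

theorem UniversalEnvelopingAlgebra.exists_lift {E : Type*} [Ring E] [Algebra K E] (f : g →ₗ[K] E)
    (hf : ∀ x y, f ⁅x, y⁆ = f x * f y - f y * f x) :
    ∃ Θ : UEA K g →ₐ[K] E, ∀ x, Θ (ι K x) = f x := by
  let : LieRing E := LieRing.ofAssociativeRing
  let f' : g →ₗ⁅K⁆ E := { f with map_lie' := fun {x y} => hf x y }
  exact ⟨UniversalEnvelopingAlgebra.lift K f', fun x =>
    UniversalEnvelopingAlgebra.lift_ι_apply K f' x⟩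

theorem UniversalEnvelopingAlgebra.ι_lie (x y : g) :
    ι K ⁅x, y⁆ = ι K x * ι K y - ι K y * ι K x := by
  let : LieRing (UEA K g) := LieRing.ofAssociativeRing
  exact LieHom.map_lie (ι K) x y

/-- The canonical map to the universal enveloping algebra, as a linear map. -/
def UniversalEnvelopingAlgebra.ιLinear : g →ₗ[K] UEA K g :=
  letI : LieRing (UEA K g) := LieRing.ofAssociativeRing
  LieHom.toLinearMap (ι K)

theorem UniversalEnvelopingAlgebra.mem_of_forall_ι_mem (T : Subalgebra K (UEA K g))
    (hT : ∀ x, ι K x ∈ T) (u : UEA K g) : u ∈ T := by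
  obtain ⟨Θ, hΘ⟩ := exists_lift
    (E := T) (LinearMap.codRestrict T.toSubmodule (ιLinear (K := K)) hT) (fun x y => by
      apply Subtype.ext; exact ι_lie x y)
  have : T.val.comp Θ = AlgHom.id K _ := by
    let : LieRing (UEA K g) := LieRing.ofAssociativeRing
    apply UniversalEnvelopingAlgebra.hom_ext
    ext x
    exact congrArg Subtype.val (hΘ x)
  rw [← AlgHom.id_apply (R := K) u, ← this]
  exact (Θ u).2

end UniversalLift

section GermModule

open Filter

variable {K g}
variable {V : ℕ → Type*} [∀ n, AddCommGroup (V n)] [∀ n, Module K (V n)]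

variable (K V) in
/-- The sequences that vanish eventually. -/
def eventuallyZero : Submodule K (∀ n, V n) where
  carrier := {θ | ∀ᶠ n in atTop, θ n = 0}
  add_mem' := by
    intro a b ha hb
    filter_upwards [ha, hb] with n h1 h2
    rw [Pi.add_apply, h1, h2, add_zero]
  zero_mem' := Eventually.of_forall fun _ => rfl
  smul_mem' := by
    intro c a ha
    filter_upwards [ha] with n h1
    rw [Pi.smul_apply, h1, smul_zero]

theorem mem_eventuallyZero {θ : ∀ n, V n} :
    θ ∈ eventuallyZero K V ↔ ∀ᶠ n in atTop, θ n = 0 := Iff.rfl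

/-- The action of a sequence of endomorphisms on germs of sequences. -/
def germEnd (T : ∀ n, Module.End K (V n)) : Module.End K ((∀ n, V n) ⧸ eventuallyZero K V) :=
  (eventuallyZero K V).mapQ (eventuallyZero K V)
    (LinearMap.pi fun n => (T n).comp (LinearMap.proj n)) (by
      intro θ hθ
      rw [Submodule.mem_comap, mem_eventuallyZero]
      filter_upwards [hθ] with n hn
      rw [LinearMap.pi_apply, LinearMap.comp_apply, LinearMap.proj_apply, hn, map_zero])

theorem germEnd_mk (T : ∀ n, Module.End K (V n)) (θ : ∀ n, V n) :
    germEnd T ((eventuallyZero K V).mkQ θ) = (eventuallyZero K V).mkQ fun n => T n (θ n) := rfl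

theorem germEnd_congr (T T' : ∀ n, Module.End K (V n)) (h : ∀ᶠ n in atTop, T n = T' n) :
    germEnd T = germEnd T' := by
  refine LinearMap.ext fun q => ?_
  obtain ⟨θ, rfl⟩ := Submodule.mkQ_surjective _ q
  rw [germEnd_mk, germEnd_mk, ← sub_eq_zero, ← map_sub, Submodule.mkQ_apply,
    Submodule.Quotient.mk_eq_zero, mem_eventuallyZero]
  filter_upwards [h] with n hn
  rw [Pi.sub_apply, hn, sub_self]

theorem germEnd_commutator (T T' : ∀ n, Module.End K (V n)) :
    germEnd (fun n => T n * T' n - T' n * T n) = germEnd T * germEnd T' - germEnd T' * germEnd T := by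
  refine LinearMap.ext fun q => ?_
  obtain ⟨θ, rfl⟩ := Submodule.mkQ_surjective _ q
  rw [LinearMap.sub_apply, Module.End.mul_apply, Module.End.mul_apply, germEnd_mk, germEnd_mk,
    germEnd_mk, germEnd_mk, germEnd_mk, ← map_sub]
  rfl

theorem exists_germ_lift (ρ : ∀ n, g →ₗ[K] Module.End K (V n))
    (hρ : ∀ x y, ∀ᶠ n in atTop, ρ n ⁅x, y⁆ = ρ n x * ρ n y - ρ n y * ρ n x) :
    ∃ Θ : UEA K g →ₐ[K] Module.End K ((∀ n, V n) ⧸ eventuallyZero K V),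
      ∀ x, Θ (ι K x) = germEnd fun n => ρ n x := by
  refine UniversalEnvelopingAlgebra.exists_lift
    (E := Module.End K ((∀ n, V n) ⧸ eventuallyZero K V))
    ⟨⟨fun x => germEnd fun n => ρ n x, fun x y => ?_⟩, fun c x => ?_⟩ fun x y => ?_
  · refine LinearMap.ext fun q => ?_
    obtain ⟨θ, rfl⟩ := Submodule.mkQ_surjective _ q
    rw [LinearMap.add_apply, germEnd_mk, germEnd_mk, germEnd_mk, ← map_add]
    congr 1; ext n
    rw [map_add, LinearMap.add_apply, Pi.add_apply]
  · refine LinearMap.ext fun q => ?_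
    obtain ⟨θ, rfl⟩ := Submodule.mkQ_surjective _ q
    rw [LinearMap.smul_apply, germEnd_mk, germEnd_mk, ← map_smul]
    congr 1; ext n
    rw [map_smul, LinearMap.smul_apply, Pi.smul_apply, RingHom.id_apply]
  · exact (germEnd_congr _ _ (hρ x y)).trans (germEnd_commutator _ _)

theorem lift_word_germ (ρ : ∀ n, g →ₗ[K] Module.End K (V n))
    (Θ : UEA K g →ₐ[K] Module.End K ((∀ n, V n) ⧸ eventuallyZero K V))
    (hΘ : ∀ x, Θ (ι K x) = germEnd fun n => ρ n x) (θ : ∀ n, V n) (l : List g) :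
    Θ (l.map (ι K)).prod ((eventuallyZero K V).mkQ θ) =
      (eventuallyZero K V).mkQ fun n => (l.map (ρ n)).prod (θ n) := by
  induction l with
  | nil => simp
  | cons x l ih =>
    rw [List.map_cons, List.prod_cons, map_mul, Module.End.mul_apply, ih, hΘ, germEnd_mk]
    simp

end GermModule

namespace RootReductive

open Filter

variable {K g} (S : RootReductive K g)
variable {V : ℕ → Type*} [∀ n, AddCommGroup (V n)] [∀ n, Module K (V n)]

theorem eventually_sum_words_eq_zero (ρ : ∀ n, g →ₗ[K] Module.End K (V n))
    (hρ : ∀ x y, ∀ᶠ n in atTop, ρ n ⁅x, y⁆ = ρ n x * ρ n y - ρ n y * ρ n x)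
    (ε : ∀ n, V n) (hε : ∀ x ∈ S.b, ∀ᶠ n in atTop, ρ n x (ε n) = 0)
    {I : Type*} (s : Finset I) (c : I → K) (w : I → List g)
    (h : ∑ i ∈ s, c i • ((w i).map (ι K)).prod ∈ S.vIdeal 0) :
    ∀ᶠ n in atTop, ∑ i ∈ s, c i • ((w i).map (ρ n)).prod (ε n) = 0 := by
  obtain ⟨Θ, hΘ⟩ := exists_germ_lift ρ hρ
  have hb : ∀ x ∈ S.b, Θ (ι K x) ((eventuallyZero K V).mkQ ε) = 0 := by
    intro x hx
    rw [hΘ, germEnd_mk, Submodule.mkQ_apply, Submodule.Quotient.mk_eq_zero]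
    exact hε x hx
  have hkill : ∀ u ∈ S.vIdeal 0, Θ u ((eventuallyZero K V).mkQ ε) = 0 := by
    intro u hu
    refine Submodule.span_induction (p := fun u _ => Θ u ((eventuallyZero K V).mkQ ε) = 0)
      ?_ ?_ ?_ ?_ hu
    · rintro u (⟨x, hx, rfl⟩ | ⟨H, rfl⟩)
      · refine hb x ?_
        change x ∈ S.b.toSubmodule
        rw [S.b_def]
        exact Submodule.mem_sup_right hx
      · rw [LinearMap.zero_apply, map_zero, sub_zero]
        exact hb _ (S.h_le_b H.2)
    · rw [map_zero, LinearMap.zero_apply]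
    · intro x y _ _ hx hy; rw [map_add, LinearMap.add_apply, hx, hy, add_zero]
    · intro a x _ hx; rw [smul_eq_mul, map_mul, Module.End.mul_apply, hx, map_zero]
  have h1 := hkill _ h
  simp only [map_sum, map_smul, LinearMap.sum_apply, LinearMap.smul_apply,
    lift_word_germ ρ Θ hΘ] at h1
  simp only [← map_smul, ← map_sum] at h1
  rw [Submodule.mkQ_apply, Submodule.Quotient.mk_eq_zero, mem_eventuallyZero] at h1
  filter_upwards [h1] with n hn
  simpa using hn

end RootReductive

section DualFields

open MvPolynomial

variable {K g}

/-- The action of matrix-valued data on functionals by vector fields. -/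
def fieldAction {d : ℕ} (A : g →ₗ[K] Matrix (Fin d) (Fin d) K) :
    g →ₗ[K] Module.End K (Module.Dual K (MvPolynomial (Fin d × Fin d) K)) where
  toFun x := ((matrixField (A x) : Derivation K _ _) :
    MvPolynomial (Fin d × Fin d) K →ₗ[K] MvPolynomial (Fin d × Fin d) K).dualMap
  map_add' x y := by
    refine LinearMap.ext fun θ => LinearMap.ext fun p => ?_
    have := matrixField_linear 1 (A x) (A y) p
    rw [one_smul, one_smul] at this
    change θ (matrixField (A (x + y)) p) = θ (matrixField (A x) p) + θ (matrixField (A y) p)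
    rw [map_add, this, map_add]
  map_smul' c x := by
    refine LinearMap.ext fun θ => LinearMap.ext fun p => ?_
    have h0 := matrixField_linear (-1) (0 : Matrix (Fin d) (Fin d) K) 0 p
    rw [smul_zero, add_zero, neg_smul, one_smul, neg_add_cancel] at h0
    have := matrixField_linear c (A x) 0 p
    rw [add_zero, h0, add_zero] at this
    change θ (matrixField (A (c • x)) p) = c • θ (matrixField (A x) p)
    rw [map_smul, this, map_smul]

theorem fieldAction_apply {d : ℕ} (A : g →ₗ[K] Matrix (Fin d) (Fin d) K) (x : g)
    (θ : Module.Dual K (MvPolynomial (Fin d × Fin d) K)) (p : MvPolynomial (Fin d × Fin d) K) :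
    fieldAction A x θ p = θ (matrixField (A x) p) := rfl

theorem fieldAction_lie {d : ℕ} (A : g →ₗ[K] Matrix (Fin d) (Fin d) K) (x y : g)
    (h : A ⁅x, y⁆ = A x * A y - A y * A x) : fieldAction A ⁅x, y⁆ =
      fieldAction A x * fieldAction A y - fieldAction A y * fieldAction A x := by
  refine LinearMap.ext fun θ => LinearMap.ext fun p => ?_
  rw [LinearMap.sub_apply, Module.End.mul_apply, Module.End.mul_apply, LinearMap.sub_apply,
    fieldAction_apply, fieldAction_apply, fieldAction_apply, fieldAction_apply, fieldAction_apply,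
    h, matrixField_lie, map_sub]

theorem fieldAction_word {d : ℕ} (A : g →ₗ[K] Matrix (Fin d) (Fin d) K)
    (P : Matrix (Fin d) (Fin d) K) (l : List g) : ∀ p,
    (l.map (fieldAction A)).prod (evalMatrix P).toLinearMap p = evalWord P (l.map A) p := by
  induction l with
  | nil => intro p; rfl
  | cons x l ih =>
    intro p
    rw [List.map_cons, List.prod_cons, Module.End.mul_apply, fieldAction_apply, ih, List.map_cons,
      evalWord]

end DualFields

namespace RootReductive

open Filter

variable {K g} (S : RootReductive K g)

theorem b_le_iSup : S.b.toSubmodule ≤ ⨆ χ ∈ insert 0 S.Φp, S.W χ := by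
  rw [S.b_def, iSup_insert]
  exact sup_le_sup_right (S.h_le_W_zero) _

theorem weight_of_mem_b {x : g} {χ : Module.Dual K S.h} (hx : x ∈ S.b) (hχ : x ∈ S.W χ)
    (h0 : x ≠ 0) : χ = 0 ∨ χ ∈ S.Φp := by
  by_contra hcon
  have h1 := (S.iSupIndep_W χ)
  refine h0 ((Submodule.disjoint_def.1 h1) x hχ (?_))
  refine (iSup₂_le fun δ hδ => ?_ : ⨆ χ ∈ insert 0 S.Φp, S.W χ ≤ _) (S.b_le_iSup hx)
  exact le_iSup₂_of_le δ (by rintro rfl; exact hcon hδ) le_rfl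

theorem f_notMem_b {γ : Module.Dual K S.h} (hγ : γ ∈ S.Φp) : S.f γ ∉ S.b := by
  intro h
  rcases S.weight_of_mem_b h (S.f_mem γ) (S.f_ne (S.pos_subset hγ)) with h1 | h1
  · exact S.root_ne_zero (S.pos_subset hγ) (neg_eq_zero.1 h1)
  · exact S.not_pos_neg hγ h1

theorem exists_level_matrices (n : ℕ) : ∃ (d : ℕ) (A : g →ₗ[K] Matrix (Fin d) (Fin d) K)
    (P : Matrix (Fin d) (Fin d) K),
    (∀ x ∈ S.gc n, ∀ y ∈ S.gc n, A ⁅x, y⁆ = A x * A y - A y * A x) ∧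
    (∀ x ∈ S.b, x ∈ S.gc n → (1 - P) * A x * P = 0) ∧
    ∀ γ ∈ S.Φp, S.f γ ∈ S.gc n → (S.hc γ : g) ∈ S.gc n → (1 - P) * A (S.f γ) * P ≠ 0 := by
  have := S.gc_findim n
  set L := S.gc n with hL
  let bL := Module.finBasis K L
  obtain ⟨π, hπ⟩ := LinearMap.exists_leftInverse_of_injective L.toSubmodule.subtype
    (Submodule.ker_subtype _)
  have hπ' : ∀ x (hx : x ∈ L), π x = ⟨x, hx⟩ := fun x hx => LinearMap.congr_fun hπ ⟨x, hx⟩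
  let B : Submodule K L := S.b.toSubmodule.comap L.toSubmodule.subtype
  obtain ⟨p, hp⟩ := LinearMap.exists_leftInverse_of_injective B.subtype (Submodule.ker_subtype _)
  have hp1 : ∀ x (hx : x ∈ B), p x = ⟨x, hx⟩ := fun x hx => LinearMap.congr_fun hp ⟨x, hx⟩
  let pe : Module.End K L := B.subtype.comp p
  have hpe : ∀ x, x ∈ B → pe x = x := fun x hx => by
    change ((p x : B) : L) = x
    rw [hp1 x hx]
  have hpB : ∀ x, pe x ∈ B := fun x => (p x).2
  let T := LinearMap.toMatrixAlgEquiv bL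
  let A : g →ₗ[K] Matrix (Fin (Module.finrank K L)) (Fin (Module.finrank K L)) K :=
    T.toLinearMap.comp ((LieAlgebra.ad K L : L →ₗ[K] Module.End K L).comp π)
  have hA : ∀ x (hx : x ∈ L), A x = T (LieAlgebra.ad K L ⟨x, hx⟩) := fun x hx => by
    change T (LieAlgebra.ad K L (π x)) = _
    rw [hπ' x hx]
  have hAP : ∀ x (hx : x ∈ L), (1 - T pe) * A x * T pe =
      T ((1 - pe) * LieAlgebra.ad K L ⟨x, hx⟩ * pe) := fun x hx => by
    rw [hA x hx, map_mul, map_mul, map_sub, map_one]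
  refine ⟨_, A, T pe, ?_, ?_, ?_⟩
  · intro x hx y hy
    rw [hA _ (L.lie_mem hx hy), hA x hx, hA y hy, ← map_mul T, ← map_mul T, ← map_sub T]
    congr 1
    ext z : 1
    exact lie_lie (⟨x, hx⟩ : L) (⟨y, hy⟩ : L) z
  · intro x hxb hx
    rw [hAP x hx]
    refine (congrArg T (LinearMap.ext fun z => ?_)).trans (map_zero T)
    have : ⁅(⟨x, hx⟩ : L), pe z⁆ ∈ B := S.b.lie_mem hxb (hpB z)
    rw [Module.End.mul_apply, Module.End.mul_apply, LieAlgebra.ad_apply, LinearMap.sub_apply,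
      Module.End.one_apply, hpe _ this, sub_self, LinearMap.zero_apply]
  · intro γ hγ hf hH h0
    rw [hAP _ hf, map_eq_zero_iff T T.injective] at h0
    have h1 := LinearMap.congr_fun h0 ⟨_, hH⟩
    rw [Module.End.mul_apply, Module.End.mul_apply, hpe _ (S.h_le_b (S.hc γ).2),
      LieAlgebra.ad_apply, LinearMap.zero_apply, LinearMap.sub_apply, Module.End.one_apply,
      sub_eq_zero] at h1
    have h2 : ⁅(⟨S.f γ, hf⟩ : L), (⟨S.hc γ, hH⟩ : L)⁆ ∈ B := h1 ▸ hpB _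
    have h3 : ⁅S.f γ, (S.hc γ : g)⁆ = (2 : K) • S.f γ := by
      rw [← lie_skew, S.mem_W.1 (S.f_mem γ) (S.hc γ), LinearMap.neg_apply,
        S.root_hc (S.pos_subset hγ), neg_smul, neg_neg]
    have h4 : (2 : K) • S.f γ ∈ S.b.toSubmodule := by rw [← h3]; exact h2
    exact S.f_notMem_b hγ ((S.b.toSubmodule.smul_mem_iff two_ne_zero).1 h4)

/-- The product of negative root vectors attached to a list of positive roots. -/
def wordU (l : List (Module.Dual K S.h)) : UEA K g := (l.map fun β => ι K (S.f β)).prod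

theorem wordU_coeff_eq_zero {I : Type*} (s : Finset I) (c : I → K)
    (w : I → List (Module.Dual K S.h)) (hw : ∀ i ∈ s, ∀ β ∈ w i, β ∈ S.Φp)
    (hinj : ∀ i ∈ s, ∀ j ∈ s, (w i).length = (w j).length → i = j)
    (h : ∑ i ∈ s, c i • S.wordU (w i) ∈ S.vIdeal 0) : ∀ i ∈ s, c i = 0 := by
  classical
  choose d A P hA hb hf using S.exists_level_matrices
  have hev : ∀ x, ∀ᶠ n in atTop, x ∈ S.gc n := fun x => by
    obtain ⟨n, hn⟩ := S.gc_exhausts x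
    exact eventually_atTop.2 ⟨n, fun m hm => S.gc_mono hm hn⟩
  have key := S.eventually_sum_words_eq_zero
    (V := fun n => Module.Dual K (MvPolynomial (Fin (d n) × Fin (d n)) K))
    (fun n => fieldAction (A n)) (fun x y => by
      filter_upwards [hev x, hev y] with n hx hy
      exact fieldAction_lie _ _ _ (hA n x hx y hy))
    (fun n => (evalMatrix (P n)).toLinearMap) (fun x hx => by
      filter_upwards [hev x] with n hn
      refine LinearMap.ext fun p => ?_
      exact evalMatrix_matrixField_eq_zero _ _ (hb n x hx hn) p)
    s c (fun i => (w i).map S.f) (by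
      simpa only [wordU, List.map_map, Function.comp_def] using h)
  by_contra! hcon
  have hne : (s.filter fun i => c i ≠ 0).Nonempty := by
    obtain ⟨i, hi, hi0⟩ := hcon
    exact ⟨i, Finset.mem_filter.2 ⟨hi, hi0⟩⟩
  obtain ⟨i, hi, hmax⟩ := Finset.exists_max_image _ (fun i => (w i).length) hne
  rw [Finset.mem_filter] at hi
  have hall : ∀ᶠ n in atTop, ∀ β ∈ (w i).toFinset,
      S.f β ∈ S.gc n ∧ (S.hc β : g) ∈ S.gc n := by
    rw [Filter.eventually_all_finset]
    exact fun β _ => (hev _).and (hev _)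
  obtain ⟨n, hn, hn2⟩ := (key.and hall).exists
  obtain ⟨p, hp1, hp2⟩ := exists_evalWord_ne_zero (P n)
    {M | ∃ β ∈ w i, M = A n (S.f β)}
    (((w i).toFinset.finite_toSet.image fun β => A n (S.f β)).subset (by
      rintro _ ⟨β, hβ, rfl⟩
      exact ⟨β, by simpa using hβ, rfl⟩)) (by
      rintro _ ⟨β, hβ, rfl⟩
      obtain ⟨h1, h2⟩ := hn2 β (List.mem_toFinset.2 hβ)
      exact hf n β (hw i hi.1 β hβ) h1 h2) (w i).length
  have h1 := LinearMap.congr_fun hn p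
  rw [LinearMap.sum_apply, Finset.sum_eq_single_of_mem i hi.1, LinearMap.smul_apply,
    fieldAction_word, LinearMap.zero_apply, smul_eq_mul] at h1
  · refine (mul_ne_zero hi.2 (hp2 _ (by simp) ?_)) h1
    intro M hM
    simp only [List.map_map, List.mem_map, Function.comp] at hM
    obtain ⟨β, hβ, rfl⟩ := hM
    exact ⟨β, hβ, rfl⟩
  · intro j hj hji
    rw [LinearMap.smul_apply, fieldAction_word, smul_eq_mul]
    by_cases hc : c j = 0
    · rw [hc, zero_mul]
    · rw [hp1, mul_zero]
      have h2 := hmax j (Finset.mem_filter.2 ⟨hj, hc⟩)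
      rw [List.length_map, List.length_map]
      exact lt_of_le_of_ne h2 fun h3 => hji (hinj j hj i hi.1 h3)

end RootReductive

namespace RootReductive

variable {K g} (S : RootReductive K g)

theorem ι_smul_comm {lam : Module.Dual K S.h} (x y : g) (m : S.Verma lam) :
    ι K x • ι K y • m = ι K y • ι K x • m + ι K ⁅x, y⁆ • m := by
  rw [UniversalEnvelopingAlgebra.ι_lie, sub_smul, mul_smul, mul_smul]; abel

theorem compHom_eq (lam : Module.Dual K S.h) :
    Module.compHom (S.Verma lam) (algebraMap K (UEA K g)) =
      (inferInstance : Module K (S.Verma lam)) :=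
  Module.ext' _ _ fun r m => algebraMap_smul (UEA K g) r m

/-- The weight spaces of a Verma module. -/
def vW (lam χ : Module.Dual K S.h) : Submodule K (S.Verma lam) :=
  jointEig (fun H : S.h => Algebra.lsmul K K (S.Verma lam) (ι K (H : g))) χ

theorem mem_vW {lam χ : Module.Dual K S.h} {m : S.Verma lam} :
    m ∈ S.vW lam χ ↔ ∀ H : S.h, ι K (H : g) • m = χ H • m := Iff.rfl

theorem iSupIndep_vW (lam : Module.Dual K S.h) : iSupIndep (S.vW lam) :=
  iSupIndep_jointEig (fun H : S.h => Algebra.lsmul K K (S.Verma lam) (ι K (H : g)))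
    (w := fun χ : Module.Dual K S.h => ⇑χ) DFunLike.coe_injective

theorem wtSet_verma (lam χ : Module.Dual K S.h) :
    S.wtSet (S.Verma lam) χ = (S.vW lam χ : Set (S.Verma lam)) := by
  ext m
  refine forall_congr' fun H => ?_
  rw [algebraMap_smul]
  rfl

theorem isLocFin_verma_iff (lam : Module.Dual K S.h) : S.IsLocFin (S.Verma lam) ↔
    ∀ m : S.Verma lam, ∃ N : Submodule K (S.Verma lam), m ∈ N ∧ FiniteDimensional K N ∧
      ∀ x ∈ S.b, ∀ v ∈ N, ι K x • v ∈ N := by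
  simp only [IsLocFin]
  rw [S.compHom_eq lam]

theorem hasFinDimWt_verma_iff (lam : Module.Dual K S.h) : S.HasFinDimWt (S.Verma lam) ↔
    ∀ χ : Module.Dual K S.h, ∃ s : Finset (S.Verma lam),
      (s : Set (S.Verma lam)) ⊆ S.vW lam χ ∧
        (S.vW lam χ : Set (S.Verma lam)) ⊆ Submodule.span K (s : Set (S.Verma lam)) := by
  simp only [HasFinDimWt, wtSet_verma]
  rw [S.compHom_eq lam]

theorem ι_smul_mem_vW {lam χ γ : Module.Dual K S.h} {x : g} (hx : x ∈ S.W γ) {m : S.Verma lam}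
    (hm : m ∈ S.vW lam χ) : ι K x • m ∈ S.vW lam (χ + γ) := by
  intro H
  change ι K (H : g) • ι K x • m = (χ + γ) H • ι K x • m
  rw [ι_smul_comm, S.mem_vW.1 hm H, S.mem_W.1 hx H, map_smul, smul_assoc, LinearMap.add_apply,
    add_smul, smul_comm]

/-- The canonical generator of a Verma module. -/
def vac (lam : Module.Dual K S.h) : S.Verma lam := Submodule.Quotient.mk 1

theorem smul_vac (lam : Module.Dual K S.h) (u : UEA K g) :
    u • S.vac lam = Submodule.Quotient.mk u := by
  rw [vac, ← Submodule.Quotient.mk_smul, smul_eq_mul, mul_one]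

theorem smul_vac_eq_zero (lam : Module.Dual K S.h) (u : UEA K g) :
    u • S.vac lam = 0 ↔ u ∈ S.vIdeal lam := by
  rw [smul_vac, Submodule.Quotient.mk_eq_zero]

theorem vac_mem (lam : Module.Dual K S.h) : S.vac lam ∈ S.vW lam lam := by
  intro H
  change ι K (H : g) • S.vac lam = lam H • S.vac lam
  rw [← sub_eq_zero, ← algebraMap_smul (UEA K g) (lam H) (S.vac lam), ← sub_smul,
    smul_vac_eq_zero]
  exact Submodule.subset_span (Or.inr ⟨H, rfl⟩)

theorem pos_smul_vac {lam β : Module.Dual K S.h} (hβ : β ∈ S.Φp) {x : g} (hx : x ∈ S.W β) :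
    ι K x • S.vac lam = 0 := by
  rw [smul_vac_eq_zero]
  refine Submodule.subset_span (Or.inl ⟨x, ?_, rfl⟩)
  exact Submodule.mem_iSup_of_mem β (Submodule.mem_iSup_of_mem hβ hx)

/-- The vectors obtained from the canonical generator by applying negative root vectors. -/
def wordV (lam : Module.Dual K S.h) (l : List (Module.Dual K S.h)) : S.Verma lam :=
  S.wordU l • S.vac lam

theorem wordV_nil (lam : Module.Dual K S.h) : S.wordV lam [] = S.vac lam := by
  rw [wordV, wordU, List.map_nil, List.prod_nil, one_smul]

theorem wordV_cons (lam β : Module.Dual K S.h) (l : List (Module.Dual K S.h)) :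
    S.wordV lam (β :: l) = ι K (S.f β) • S.wordV lam l := by
  rw [wordV, wordV, wordU, wordU, List.map_cons, List.prod_cons, mul_smul]

theorem wordV_mem (lam : Module.Dual K S.h) (l : List (Module.Dual K S.h)) :
    S.wordV lam l ∈ S.vW lam (lam - l.sum) := by
  induction l with
  | nil => rw [wordV_nil, List.sum_nil, sub_zero]; exact S.vac_mem lam
  | cons β l ih =>
    have := S.ι_smul_mem_vW (S.f_mem β) ih
    rwa [wordV_cons, List.sum_cons, show lam - (β + l.sum) = lam - l.sum + -β by abel]

theorem wordV_sum_eq {lam χ : Module.Dual K S.h} {l : List (Module.Dual K S.h)}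
    (h : S.wordV lam l ∈ S.vW lam χ) (h0 : S.wordV lam l ≠ 0) : lam - l.sum = χ := by
  by_contra hne
  exact h0 (Submodule.disjoint_def.1 ((S.iSupIndep_vW lam).pairwiseDisjoint hne) _
    (S.wordV_mem lam l) h)

theorem sum_smul_wordV {I : Type*} (s : Finset I) (c : I → K) (lam : Module.Dual K S.h)
    (w : I → List (Module.Dual K S.h)) : ∑ i ∈ s, c i • S.wordV lam (w i) =
      (∑ i ∈ s, c i • S.wordU (w i)) • S.vac lam := by
  rw [Finset.sum_smul]
  exact Finset.sum_congr rfl fun i _ => (smul_assoc _ _ _).symm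

theorem linearIndependent_wordV {I : Type*} (w : I → List (Module.Dual K S.h))
    (hw : ∀ i, ∀ β ∈ w i, β ∈ S.Φp) (hinj : Function.Injective fun i => (w i).length) :
    LinearIndependent K fun i => S.wordV 0 (w i) := by
  rw [linearIndependent_iff']
  intro s c hs
  rw [sum_smul_wordV, smul_vac_eq_zero] at hs
  exact S.wordU_coeff_eq_zero s c w (fun i _ => hw i) (fun i _ j _ hij => hinj hij) hs

theorem isDynkin_of_hasFinDimWt (h : S.HasFinDimWt (S.Verma 0)) : S.IsDynkin := by
  intro α hα
  by_contra hcon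
  obtain ⟨s, -, hs⟩ := (S.hasFinDimWt_verma_iff 0).1 h (-α)
  choose l hl1 hl2 hl3 _ using S.exists_long_decomposition hα hcon
  have hli := S.linearIndependent_wordV (fun k : ℕ => (α - (l k).sum) :: l k)
    (fun k β hβ => by
      rcases List.mem_cons.1 hβ with rfl | hβ
      · exact hl3 k
      · exact hl2 k β hβ)
    (fun i j hij => by simpa [hl1] using hij)
  have := hli.finite_of_le_span_finite _ (s : Set (S.Verma 0)) (by
    rintro _ ⟨k, rfl⟩
    apply hs
    have := S.wordV_mem 0 ((α - (l k).sum) :: l k)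
    rwa [List.sum_cons, sub_add_cancel, zero_sub] at this)
  exact not_finite ℕ

theorem f_smul_vac_ne_zero {β : Module.Dual K S.h} (hβ : β ∈ S.Φp) :
    ι K (S.f β) • S.vac 0 ≠ 0 := by
  have := (S.linearIndependent_wordV (fun _ : Unit => [β]) (fun i γ hγ => by
    rw [List.mem_singleton] at hγ; rwa [hγ]) (fun _ _ _ => rfl)).ne_zero ()
  rwa [wordV_cons, wordV_nil] at this

theorem isDynkin_of_isLocFin (h : S.IsLocFin (S.Verma 0)) : S.IsDynkin := by
  intro α hα
  obtain ⟨N, hN, hfin, hst⟩ := (S.isLocFin_verma_iff 0).1 h (ι K (S.f α) • S.vac 0)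
  refine S.subset_closure_simples (D := {γ ∈ S.Φp | ι K (S.f γ) • S.vac 0 ∈ N}) ?_
    (fun γ hγ => hγ.1) ?_ ⟨hα, hN⟩
  · refine Set.Finite.subset ((finite_setOf_inter_ne (S.iSupIndep_vW 0) N).image Neg.neg) ?_
    rintro γ ⟨hγ, hγN⟩
    refine ⟨-γ, ⟨_, hγN, ?_, S.f_smul_vac_ne_zero hγ⟩, neg_neg γ⟩
    have := S.ι_smul_mem_vW (S.f_mem γ) (S.vac_mem 0)
    rwa [zero_add] at this
  · rintro β hβ γ hγ ⟨hβγ, hN2⟩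
    refine ⟨hβ, ?_⟩
    have hroot : γ + -(β + γ) = -β := by abel
    have hx := lie_mem_W (S.e_mem γ) (S.f_mem (β + γ))
    have hx0 := S.lie_ne_zero (S.pos_subset hγ) (S.neg_pos_root hβγ)
      (by rw [hroot]; exact S.neg_pos_root hβ) (S.e_mem γ) (S.f_mem (β + γ))
      (e_ne (S.pos_subset hγ)) (f_ne (S.pos_subset hβγ))
    rw [hroot] at hx
    obtain ⟨c, hc⟩ := S.W_eq_smul_f (S.pos_subset hβ) hx
    have hc0 : c ≠ 0 := by rintro rfl; exact hx0 (by rw [hc, zero_smul])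
    have hb : S.e γ ∈ S.b := by
      change S.e γ ∈ S.b.toSubmodule
      rw [S.b_def]
      exact Submodule.mem_sup_right (Submodule.mem_iSup_of_mem γ
        (Submodule.mem_iSup_of_mem hγ (S.e_mem γ)))
    have h1 := hst _ hb _ hN2
    rw [ι_smul_comm, S.pos_smul_vac hγ (S.e_mem γ), smul_zero, zero_add, hc, map_smul,
      smul_assoc] at h1
    exact (N.smul_mem_iff hc0).1 h1

/-- The words in simple negative root vectors. -/
def simpleWords (lam : Module.Dual K S.h) : Set (S.Verma lam) :=
  {m | ∃ l : List (Module.Dual K S.h), (∀ σ ∈ l, σ ∈ S.simples) ∧ m = S.wordV lam l}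

theorem lie_e_f_simple {σ τ : Module.Dual K S.h} (hσ : σ ∈ S.simples) (hτ : τ ∈ S.simples)
    (hne : σ ≠ τ) : ⁅S.e σ, S.f τ⁆ = 0 := by
  by_contra h0
  have := S.root_of_mem (lie_mem_W (S.e_mem σ) (S.f_mem τ)) h0
    (by rw [← sub_eq_add_neg]; exact sub_ne_zero.2 hne)
  rw [← sub_eq_add_neg] at this
  exact S.simple_sub_not_root hσ hτ this

/-- The stabilizer in `g` of a subspace of a Verma module. -/
def stabVerma {lam : Module.Dual K S.h} (N : Submodule K (S.Verma lam)) : LieSubalgebra K g where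
  carrier := {x | ∀ m ∈ N, ι K x • m ∈ N}
  add_mem' := by
    intro x y hx hy m hm
    rw [map_add, add_smul]; exact N.add_mem (hx m hm) (hy m hm)
  zero_mem' := by intro m _; rw [map_zero, zero_smul]; exact N.zero_mem
  smul_mem' := by
    intro c x hx m hm
    rw [map_smul, smul_assoc]; exact N.smul_mem c (hx m hm)
  lie_mem' := by
    intro x y hx hy m hm
    rw [UniversalEnvelopingAlgebra.ι_lie, sub_smul, mul_smul, mul_smul]
    exact N.sub_mem (hx _ (hy m hm)) (hy _ (hx m hm))

theorem smul_mem_of_stab {lam : Module.Dual K S.h} (N : Submodule K (S.Verma lam))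
    (hN : S.stabVerma N = ⊤) (u : UEA K g) {m : S.Verma lam} (hm : m ∈ N) : u • m ∈ N := by
  let T : Subalgebra K (UEA K g) :=
    { carrier := {u | ∀ m ∈ N, u • m ∈ N}
      add_mem' := fun {a b} ha hb m hm => by
        rw [add_smul]; exact N.add_mem (ha m hm) (hb m hm)
      mul_mem' := fun {a b} ha hb m hm => by
        rw [mul_smul]; exact ha _ (hb m hm)
      algebraMap_mem' := fun r m hm => by
        rw [algebraMap_smul]; exact N.smul_mem r hm }
  refine UniversalEnvelopingAlgebra.mem_of_forall_ι_mem T (fun x => ?_) u m hm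
  have : x ∈ S.stabVerma N := by rw [hN]; exact LieSubalgebra.mem_top x
  exact this

/-- `g` is generated by `h` and the simple root spaces and their negatives. -/
def SimplyGenerated : Prop :=
  LieSubalgebra.lieSpan K g ((S.h : Set g) ∪
    ⋃ α ∈ S.simples, ((rootSp K g S.h α : Set g) ∪ (rootSp K g S.h (-α) : Set g))) = ⊤

variable {S} in
theorem SimplyGenerated.le (h : S.SimplyGenerated) (L : LieSubalgebra K g)
    (hh : ∀ H ∈ S.h, H ∈ L) (he : ∀ σ ∈ S.simples, S.e σ ∈ L) (hf : ∀ σ ∈ S.simples, S.f σ ∈ L) :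
    L = ⊤ := by
  rw [SimplyGenerated] at h
  rw [eq_top_iff, ← h, LieSubalgebra.lieSpan_le]
  rintro x (hx | hx)
  · exact hh x hx
  · obtain ⟨σ, hσ, hx⟩ := Set.mem_iUnion₂.1 hx
    rcases hx with hx | hx
    · obtain ⟨c, rfl⟩ := S.W_eq_smul_e (S.pos_subset hσ.1) hx
      exact L.smul_mem c (he σ hσ)
    · obtain ⟨c, rfl⟩ := S.W_eq_smul_f (S.pos_subset hσ.1) hx
      exact L.smul_mem c (hf σ hσ)

theorem span_simpleWords (h : S.SimplyGenerated) (lam : Module.Dual K S.h) :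
    Submodule.span K (S.simpleWords lam) = ⊤ := by
  set N := Submodule.span K (S.simpleWords lam) with hNdef
  have hgen : ∀ x : g, (∀ l : List (Module.Dual K S.h), (∀ σ ∈ l, σ ∈ S.simples) →
      ι K x • S.wordV lam l ∈ N) → x ∈ S.stabVerma N := by
    intro x hx m hm
    have : N ≤ N.comap (Algebra.lsmul K K (S.Verma lam) (ι K x)) := by
      conv_lhs => rw [hNdef]
      rw [Submodule.span_le]
      rintro _ ⟨l, hl, rfl⟩
      exact hx l hl
    exact this hm
  have hword : ∀ l : List (Module.Dual K S.h), (∀ σ ∈ l, σ ∈ S.simples) → S.wordV lam l ∈ N :=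
    fun l hl => Submodule.subset_span ⟨l, hl, rfl⟩
  have hh : ∀ H ∈ S.h, ∀ l : List (Module.Dual K S.h), (∀ σ ∈ l, σ ∈ S.simples) →
      ι K H • S.wordV lam l ∈ N := fun H hH l hl => by
    rw [S.mem_vW.1 (S.wordV_mem lam l) ⟨H, hH⟩]
    exact N.smul_mem _ (hword l hl)
  have hf : ∀ σ ∈ S.simples, S.f σ ∈ S.stabVerma N := fun σ hσ => hgen _ fun l hl => by
    rw [← wordV_cons]
    exact hword _ (List.forall_mem_cons.2 ⟨hσ, hl⟩)
  have htop : S.stabVerma N = ⊤ := by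
    refine h.le _ (fun H hH => hgen _ (hh H hH)) (fun σ hσ => hgen _ fun l => ?_) hf
    induction l with
    | nil =>
      intro _
      rw [wordV_nil, S.pos_smul_vac hσ.1 (S.e_mem σ)]
      exact N.zero_mem
    | cons τ l ih =>
      intro hl
      obtain ⟨hτ, hl1⟩ := List.forall_mem_cons.1 hl
      rw [wordV_cons, ι_smul_comm]
      refine N.add_mem (hf τ hτ _ (ih hl1)) ?_
      by_cases hne : σ = τ
      · subst hne
        rw [lie_e_f]
        exact hh _ (S.hc σ).2 l hl1
      · rw [S.lie_e_f_simple hσ hτ hne, map_zero, zero_smul]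
        exact N.zero_mem
  rw [eq_top_iff]
  rintro m -
  induction m using Submodule.Quotient.induction_on with
  | H u =>
    rw [← smul_vac]
    refine S.smul_mem_of_stab N htop u ?_
    rw [← wordV_nil]
    exact hword [] (by simp)

theorem mem_span_words_weight (h : S.SimplyGenerated) {lam χ : Module.Dual K S.h}
    {m : S.Verma lam} (hm : m ∈ S.vW lam χ) :
    m ∈ Submodule.span K {m | ∃ l : List (Module.Dual K S.h), (∀ σ ∈ l, σ ∈ S.simples) ∧
      lam - l.sum = χ ∧ m = S.wordV lam l} := by
  have h1 := mem_span_inter_of_iSupIndep (S.iSupIndep_vW lam) (s := S.simpleWords lam)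
    (by rintro _ ⟨l, _, rfl⟩; exact ⟨_, S.wordV_mem lam l⟩) hm
    (by rw [S.span_simpleWords h lam]; exact Submodule.mem_top)
  refine (Submodule.span_le.2 ?_ : Submodule.span K _ ≤ _) h1
  rintro _ ⟨⟨l, hl, rfl⟩, hl2⟩
  by_cases h0 : S.wordV lam l = 0
  · rw [h0]; exact Submodule.zero_mem _
  · exact Submodule.subset_span ⟨l, hl, S.wordV_sum_eq hl2 h0, rfl⟩

theorem hasFinDimWt_of_simplyGenerated (h : S.SimplyGenerated) (lam : Module.Dual K S.h) :
    S.HasFinDimWt (S.Verma lam) := by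
  rw [hasFinDimWt_verma_iff]
  intro χ
  have hfin : {m | ∃ l : List (Module.Dual K S.h), (∀ σ ∈ l, σ ∈ S.simples) ∧
      lam - l.sum = χ ∧ m = S.wordV lam l}.Finite := by
    by_cases hex : ∃ l : List (Module.Dual K S.h), (∀ σ ∈ l, σ ∈ S.simples) ∧ lam - l.sum = χ
    · obtain ⟨l₀, h1, h2⟩ := hex
      refine (l₀.permutations.finite_toSet.image (S.wordV lam)).subset ?_
      rintro _ ⟨l, hl, hl2, rfl⟩
      refine ⟨l, List.mem_permutations.2 (Multiset.coe_eq_coe.1 ?_), rfl⟩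
      refine S.simple_multiset_unique _ _ _ rfl (by simpa using hl) (by simpa using h1) ?_
      rw [Multiset.sum_coe, Multiset.sum_coe]
      exact sub_right_injective (hl2.trans h2.symm)
    · refine Set.finite_empty.subset ?_
      rintro _ ⟨l, hl, hl2, rfl⟩
      exact hex ⟨l, hl, hl2⟩
  refine ⟨hfin.toFinset, ?_, fun m hm => ?_⟩
  · intro m hm
    obtain ⟨l, hl, rfl, rfl⟩ := hfin.mem_toFinset.1 hm
    exact S.wordV_mem lam l
  · rw [hfin.coe_toFinset]
    exact S.mem_span_words_weight h hm

theorem isLocFin_of_isDynkin (hD : S.IsDynkin) (h : S.SimplyGenerated) (lam : Module.Dual K S.h) :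
    S.IsLocFin (S.Verma lam) := by
  rw [isLocFin_verma_iff]
  intro m
  have hm : m ∈ Submodule.span K (S.simpleWords lam) := by
    rw [S.span_simpleWords h lam]; exact Submodule.mem_top
  induction hm using Submodule.span_induction with
  | zero =>
    exact ⟨⊥, Submodule.zero_mem _, inferInstance, fun x _ v hv => by
      rw [(Submodule.mem_bot K).1 hv, smul_zero]; exact Submodule.zero_mem _⟩
  | add x y _ _ hx hy =>
    obtain ⟨N, h1, h2, h3⟩ := hx
    obtain ⟨N', h1', h2', h3'⟩ := hy
    refine ⟨N ⊔ N', Submodule.add_mem_sup h1 h1', inferInstance, fun x hx v hv => ?_⟩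
    obtain ⟨a, ha, b, hb, rfl⟩ := Submodule.mem_sup.1 hv
    rw [smul_add]
    exact Submodule.add_mem_sup (h3 x hx a ha) (h3' x hx b hb)
  | smul c x _ hx =>
    obtain ⟨N, h1, h2, h3⟩ := hx
    exact ⟨N, N.smul_mem c h1, h2, h3⟩
  | mem x hx =>
    obtain ⟨l, hl, rfl⟩ := hx
    set T : Set (S.Verma lam) := S.wordV lam '' {l' | l'.Subperm l} with hT
    have hfin : T.Finite := by
      refine Set.Finite.image _ ?_
      refine (l.sublists.flatMap List.permutations).finite_toSet.subset ?_
      rintro l' ⟨l'', h1, h2⟩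
      exact List.mem_flatMap.2 ⟨l'', List.mem_sublists.2 h2, List.mem_permutations.2 h1.symm⟩
    refine ⟨Submodule.span K T, Submodule.subset_span ⟨l, List.Subperm.refl l, rfl⟩,
      FiniteDimensional.span_of_finite K hfin, fun x hx v hv => ?_⟩
    have hstab : S.b ≤ S.stabVerma (Submodule.span K T) := by
      have hgen : ∀ x : g, (∀ l' : List (Module.Dual K S.h), l'.Subperm l →
          ι K x • S.wordV lam l' ∈ Submodule.span K T) → x ∈ S.stabVerma (Submodule.span K T) := by
        intro x hx m hm
        have : Submodule.span K T ≤ (Submodule.span K T).comap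
            (Algebra.lsmul K K (S.Verma lam) (ι K x)) := by
          rw [Submodule.span_le]
          rintro _ ⟨l', hl', rfl⟩
          exact hx l' hl'
        exact this hm
      change S.b.toSubmodule ≤ (S.stabVerma (Submodule.span K T)).toSubmodule
      rw [S.b_def]
      refine sup_le (fun H hH => hgen H fun l' hl' => ?_)
        (iSup₂_le fun β hβ x hx => hgen x fun l' hl' => ?_)
      · rw [S.mem_vW.1 (S.wordV_mem lam l') ⟨H, hH⟩]
        exact Submodule.smul_mem _ _ (Submodule.subset_span ⟨l', hl', rfl⟩)
      · have h1 := S.mem_span_words_weight h (S.ι_smul_mem_vW hx (S.wordV_mem lam l'))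
        refine Submodule.span_mono ?_ h1
        rintro _ ⟨l'', hl'', hsum, rfl⟩
        refine ⟨l'', ?_, rfl⟩
        obtain ⟨mβ, hmβ, hmsum⟩ := AddSubmonoid.exists_multiset_of_mem_closure (hD β hβ)
        have hl's : ∀ σ ∈ l', σ ∈ S.simples := fun σ hσ => hl σ (hl'.subset hσ)
        have h2 : (l'' : Multiset (Module.Dual K S.h)) + mβ = l' := by
          refine S.simple_multiset_unique _ _ _ rfl ?_ (by simpa using hl's) ?_
          · intro σ hσ
            rcases Multiset.mem_add.1 hσ with hσ | hσ
            · exact hl'' σ (Multiset.mem_coe.1 hσ)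
            · exact hmβ σ hσ
          · rw [Multiset.sum_add, hmsum, Multiset.sum_coe, Multiset.sum_coe]
            have h3 : l''.sum = lam - (lam - l''.sum) := by abel
            rw [h3, hsum]; abel
        have h4 : List.Subperm l'' l' := by
          rw [← Multiset.coe_le, ← h2]
          exact Multiset.le_add_right _ _
        exact h4.trans hl'
    exact hstab hx v hv

end RootReductive

namespace RootReductive

variable {K g} (S : RootReductive K g)

theorem exists_simple_sub {m : Multiset (Module.Dual K S.h)} (hm : ∀ σ ∈ m, σ ∈ S.simples)
    (hα : m.sum ∈ S.Φp) : ∃ σ ∈ m, m.sum = σ ∨ m.sum - σ ∈ S.Φp := by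
  classical
  by_contra! hcon
  have hαΦ := S.pos_subset hα
  have hnn : ∀ σ ∈ m, σ (S.hc m.sum) ∈ (ratCone K).comap (negAddMonoidHom (α := K)) := by
    intro σ hσ
    have hσp := (hm σ hσ).1
    have hsub : σ - m.sum ∉ S.Φ := by
      intro h
      rcases S.pos_or_neg h with h | h
      · exact (hm σ hσ).2 ⟨_, hα, _, h, by abel⟩
      · exact (hcon σ hσ).2 (by rwa [neg_sub] at h)
    obtain ⟨n, hn⟩ := S.root_hc_neg_nat hαΦ (S.pos_subset hσp) (hcon σ hσ).1.symm hsub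
    exact ⟨n, by positivity, by simp [hn]⟩
  have h2 : m.sum (S.hc m.sum) = 2 := root_hc hαΦ
  have h3 : m.sum (S.hc m.sum) ∈ (ratCone K).comap (negAddMonoidHom (α := K)) := by
    rw [S.multiset_sum_apply m]
    refine AddSubmonoid.multiset_sum_mem _ _ fun c hc => ?_
    obtain ⟨σ, hσ, rfl⟩ := Multiset.mem_map.1 hc
    exact hnn σ hσ
  rw [h2] at h3
  have h4 := eq_zero_of_mem_ratCone (F := K) (c := 2) ⟨2, by norm_num, by simp⟩ h3
  exact two_ne_zero h4

theorem root_vectors_mem (G : LieSubalgebra K g) (he : ∀ σ ∈ S.simples, S.e σ ∈ G)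
    (hf : ∀ σ ∈ S.simples, S.f σ ∈ G) (n : ℕ) : ∀ m : Multiset (Module.Dual K S.h),
    m.card = n → (∀ σ ∈ m, σ ∈ S.simples) → m.sum ∈ S.Φp →
      S.W m.sum ≤ G.toSubmodule ∧ S.W (-m.sum) ≤ G.toSubmodule := by
  classical
  have hle : ∀ {α : Module.Dual K S.h} {x : g}, α ∈ S.Φ → x ∈ G → x ∈ S.W α → x ≠ 0 →
      S.W α ≤ G.toSubmodule := by
    intro α x hα hx hxα h0 y hy
    obtain ⟨c, rfl⟩ := S.W_eq_smul hα hxα h0 hy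
    exact G.smul_mem c hx
  induction n with
  | zero =>
    intro m hm _ h0
    rw [Multiset.card_eq_zero.1 hm] at h0
    exact absurd rfl (S.root_ne_zero (S.pos_subset h0))
  | succ n ih =>
    intro m hm hs h0
    have hΦ := S.pos_subset h0
    obtain ⟨σ, hσ, h | h⟩ := S.exists_simple_sub hs h0
    · rw [h] at h0 hΦ ⊢
      exact ⟨hle hΦ (he σ (hs σ hσ)) (S.e_mem σ) (e_ne hΦ),
        hle (S.neg_root hΦ) (hf σ (hs σ hσ)) (S.f_mem σ) (f_ne hΦ)⟩
    · have h1 : m.sum = σ + (m.erase σ).sum := by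
        rw [← Multiset.sum_cons, Multiset.cons_erase hσ]
      have h2 : m.sum - σ = (m.erase σ).sum := by rw [h1]; abel
      rw [h2] at h
      have h3 := ih (m.erase σ) (by rw [Multiset.card_erase_of_mem hσ, hm]; rfl)
        (fun τ hτ => hs τ (Multiset.mem_of_mem_erase hτ)) h
      have hσΦ := S.pos_subset (hs σ hσ).1
      have hβΦ := S.pos_subset h
      set β := (m.erase σ).sum
      rw [h1] at hΦ ⊢
      refine ⟨hle hΦ (G.lie_mem (he σ (hs σ hσ)) (h3.1 (S.e_mem β)))
          (lie_mem_W (S.e_mem σ) (S.e_mem β)) (lie_e_ne_zero hσΦ hβΦ hΦ), ?_⟩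
      have hΦ2 : -σ + -β ∈ S.Φ := by rw [← neg_add]; exact S.neg_root hΦ
      rw [neg_add]
      exact hle hΦ2 (G.lie_mem (hf σ (hs σ hσ)) (h3.2 (S.f_mem β)))
        (lie_mem_W (S.f_mem σ) (S.f_mem β))
        (lie_ne_zero (S.neg_root hσΦ) (S.neg_root hβΦ) hΦ2 (S.f_mem σ) (S.f_mem β)
          (f_ne hσΦ) (f_ne hβΦ))

theorem simplyGenerated_of_isDynkin (hD : S.IsDynkin) : S.SimplyGenerated := by
  rw [SimplyGenerated, eq_top_iff]
  set G := LieSubalgebra.lieSpan K g ((S.h : Set g) ∪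
    ⋃ α ∈ S.simples, ((rootSp K g S.h α : Set g) ∪ (rootSp K g S.h (-α) : Set g)))
  have he : ∀ σ ∈ S.simples, S.e σ ∈ G := fun σ hσ => LieSubalgebra.subset_lieSpan
    (Or.inr (Set.mem_biUnion hσ (Or.inl (S.e_mem σ))))
  have hf : ∀ σ ∈ S.simples, S.f σ ∈ G := fun σ hσ => LieSubalgebra.subset_lieSpan
    (Or.inr (Set.mem_biUnion hσ (Or.inr (S.f_mem σ))))
  change (⊤ : Submodule K g) ≤ G.toSubmodule
  rw [← S.rootdec]
  refine sup_le (fun x hx => LieSubalgebra.subset_lieSpan (Or.inl hx)) (iSup₂_le fun α hα => ?_)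
  rcases S.pos_or_neg hα with h | h
  · obtain ⟨m, hm, hs⟩ := AddSubmonoid.exists_multiset_of_mem_closure (hD α h)
    rw [← hs] at h ⊢
    exact (S.root_vectors_mem G he hf _ m rfl hm h).1
  · obtain ⟨m, hm, hs⟩ := AddSubmonoid.exists_multiset_of_mem_closure (hD _ h)
    rw [← hs] at h
    have := (S.root_vectors_mem G he hf _ m rfl hm h).2
    rwa [hs, neg_neg] at this

/-- If `a` is a homogeneous subspace, then components of negative weight of `a + b`
come from `a`. -/
theorem mem_of_mem_sup_b {a : Submodule K g} (ha : S.IsHomog a) {β : Module.Dual K S.h}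
    (hβ : β ∈ S.Φp) {x : g} (hx : x ∈ a ⊔ S.b.toSubmodule) (hxβ : x ∈ S.W (-β)) : x ∈ a := by
  have h1 : x ∈ Submodule.span K ((⋃ χ, ((a ⊓ S.W χ : Submodule K g) : Set g)) ∪
      ⋃ χ ∈ insert 0 S.Φp, (S.W χ : Set g)) := by
    refine (sup_le (ha.trans (iSup_le fun χ y hy => ?_))
      (S.b_le_iSup.trans (iSup₂_le fun χ hχ y hy => ?_)) : a ⊔ S.b.toSubmodule ≤ _) hx
    · exact Submodule.subset_span (Or.inl (Set.mem_iUnion.2 ⟨χ, hy⟩))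
    · exact Submodule.subset_span (Or.inr (Set.mem_biUnion hχ hy))
  have h2 := mem_span_inter_of_iSupIndep S.iSupIndep_W (by
    rintro v (hv | hv)
    · obtain ⟨χ, hv⟩ := Set.mem_iUnion.1 hv
      exact ⟨χ, hv.2⟩
    · obtain ⟨χ, _, hv⟩ := Set.mem_iUnion₂.1 hv
      exact ⟨χ, hv⟩) hxβ h1
  refine (Submodule.span_le.2 ?_ : Submodule.span K _ ≤ _) h2
  rintro v ⟨hv | hv, hvβ⟩
  · obtain ⟨χ, hv⟩ := Set.mem_iUnion.1 hv
    exact hv.1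
  · obtain ⟨χ, hχ, hv⟩ := Set.mem_iUnion₂.1 hv
    have hne : χ ≠ -β := by
      rintro rfl
      rcases hχ with h | h
      · exact S.root_ne_zero (S.pos_subset hβ) (neg_eq_zero.1 h)
      · exact S.not_pos_neg hβ h
    rw [S.W_inter hv hvβ hne]
    exact a.zero_mem

theorem isHomog_of_rootdec {a : Submodule K g}
    (ha : a = (a ⊓ S.h.toSubmodule) ⊔ (⨆ α ∈ S.Φ, (a ⊓ rootSp K g S.h α))) : S.IsHomog a := by
  rw [IsHomog]
  conv_lhs => rw [ha]
  refine sup_le ?_ (iSup₂_le fun α _ => le_iSup (fun χ => a ⊓ S.W χ) α)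
  rw [← S.W_zero]
  exact le_iSup (fun χ => a ⊓ S.W χ) 0

theorem isDynkin_of_exists_chain (gc' : ℕ → LieSubalgebra K g)
    (hfd : ∀ n, FiniteDimensional K (gc' n)) (hex : ∀ x : g, ∃ n, x ∈ gc' n)
    (hh : ∀ n, S.IsHomog (gc' n).toSubmodule)
    (hp : ∀ n, ∃ p : LieSubalgebra K g,
      p.toSubmodule = (gc' n).toSubmodule ⊔ S.b.toSubmodule) : S.IsDynkin := by
  intro α hα
  obtain ⟨n, hn⟩ := hex (S.f α)
  obtain ⟨p, hp⟩ := hp n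
  have := hfd n
  have hmemp : ∀ {x : g}, x ∈ p ↔ x ∈ (gc' n).toSubmodule ⊔ S.b.toSubmodule := by
    intro x; rw [← hp]; rfl
  refine S.subset_closure_simples (D := {γ | γ ∈ S.Φp ∧ S.f γ ∈ gc' n}) ?_ (fun γ hγ => hγ.1) ?_
    ⟨hα, hn⟩
  · have h1 := finite_setOf_inter_ne S.iSupIndep_W (gc' n).toSubmodule
    refine (h1.preimage neg_injective.injOn).subset fun γ hγ => ?_
    exact ⟨S.f γ, hγ.2, S.f_mem γ, f_ne (S.pos_subset hγ.1)⟩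
  · intro β hβ γ hγ hD
    refine ⟨hβ, ?_⟩
    have h1 : ⁅S.e γ, S.f (β + γ)⁆ ∈ p := by
      refine p.lie_mem (hmemp.2 ?_) (hmemp.2 (Submodule.mem_sup_left hD.2))
      refine Submodule.mem_sup_right ?_
      rw [S.b_def]
      exact Submodule.mem_sup_right
        (Submodule.mem_iSup_of_mem γ (Submodule.mem_iSup_of_mem hγ (S.e_mem γ)))
    have hw : γ + -(β + γ) = -β := by abel
    have h2 := lie_mem_W (S.e_mem γ) (S.f_mem (β + γ))
    have hβΦ := S.pos_subset hβ
    have h3 : ⁅S.e γ, S.f (β + γ)⁆ ≠ 0 :=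
      lie_ne_zero (S.pos_subset hγ) (S.neg_root (S.pos_subset hD.1))
        (by rw [hw]; exact S.neg_root hβΦ) (S.e_mem _) (S.f_mem _) (e_ne (S.pos_subset hγ))
        (f_ne (S.pos_subset hD.1))
    rw [hw] at h2
    have h4 := S.mem_of_mem_sup_b (hh n) hβ (hmemp.1 h1) h2
    obtain ⟨c, hc⟩ := S.W_eq_smul (S.neg_root hβΦ) h2 h3 (S.f_mem β)
    rw [hc]
    exact (gc' n).smul_mem c h4

end RootReductive

namespace RootReductive

variable {K g} (S : RootReductive K g)

theorem hc_apply_ne_zero_symm {σ τ : Module.Dual K S.h} (hσ : σ ∈ S.Φ) (hτ : τ ∈ S.Φ)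
    (h : σ (S.hc τ) ≠ 0) : τ (S.hc σ) ≠ 0 := by
  obtain ⟨n, hn⟩ := S.exists_level (s := {S.e σ, S.f σ, S.e τ, S.f τ}) (by simp)
  simp only [Set.insert_subset_iff, Set.singleton_subset_iff] at hn
  obtain ⟨h1, h2, h3, h4⟩ := hn
  have := S.gc_findim n
  obtain ⟨d, ω, -, -, -, hk⟩ := S.exists_killing_form (S.gc n) (S.isHomog_gc n)
  obtain ⟨q, hq, -, hq'⟩ := hk σ hσ h1 h2
  obtain ⟨r, hr, -, hr'⟩ := hk τ hτ h3 h4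
  have e1 := hq' (S.hc τ) (by rw [← S.lie_e_f]; exact (S.gc n).lie_mem h3 h4)
  have e2 := hr' (S.hc σ) (by rw [← S.lie_e_f]; exact (S.gc n).lie_mem h1 h2)
  have e3 : ∑ i, ω i (S.hc τ) * ω i (S.hc σ) = ∑ i, ω i (S.hc σ) * ω i (S.hc τ) :=
    Finset.sum_congr rfl fun _ _ => mul_comm _ _
  intro h0
  rw [h0, zero_mul] at e2
  rw [e3, e2] at e1
  have hqK : (q : K) ≠ 0 := by exact_mod_cast hq.ne'
  exact (mul_ne_zero h hqK) e1.symm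

variable {F : Finset (Module.Dual K S.h)}

/-- An integral combination of roots is zero as soon as it is orthogonal to these roots. -/
theorem int_comb_eq_zero (hF : ∀ σ ∈ F, σ ∈ S.Φ) (c : Module.Dual K S.h → ℤ)
    (h : ∀ τ ∈ F, (∑ σ ∈ F, c σ • σ) (S.hc τ) = 0) : ∑ σ ∈ F, c σ • σ = 0 := by
  classical
  set δ := ∑ σ ∈ F, c σ • σ with hδ
  refine LinearMap.ext fun H => ?_
  obtain ⟨n, hn⟩ := S.exists_level (s := insert (H : g) ((S.e '' F) ∪ (S.f '' F)))
    (((F.finite_toSet.image _).union (F.finite_toSet.image _)).insert _)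
  have hH : (H : g) ∈ S.gc n := hn (Set.mem_insert _ _)
  have he : ∀ σ ∈ F, S.e σ ∈ S.gc n := fun σ hσ =>
    hn (Or.inr (Or.inl ⟨σ, hσ, rfl⟩))
  have hf : ∀ σ ∈ F, S.f σ ∈ S.gc n := fun σ hσ =>
    hn (Or.inr (Or.inr ⟨σ, hσ, rfl⟩))
  have hhc : ∀ σ ∈ F, (S.hc σ : g) ∈ S.gc n := fun σ hσ => by
    rw [← S.lie_e_f]; exact (S.gc n).lie_mem (he σ hσ) (hf σ hσ)
  have := S.gc_findim n
  obtain ⟨d, ω, hω, -, -, hk⟩ := S.exists_killing_form (S.gc n) (S.isHomog_gc n)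
  choose! q hq _ hq' using fun σ (hσ : σ ∈ F) => hk σ (hF σ hσ) (he σ hσ) (hf σ hσ)
  have hq0 : ∀ σ ∈ F, (q σ : K) ≠ 0 := fun σ hσ => by exact_mod_cast (hq σ hσ).ne'
  set t : S.h := ∑ σ ∈ F, ((c σ : K) * (q σ : K)⁻¹) • S.hc σ with ht
  have hsum : ∀ H' : S.h, (H' : g) ∈ S.gc n → ∑ i, ω i H' * ω i t = δ H' := by
    intro H' hH'
    simp only [ht, map_sum, map_smul, Finset.mul_sum, smul_eq_mul]
    rw [Finset.sum_comm, hδ, LinearMap.sum_apply]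
    refine Finset.sum_congr rfl fun σ hσ => ?_
    have : ∀ i, ω i H' * ((c σ : K) * (q σ : K)⁻¹ * ω i (S.hc σ)) =
      (c σ : K) * (q σ : K)⁻¹ * (ω i H' * ω i (S.hc σ)) := fun i => by ring
    simp only [this, ← Finset.mul_sum]
    rw [hq' σ hσ H' hH', LinearMap.smul_apply, zsmul_eq_mul]
    field_simp [hq0 σ hσ]
  have htmem : (t : g) ∈ S.gc n := by
    rw [ht]
    have : ((∑ σ ∈ F, ((c σ : K) * (q σ : K)⁻¹) • S.hc σ : S.h) : g) =
        ∑ σ ∈ F, ((c σ : K) * (q σ : K)⁻¹) • (S.hc σ : g) :=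
      map_sum S.h.toSubmodule.subtype _ _
    rw [this]
    exact sum_mem fun σ hσ => (S.gc n).smul_mem _ (hhc σ hσ)
  have hδt : δ t = 0 := by
    rw [ht, map_sum]
    exact Finset.sum_eq_zero fun σ hσ => by rw [map_smul, h σ hσ, smul_zero]
  have hzero : ∀ i ∈ Finset.univ, ω i t = 0 := by
    refine eq_zero_of_sum_mul_self (x := fun i => ω i t) (fun i _ => ?_) ?_
    · rw [ht, map_sum]
      refine sum_mem fun σ hσ => ?_
      obtain ⟨x, _, hx, hx0⟩ := hω i
      obtain ⟨m, hm⟩ := S.weight_hc_int (hF σ hσ) hx hx0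
      rw [map_smul, hm]
      exact ⟨(c σ * (q σ)⁻¹) * m, by simp⟩
    · rw [hsum t htmem, hδt, neg_zero]
      exact AddSubmonoid.zero_mem _
  rw [← hsum H hH]
  exact Finset.sum_eq_zero fun i hi => by rw [hzero i hi, mul_zero]

theorem span_int_eq_zero (hF : ∀ σ ∈ F, σ ∈ S.Φ) {δ : Module.Dual K S.h}
    (hδ : δ ∈ Submodule.span ℤ (F : Set (Module.Dual K S.h)))
    (h : ∀ τ ∈ F, δ (S.hc τ) = 0) : δ = 0 := by
  obtain ⟨c, -, rfl⟩ := Submodule.mem_span_finset.1 hδ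
  exact S.int_comb_eq_zero hF c h

/-- Simple roots are linearly independent over the integers. -/
theorem simple_int_comb (hF : ∀ σ ∈ F, σ ∈ S.simples) (c : Module.Dual K S.h → ℤ)
    (h : ∑ σ ∈ F, c σ • σ = 0) : ∀ σ ∈ F, c σ = 0 := by
  classical
  have key : ∀ d : Module.Dual K S.h → ℕ,
      (∀ σ ∈ ∑ σ ∈ F, d σ • ({σ} : Multiset (Module.Dual K S.h)), σ ∈ S.simples) ∧
      (∑ σ ∈ F, d σ • ({σ} : Multiset (Module.Dual K S.h))).sum = ∑ σ ∈ F, d σ • σ ∧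
      ∀ σ ∈ F, (∑ σ ∈ F, d σ • ({σ} : Multiset (Module.Dual K S.h))).count σ = d σ := by
    intro d
    refine ⟨fun σ hσ => ?_, ?_, fun σ hσ => ?_⟩
    · obtain ⟨τ, hτ, hστ⟩ := Multiset.mem_sum.1 hσ
      rw [Multiset.mem_singleton.1 (Multiset.mem_of_mem_nsmul hστ)]
      exact hF τ hτ
    · rw [Multiset.sum_sum]
      exact Finset.sum_congr rfl fun σ _ => by rw [Multiset.sum_nsmul, Multiset.sum_singleton]
    · rw [Multiset.count_sum']
      simp only [Multiset.count_nsmul, Multiset.count_singleton]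
      simp [hσ]
  obtain ⟨h1, h2, h3⟩ := key fun σ => (c σ).toNat
  obtain ⟨h4, h5, h6⟩ := key fun σ => (-c σ).toNat
  have h7 := S.simple_multiset_unique _ _ _ rfl h1 h4 (by
    rw [h2, h5, ← sub_eq_zero, ← Finset.sum_sub_distrib, ← h]
    refine Finset.sum_congr rfl fun σ _ => ?_
    rw [← natCast_zsmul, ← natCast_zsmul, ← sub_smul, Int.toNat_sub_toNat_neg])
  intro σ hσ
  have h8 := h3 σ hσ
  rw [h7, h6 σ hσ] at h8
  omega

/-- The Cartan matrix of a finite set of simple roots is invertible. -/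
theorem isUnit_det_cartan (hF : ∀ σ ∈ F, σ ∈ S.simples) [DecidableEq F] :
    IsUnit (Matrix.of fun σ τ : F => (σ : Module.Dual K S.h) (S.hc τ)).det := by
  classical
  have hFΦ : ∀ σ ∈ F, σ ∈ S.Φ := fun σ hσ => S.pos_subset (hF σ hσ).1
  choose A hA using fun σ τ : F => S.root_hc_int (hFΦ τ τ.2) (hFΦ σ σ.2)
  have hmap : (Matrix.of fun σ τ : F => (σ : Module.Dual K S.h) (S.hc τ)) =
      (Int.castRingHom K).mapMatrix (Matrix.of A) := by
    ext σ τ; simp [hA]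
  rw [hmap, ← RingHom.map_det, isUnit_iff_ne_zero]
  simp only [eq_intCast, ne_eq, Int.cast_eq_zero]
  intro h0
  obtain ⟨v, hv, hv0⟩ := Matrix.exists_vecMul_eq_zero_iff.2 h0
  set c : Module.Dual K S.h → ℤ := fun σ => if h : σ ∈ F then v ⟨σ, h⟩ else 0
  have hc : ∀ σ : F, c σ = v σ := fun σ => dif_pos σ.2
  have h1 : ∑ σ ∈ F, c σ • σ = 0 := by
    refine S.int_comb_eq_zero hFΦ c fun τ hτ => ?_
    have h2 := congrFun hv0 ⟨τ, hτ⟩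
    simp only [Matrix.vecMul, dotProduct, Matrix.of_apply, Pi.zero_apply] at h2
    rw [LinearMap.sum_apply, ← Finset.sum_coe_sort]
    have h3 : ((∑ σ : F, v σ * A σ ⟨τ, hτ⟩ : ℤ) : K) = 0 := by rw [h2, Int.cast_zero]
    rw [← h3, Int.cast_sum]
    refine Finset.sum_congr rfl fun σ _ => ?_
    rw [LinearMap.smul_apply, hA σ ⟨τ, hτ⟩, hc, zsmul_eq_mul, Int.cast_mul]
  refine hv (funext fun σ => ?_)
  rw [← hc σ, Pi.zero_apply]
  exact S.simple_int_comb hF c h1 σ σ.2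

theorem eq_zero_of_mem_span_hc (hF : ∀ σ ∈ F, σ ∈ S.simples) {H : S.h}
    (hH : H ∈ Submodule.span K (S.hc '' F)) (h : ∀ σ ∈ F, σ H = 0) : H = 0 := by
  classical
  obtain ⟨c, rfl⟩ := (Submodule.mem_span_image_finset_iff_exists_fun K).1 hH
  have h1 := Matrix.eq_zero_of_mulVec_eq_zero (S.isUnit_det_cartan hF).ne_zero
    (v := c) (funext fun σ => by
      simp only [Matrix.mulVec, dotProduct, Matrix.of_apply, Pi.zero_apply]
      rw [← h σ σ.2, map_sum]
      exact Finset.sum_congr rfl fun τ _ => by rw [map_smul, smul_eq_mul, mul_comm])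
  exact Finset.sum_eq_zero fun σ _ => by rw [congrFun h1 σ]; simp

theorem exists_mem_span_hc (hF : ∀ σ ∈ F, σ ∈ S.simples) (H : S.h) :
    ∃ H' ∈ Submodule.span K (S.hc '' F), ∀ σ ∈ F, σ (H - H') = 0 := by
  classical
  set B := Matrix.of fun σ τ : F => (σ : Module.Dual K S.h) (S.hc τ) with hB
  set v : F → K := fun σ => (σ : Module.Dual K S.h) H with hv
  have h1 : B.mulVec (B⁻¹.mulVec v) = v := by
    rw [Matrix.mulVec_mulVec, Matrix.mul_nonsing_inv _ (S.isUnit_det_cartan hF),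
      Matrix.one_mulVec]
  refine ⟨∑ τ : F, (B⁻¹.mulVec v) τ • S.hc τ, sum_mem fun τ _ => Submodule.smul_mem _ _
    (Submodule.subset_span ⟨τ, τ.2, rfl⟩), fun σ hσ => ?_⟩
  have h2 := congrFun h1 ⟨σ, hσ⟩
  simp only [Matrix.mulVec, dotProduct, hB, hv, Matrix.of_apply] at h2
  rw [map_sub, ← h2, map_sum, sub_eq_zero]
  exact Finset.sum_congr rfl fun τ _ => by
    rw [map_smul, smul_eq_mul, mul_comm]; rfl

end RootReductive

namespace RootReductive

variable {K g} (S : RootReductive K g)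

/-- The subalgebra generated by `t` and the root vectors of weights `±σ`, `σ ∈ F`. -/
def genSub (t : Set g) (F : Finset (Module.Dual K S.h)) : LieSubalgebra K g :=
  LieSubalgebra.lieSpan K g (t ∪ (S.e '' F ∪ S.f '' F))

variable {t : Set g} {F : Finset (Module.Dual K S.h)}

theorem subset_genSub : t ⊆ S.genSub t F := fun _ hx => LieSubalgebra.subset_lieSpan (Or.inl hx)

theorem e_mem_genSub {σ : Module.Dual K S.h} (hσ : σ ∈ F) : S.e σ ∈ S.genSub t F :=
  LieSubalgebra.subset_lieSpan (Or.inr (Or.inl ⟨σ, hσ, rfl⟩))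

theorem f_mem_genSub {σ : Module.Dual K S.h} (hσ : σ ∈ F) : S.f σ ∈ S.genSub t F :=
  LieSubalgebra.subset_lieSpan (Or.inr (Or.inr ⟨σ, hσ, rfl⟩))

theorem hc_mem_genSub {σ : Module.Dual K S.h} (hσ : σ ∈ F) : (S.hc σ : g) ∈ S.genSub t F := by
  rw [← S.lie_e_f]
  exact (S.genSub t F).lie_mem (S.e_mem_genSub hσ) (S.f_mem_genSub hσ)

theorem genSub_le {L : LieSubalgebra K g} (h1 : t ⊆ L) (h2 : ∀ σ ∈ F, S.e σ ∈ L)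
    (h3 : ∀ σ ∈ F, S.f σ ∈ L) : S.genSub t F ≤ L := by
  rw [genSub, LieSubalgebra.lieSpan_le]
  rintro x (hx | ⟨σ, hσ, rfl⟩ | ⟨σ, hσ, rfl⟩)
  exacts [h1 hx, h2 σ hσ, h3 σ hσ]

/-- The subalgebra of all elements preserving a subspace. -/
def stabSub (N : Submodule K g) : LieSubalgebra K g where
  carrier := {x | ∀ v ∈ N, ⁅x, v⁆ ∈ N}
  add_mem' := fun ha hb v hv => by rw [add_lie]; exact N.add_mem (ha v hv) (hb v hv)
  zero_mem' := fun v _ => by rw [zero_lie]; exact N.zero_mem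
  smul_mem' := fun c x hx v hv => by rw [smul_lie]; exact N.smul_mem c (hx v hv)
  lie_mem' := fun {x y} hx hy v hv => by
    rw [lie_lie]; exact N.sub_mem (hx _ (hy v hv)) (hy _ (hx v hv))

/-- A subspace stable under the generators of `S.genSub t F`, as a Lie submodule. -/
def genSubmodule (N : Submodule K g) (h1 : ∀ x ∈ t, ∀ v ∈ N, ⁅x, v⁆ ∈ N)
    (h2 : ∀ σ ∈ F, ∀ v ∈ N, ⁅S.e σ, v⁆ ∈ N) (h3 : ∀ σ ∈ F, ∀ v ∈ N, ⁅S.f σ, v⁆ ∈ N) :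
    LieSubmodule K (S.genSub t F) g :=
  { N with
    lie_mem := fun {x m} hm =>
      (S.genSub_le (L := stabSub N) h1 h2 h3) x.2 m hm }

theorem lie_mem_of_mem_genSub {x : g} (hx : x ∈ S.genSub t F) {N : LieSubmodule K (S.genSub t F) g}
    {m : g} (hm : m ∈ N) : ⁅x, m⁆ ∈ N := N.lie_mem (x := ⟨x, hx⟩) hm

/-- The sum of the weight spaces with weights congruent to `β` modulo the lattice spanned
by `F`. -/
def cosetSum (F : Finset (Module.Dual K S.h)) (β : Module.Dual K S.h) : Submodule K g :=
  ⨆ χ : {χ : Module.Dual K S.h // χ - β ∈ Submodule.span ℤ (F : Set (Module.Dual K S.h))}, S.W χ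

theorem W_le_cosetSum {β χ : Module.Dual K S.h}
    (h : χ - β ∈ Submodule.span ℤ (F : Set (Module.Dual K S.h))) : S.W χ ≤ S.cosetSum F β :=
  le_iSup (fun χ : {χ : Module.Dual K S.h //
    χ - β ∈ Submodule.span ℤ (F : Set (Module.Dual K S.h))} => S.W χ) ⟨χ, h⟩

theorem lie_mem_cosetSum {β δ : Module.Dual K S.h} {y : g} (hy : y ∈ S.W δ)
    (hδ : δ ∈ Submodule.span ℤ (F : Set (Module.Dual K S.h))) :
    ∀ v ∈ S.cosetSum F β, ⁅y, v⁆ ∈ S.cosetSum F β := by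
  have : S.cosetSum F β ≤ (S.cosetSum F β).comap (LieAlgebra.ad K g y : g →ₗ[K] g) := by
    conv_lhs => rw [cosetSum]
    refine iSup_le fun χ v hv => S.W_le_cosetSum ?_ (lie_mem_W hy hv)
    rw [add_sub_assoc]
    exact add_mem hδ χ.2
  exact this

/-- The coset sum as a Lie submodule. -/
def cosetSubmodule (ht : t ⊆ S.h) (β : Module.Dual K S.h) : LieSubmodule K (S.genSub t F) g :=
  S.genSubmodule (S.cosetSum F β)
    (fun _ hx => S.lie_mem_cosetSum (S.h_le_W_zero (ht hx)) (zero_mem _))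
    (fun σ hσ => S.lie_mem_cosetSum (S.e_mem σ) (Submodule.subset_span hσ))
    (fun σ hσ => S.lie_mem_cosetSum (S.f_mem σ) (neg_mem (Submodule.subset_span hσ)))

theorem isHomog_of_le_cosetSum (hF : ∀ σ ∈ F, σ ∈ S.Φ) {β : Module.Dual K S.h}
    {N : Submodule K g} (hst : ∀ σ ∈ F, ∀ v ∈ N, ⁅(S.hc σ : g), v⁆ ∈ N)
    (hN : N ≤ S.cosetSum F β) : S.IsHomog N := by
  classical
  intro x hx
  have hx' := hN hx
  rw [cosetSum, Submodule.mem_iSup_iff_exists_dfinsupp'] at hx'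
  obtain ⟨y, hy⟩ := hx'
  have hw : Function.Injective fun (χ : {χ : Module.Dual K S.h //
      χ - β ∈ Submodule.span ℤ (F : Set (Module.Dual K S.h))}) (τ : F) =>
      (χ : Module.Dual K S.h) (S.hc τ) := by
    intro χ ψ h
    refine Subtype.ext (sub_eq_zero.1 (S.span_int_eq_zero hF ?_ fun τ hτ => ?_))
    · have := sub_mem χ.2 ψ.2
      rwa [sub_sub_sub_cancel_right] at this
    · rw [LinearMap.sub_apply, sub_eq_zero]
      exact congrFun h ⟨τ, hτ⟩
  rw [DFinsupp.sum] at hy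
  have h1 := jointEig_component_mem (D := fun τ : F => LieAlgebra.ad K g (S.hc τ : g)) N
    (fun τ m hm => hst τ τ.2 m hm) hw y.support (fun χ => (y χ : g))
    (fun χ _ τ => (y χ).2 _) (by rw [hy]; exact hx)
  rw [← hy]
  exact sum_mem fun χ hχ => (le_iSup (fun χ => N ⊓ S.W χ) χ.1) ⟨h1 χ hχ, (y χ).2⟩

theorem e_mem_of_hc_mem {τ : Module.Dual K S.h} (hτ : τ ∈ F)
    {N : LieSubmodule K (S.genSub t F) g} {H : S.h} (hH : (H : g) ∈ N) (h0 : τ H ≠ 0) :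
    S.e τ ∈ N := by
  have h1 : ⁅S.e τ, (H : g)⁆ = -(τ H) • S.e τ := by
    rw [← lie_skew, S.e_mem τ H, neg_smul]
  have h2 := S.lie_mem_of_mem_genSub (S.e_mem_genSub hτ) hH
  rw [h1] at h2
  exact (N.toSubmodule.smul_mem_iff (neg_ne_zero.2 h0)).1 h2

theorem hc_mem_of_e_mem {τ : Module.Dual K S.h} (hτ : τ ∈ F)
    {N : LieSubmodule K (S.genSub t F) g} (h : S.e τ ∈ N) : (S.hc τ : g) ∈ N := by
  rw [← S.lie_e_f, ← lie_skew]
  exact N.neg_mem (S.lie_mem_of_mem_genSub (S.f_mem_genSub hτ) h)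

theorem f_mem_of_e_mem (hF : ∀ σ ∈ F, σ ∈ S.Φ) {τ : Module.Dual K S.h} (hτ : τ ∈ F)
    {N : LieSubmodule K (S.genSub t F) g} (h : S.e τ ∈ N) : S.f τ ∈ N := by
  have h1 : ⁅S.f τ, (S.hc τ : g)⁆ = (2 : K) • S.f τ := by
    rw [← lie_skew, S.f_mem τ, LinearMap.neg_apply, root_hc (hF τ hτ), neg_smul, neg_neg]
  have h2 := S.lie_mem_of_mem_genSub (S.f_mem_genSub hτ) (S.hc_mem_of_e_mem hτ h)
  rw [h1] at h2
  exact (N.toSubmodule.smul_mem_iff (two_ne_zero)).1 h2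

theorem e_mem_of_f_mem (hF : ∀ σ ∈ F, σ ∈ S.Φ) {τ : Module.Dual K S.h} (hτ : τ ∈ F)
    {N : LieSubmodule K (S.genSub t F) g} (h : S.f τ ∈ N) : S.e τ ∈ N := by
  refine S.e_mem_of_hc_mem hτ (H := S.hc τ) ?_ (by rw [root_hc (hF τ hτ)]; exact two_ne_zero)
  rw [← S.lie_e_f]
  exact S.lie_mem_of_mem_genSub (S.e_mem_genSub hτ) h

/-- The roots `γ` such that every submodule containing the root space of `γ` contains the one
of `β`. -/
def above (t : Set g) (F : Finset (Module.Dual K S.h)) (β : Module.Dual K S.h) :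
    Set (Module.Dual K S.h) :=
  {γ ∈ S.Φ | ∀ N : LieSubmodule K (S.genSub t F) g, S.e γ ∈ N → S.e β ∈ N}

variable {S} in
theorem above_add {β γ δ : Module.Dual K S.h} {y : g} (hy : y ∈ S.genSub t F)
    (hyδ : y ∈ S.W (-δ)) (hy0 : y ≠ 0) (hδ : δ ∈ S.Φ) (hγ : γ ∈ S.above t F β)
    (h : δ + γ ∈ S.Φ) : δ + γ ∈ S.above t F β := by
  refine ⟨h, fun N hN => hγ.2 N ?_⟩
  have hw : -δ + (δ + γ) = γ := by abel
  have h1 := lie_mem_W hyδ (S.e_mem (δ + γ))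
  have h2 := lie_ne_zero (S.neg_root hδ) h (by rw [hw]; exact hγ.1) hyδ (S.e_mem _) hy0 (e_ne h)
  rw [hw] at h1
  obtain ⟨c, hc⟩ := S.W_eq_smul hγ.1 h1 h2 (S.e_mem γ)
  rw [hc]
  exact N.smul_mem c (S.lie_mem_of_mem_genSub hy hN)

variable {S} in
theorem neg_mem_above_iff (hF : ∀ σ ∈ F, σ ∈ S.Φ) {σ β : Module.Dual K S.h} (hσ : σ ∈ F) :
    -σ ∈ S.above t F β ↔ σ ∈ S.above t F β := by
  have hσΦ := hF σ hσ
  have hmem : ∀ N : LieSubmodule K (S.genSub t F) g, S.e (-σ) ∈ N ↔ S.e σ ∈ N := by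
    intro N
    have h0 := e_ne (S.neg_root hσΦ)
    constructor
    · intro h
      obtain ⟨c, hc⟩ := S.W_eq_smul (S.neg_root hσΦ) (S.e_mem _) h0 (S.f_mem σ)
      exact S.e_mem_of_f_mem hF hσ (by rw [hc]; exact N.smul_mem c h)
    · intro h
      obtain ⟨c, hc⟩ := W_eq_smul_f hσΦ (S.e_mem (-σ))
      rw [hc]
      exact N.smul_mem c (S.f_mem_of_e_mem hF hσ h)
  constructor
  · exact fun h => ⟨hσΦ, fun N hN => h.2 N ((hmem N).2 hN)⟩
  · exact fun h => ⟨S.neg_root hσΦ, fun N hN => h.2 N ((hmem N).1 hN)⟩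

variable {S} in
theorem mem_above_of_hc (hF : ∀ σ ∈ F, σ ∈ S.Φ) {σ τ β : Module.Dual K S.h} (hσ : σ ∈ F)
    (hτ : τ ∈ F) (h : σ ∈ S.above t F β) (h0 : τ (S.hc σ) ≠ 0) : τ ∈ S.above t F β := by
  refine ⟨hF τ hτ, fun N hN => h.2 N (S.e_mem_of_hc_mem hσ (S.hc_mem_of_e_mem hτ hN) ?_)⟩
  exact S.hc_apply_ne_zero_symm (hF τ hτ) (hF σ hσ) h0

/-- A spanning set of the submodule generated by the root space of `β`. -/
def aboveSet (t : Set g) (F : Finset (Module.Dual K S.h)) (β : Module.Dual K S.h) : Set g :=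
  (⋃ γ ∈ S.above t F β, (S.W γ : Set g)) ∪
    {x | ∃ σ ∈ F, σ ∈ S.above t F β ∧ x = (S.hc σ : g)}

variable {S} in
theorem W_le_span_aboveSet {β γ : Module.Dual K S.h} (h : γ ∈ S.above t F β) :
    S.W γ ≤ Submodule.span K (S.aboveSet t F β) := fun _ hx =>
  Submodule.subset_span (Or.inl (Set.mem_biUnion h hx))

/-- The action of the generators of nonzero weight on the span of `S.aboveSet t F β`. -/
theorem lie_mem_span_aboveSet (hF : ∀ σ ∈ F, σ ∈ S.Φ) {β σ δ : Module.Dual K S.h} (hσ : σ ∈ F)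
    (hδ : δ = σ ∨ δ = -σ) {y z : g} (hy : y ∈ S.W δ) (hz : z ∈ S.W (-δ)) (hz0 : z ≠ 0)
    (hzg : z ∈ S.genSub t F) :
    ∀ v ∈ Submodule.span K (S.aboveSet t F β), ⁅y, v⁆ ∈ Submodule.span K (S.aboveSet t F β) := by
  set N := Submodule.span K (S.aboveSet t F β) with hNdef
  have hδΦ : δ ∈ S.Φ := by
    rcases hδ with rfl | rfl
    exacts [hF _ hσ, S.neg_root (hF _ hσ)]
  have : N ≤ N.comap (LieAlgebra.ad K g y : g →ₗ[K] g) := by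
    conv_lhs => rw [hNdef]
    rw [Submodule.span_le]
    rintro v (hv | ⟨τ, hτ, hτβ, rfl⟩)
    · obtain ⟨γ, hγ, hv⟩ := Set.mem_iUnion₂.1 hv
      change ⁅y, v⁆ ∈ N
      have h1 := lie_mem_W hy hv
      by_cases h0 : ⁅y, v⁆ = 0
      · rw [h0]; exact N.zero_mem
      by_cases hsum : δ + γ = 0
      · have hσβ : σ ∈ S.above t F β := by
          have hγ' : γ = -δ := (neg_eq_of_add_eq_zero_right hsum).symm
          rcases hδ with rfl | rfl
          · rw [hγ', neg_mem_above_iff hF hσ] at hγ; exact hγ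
          · rwa [hγ', neg_neg] at hγ
        have key : ⁅y, v⁆ ∈ Submodule.span K {(S.hc σ : g)} := by
          rw [Submodule.mem_span_singleton]
          have hγ' : γ = -δ := (neg_eq_of_add_eq_zero_right hsum).symm
          rw [hγ'] at hv
          rcases hδ with rfl | rfl
          · obtain ⟨c, rfl⟩ := W_eq_smul_e (hF _ hσ) hy
            obtain ⟨d, rfl⟩ := W_eq_smul_f (hF _ hσ) hv
            exact ⟨d * c, by rw [smul_lie, lie_smul, S.lie_e_f, smul_smul, mul_comm]⟩
          · rw [neg_neg] at hv
            obtain ⟨c, rfl⟩ := W_eq_smul_f (hF _ hσ) hy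
            obtain ⟨d, rfl⟩ := W_eq_smul_e (hF _ hσ) hv
            exact ⟨-(c * d), by
              rw [smul_lie, lie_smul, ← lie_skew, S.lie_e_f, smul_neg, smul_neg, smul_smul, neg_smul]⟩
        have hsub : {(S.hc σ : g)} ⊆ S.aboveSet t F β :=
          Set.singleton_subset_iff.2 (Or.inr ⟨σ, hσ, hσβ, rfl⟩)
        exact Submodule.span_mono hsub key
      · exact W_le_span_aboveSet (above_add hzg hz hz0 hδΦ hγ (S.root_of_mem h1 h0 hsum)) h1
    · change ⁅y, (S.hc τ : g)⁆ ∈ N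
      have h1 : ⁅y, (S.hc τ : g)⁆ = -(δ (S.hc τ)) • y := by rw [← lie_skew, hy, neg_smul]
      rw [h1]
      by_cases h0 : δ (S.hc τ) = 0
      · rw [h0, neg_zero, zero_smul]; exact N.zero_mem
      refine N.smul_mem _ (W_le_span_aboveSet ?_ hy)
      rcases hδ with rfl | rfl
      · exact mem_above_of_hc hF hτ hσ hτβ h0
      · rw [neg_mem_above_iff hF hσ]
        exact mem_above_of_hc hF hτ hσ hτβ (by simpa using h0)
  exact this

/-- The submodule generated by the root space of `β`. -/
def aboveSubmodule (ht : t ⊆ S.h) (hF : ∀ σ ∈ F, σ ∈ S.Φ) (β : Module.Dual K S.h) :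
    LieSubmodule K (S.genSub t F) g :=
  S.genSubmodule (Submodule.span K (S.aboveSet t F β))
    (fun x hx => by
      have : Submodule.span K (S.aboveSet t F β) ≤
          (Submodule.span K (S.aboveSet t F β)).comap (LieAlgebra.ad K g x : g →ₗ[K] g) := by
        rw [Submodule.span_le]
        rintro v (hv | ⟨τ, hτ, hτβ, rfl⟩)
        · obtain ⟨γ, hγ, hv⟩ := Set.mem_iUnion₂.1 hv
          change ⁅x, v⁆ ∈ Submodule.span K (S.aboveSet t F β)
          rw [hv ⟨x, ht hx⟩]
          exact Submodule.smul_mem _ _ (W_le_span_aboveSet hγ hv)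
        · change ⁅x, (S.hc τ : g)⁆ ∈ Submodule.span K (S.aboveSet t F β)
          rw [S.h_abelian (ht hx) (S.hc τ).2]
          exact zero_mem _
      exact this)
    (fun σ hσ => S.lie_mem_span_aboveSet hF hσ (Or.inl rfl) (S.e_mem σ) (S.f_mem σ)
      (f_ne (hF σ hσ)) (S.f_mem_genSub hσ))
    (fun σ hσ => S.lie_mem_span_aboveSet hF hσ (Or.inr rfl) (S.f_mem σ)
      (by rw [neg_neg]; exact S.e_mem σ) (e_ne (hF σ hσ)) (S.e_mem_genSub hσ))

variable {S} in
theorem e_mem_of_ne_bot (ht : t ⊆ S.h) (hF : ∀ σ ∈ F, σ ∈ S.simples) {β : Module.Dual K S.h}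
    {N : LieSubmodule K (S.genSub t F) g}
    (h1 : N ≤ S.cosetSubmodule ht β)
    (h2 : N ≤ S.aboveSubmodule ht (fun σ hσ => S.pos_subset (hF σ hσ).1) β) (h0 : N ≠ ⊥) :
    S.e β ∈ N := by
  have hFΦ : ∀ σ ∈ F, σ ∈ S.Φ := fun σ hσ => S.pos_subset (hF σ hσ).1
  have hhom : S.IsHomog N.toSubmodule := S.isHomog_of_le_cosetSum hFΦ
    (fun σ hσ v hv => S.lie_mem_of_mem_genSub (S.hc_mem_genSub hσ) hv) h1
  obtain ⟨χ, x, hxN, hxχ, hx0⟩ : ∃ χ, ∃ x ∈ N, x ∈ S.W χ ∧ x ≠ 0 := by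
    by_contra! hcon
    refine h0 ((LieSubmodule.toSubmodule_eq_bot N).1 (eq_bot_iff.2 (hhom.trans
      (iSup_le fun χ x hx => hcon χ x hx.1 hx.2))))
  have h3 := mem_span_inter_of_iSupIndep S.iSupIndep_W (s := S.aboveSet t F β) (by
    rintro v (hv | ⟨τ, hτ, hτβ, rfl⟩)
    · obtain ⟨γ, hγ, hv⟩ := Set.mem_iUnion₂.1 hv
      exact ⟨γ, hv⟩
    · exact ⟨0, S.h_le_W_zero (S.hc τ).2⟩) hxχ (h2 hxN)
  by_cases hχ : χ = 0
  · subst hχ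
    have h4 : x ∈ (Submodule.span K (S.hc '' {σ | σ ∈ F ∧ σ ∈ S.above t F β})).map
        S.h.toSubmodule.subtype := by
      refine (Submodule.span_le.2 ?_ : Submodule.span K _ ≤ _) h3
      rintro v ⟨hv | ⟨τ, hτ, hτβ, rfl⟩, hv0⟩
      · obtain ⟨γ, hγ, hv⟩ := Set.mem_iUnion₂.1 hv
        rw [S.W_inter hv hv0 (S.root_ne_zero hγ.1)]
        exact zero_mem _
      · exact ⟨S.hc τ, Submodule.subset_span ⟨τ, ⟨hτ, hτβ⟩, rfl⟩, rfl⟩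
    obtain ⟨H, hH, rfl⟩ := h4
    obtain ⟨τ, hτ, hτH⟩ : ∃ τ ∈ F, τ H ≠ 0 := by
      by_contra! hcon
      refine hx0 ?_
      rw [S.eq_zero_of_mem_span_hc hF (Submodule.span_mono (Set.image_mono fun σ hσ => hσ.1) hH)
        hcon, map_zero]
    obtain ⟨σ, hσ, hσβ, hστ⟩ : ∃ σ ∈ F, σ ∈ S.above t F β ∧ τ (S.hc σ) ≠ 0 := by
      by_contra! hcon
      refine hτH ((Submodule.span_le.2 ?_ :
        Submodule.span K (S.hc '' {σ | σ ∈ F ∧ σ ∈ S.above t F β}) ≤ LinearMap.ker τ) hH)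
      rintro _ ⟨σ, hσ, rfl⟩
      exact hcon σ hσ.1 hσ.2
    exact (mem_above_of_hc hFΦ hσ hτ hσβ hστ).2 N (S.e_mem_of_hc_mem hτ hxN hτH)
  · by_cases hχβ : χ ∈ S.above t F β
    · obtain ⟨c, hc⟩ := S.W_eq_smul hχβ.1 hxχ hx0 (S.e_mem χ)
      exact hχβ.2 N (by rw [hc]; exact N.smul_mem c hxN)
    · refine absurd ?_ hx0
      have : Submodule.span K (S.aboveSet t F β ∩ S.W χ) ≤ ⊥ := by
        rw [Submodule.span_le]
        rintro v ⟨hv | ⟨τ, hτ, hτβ, rfl⟩, hv0⟩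
        · obtain ⟨γ, hγ, hv⟩ := Set.mem_iUnion₂.1 hv
          exact S.W_inter hv hv0 (by rintro rfl; exact hχβ hγ)
        · exact S.W_inter (S.h_le_W_zero (S.hc τ).2) hv0 (Ne.symm hχ)
      exact this h3

theorem isAtom_lieSpan_e (ht : t ⊆ S.h) (hF : ∀ σ ∈ F, σ ∈ S.simples) {β : Module.Dual K S.h}
    (hβ : β ∈ S.Φ) : IsAtom (LieSubmodule.lieSpan K (S.genSub t F) {S.e β}) := by
  have hFΦ : ∀ σ ∈ F, σ ∈ S.Φ := fun σ hσ => S.pos_subset (hF σ hσ).1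
  refine ⟨fun h => e_ne hβ ?_, fun N hN => ?_⟩
  · have h1 : S.e β ∈ LieSubmodule.lieSpan K (S.genSub t F) {S.e β} :=
      LieSubmodule.subset_lieSpan rfl
    rwa [h, LieSubmodule.mem_bot] at h1
  · by_contra h0
    refine hN.not_ge (LieSubmodule.lieSpan_le.2 (Set.singleton_subset_iff.2
      (e_mem_of_ne_bot ht hF (hN.le.trans ?_) (hN.le.trans ?_) h0)))
    · refine LieSubmodule.lieSpan_le.2 (Set.singleton_subset_iff.2 ?_)
      exact S.W_le_cosetSum (by rw [sub_self]; exact zero_mem _) (S.e_mem β)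
    · refine LieSubmodule.lieSpan_le.2 (Set.singleton_subset_iff.2 ?_)
      exact W_le_span_aboveSet (⟨hβ, fun N h => h⟩ : β ∈ S.above t F β) (S.e_mem β)

theorem sSup_atoms_eq_top (ht : t ⊆ S.h) (hF : ∀ σ ∈ F, σ ∈ S.simples) :
    sSup {N : LieSubmodule K (S.genSub t F) g | IsAtom N} = ⊤ := by
  set T := sSup {N : LieSubmodule K (S.genSub t F) g | IsAtom N} with hT
  have hFΦ : ∀ σ ∈ F, σ ∈ S.Φ := fun σ hσ => S.pos_subset (hF σ hσ).1
  have he : ∀ β ∈ S.Φ, S.e β ∈ T := fun β hβ =>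
    (le_sSup (S.isAtom_lieSpan_e ht hF hβ) : _ ≤ T) (LieSubmodule.subset_lieSpan rfl)
  have hz : ∀ H : S.h, (∀ σ ∈ F, σ H = 0) → (H : g) ∈ T := by
    intro H hH
    by_cases hH0 : (H : g) = 0
    · rw [hH0]; exact T.zero_mem
    have hzero : ∀ y : g, ⁅y, (H : g)⁆ = 0 →
        ∀ v ∈ Submodule.span K {(H : g)}, ⁅y, v⁆ ∈ Submodule.span K {(H : g)} := by
      intro y hy v hv
      obtain ⟨c, rfl⟩ := Submodule.mem_span_singleton.1 hv
      rw [lie_smul, hy, smul_zero]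
      exact zero_mem _
    let N : LieSubmodule K (S.genSub t F) g := S.genSubmodule (Submodule.span K {(H : g)})
      (fun x hx => hzero x (S.h_abelian (ht hx) H.2))
      (fun σ hσ => hzero _ (by rw [← lie_skew, S.e_mem σ H, hH σ hσ, zero_smul, neg_zero]))
      (fun σ hσ => hzero _ (by
        rw [← lie_skew, S.f_mem σ H, LinearMap.neg_apply, hH σ hσ, neg_zero, zero_smul, neg_zero]))
    have hHN : (H : g) ∈ N := Submodule.mem_span_singleton_self (H : g)
    have hN : IsAtom N := by
      refine ⟨fun h => hH0 ?_, fun N' hN' => ?_⟩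
      · rw [h] at hHN
        exact (LieSubmodule.mem_bot _).1 hHN
      · by_contra hne
        obtain ⟨v, hv, hv0⟩ := Submodule.exists_mem_ne_zero_of_ne_bot
          (mt (LieSubmodule.toSubmodule_eq_bot N').1 hne)
        obtain ⟨c, rfl⟩ := Submodule.mem_span_singleton.1 (hN'.le hv)
        refine hN'.not_ge fun w hw => ?_
        obtain ⟨d, rfl⟩ := Submodule.mem_span_singleton.1 hw
        exact N'.smul_mem d ((N'.toSubmodule.smul_mem_iff (left_ne_zero_of_smul hv0)).1 hv)
    exact (le_sSup hN : N ≤ T) hHN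
  rw [← LieSubmodule.toSubmodule_eq_top, eq_top_iff, ← S.rootdec]
  refine sup_le (fun x hx => ?_) (iSup₂_le fun β hβ x hx => ?_)
  · obtain ⟨H', hH', h0⟩ := S.exists_mem_span_hc hF ⟨x, hx⟩
    have h1 : (H' : g) ∈ T := by
      refine (Submodule.span_le.2 ?_ : Submodule.span K (S.hc '' F) ≤
        T.toSubmodule.comap S.h.toSubmodule.subtype) hH'
      rintro _ ⟨σ, hσ, rfl⟩
      exact S.hc_mem_of_e_mem hσ (he σ (hFΦ σ hσ))
    have h2 := T.add_mem (hz _ h0) h1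
    simpa using h2
  · obtain ⟨c, rfl⟩ := W_eq_smul_e hβ hx
    exact T.smul_mem c (he β hβ)

theorem complementedLattice_lieSubmodule (ht : t ⊆ S.h) (hF : ∀ σ ∈ F, σ ∈ S.simples) :
    ComplementedLattice (LieSubmodule K (S.genSub t F) g) :=
  complementedLattice_of_sSup_atoms_eq_top (S.sSup_atoms_eq_top ht hF)

end RootReductive

/-- A solvable ideal contains no `sl₂`-triple. -/
theorem _root_.LieIdeal.IsSolvable.eq_zero_of_lie {F L : Type*} [Field F] [CharZero F] [LieRing L]
    [LieAlgebra F L] {I : LieIdeal F L} (hI : LieAlgebra.IsSolvable I) {h e f : L}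
    (ht : IsSl2Triple h e f) (he : e ∈ I) (hf : f ∈ I) : h = 0 := by
  obtain ⟨k, hk⟩ := (LieAlgebra.isSolvable_iff F _).1 hI
  rw [LieIdeal.derivedSeries_eq_bot_iff] at hk
  have key : ∀ k, e ∈ LieAlgebra.derivedSeriesOfIdeal F L k I ∧
      f ∈ LieAlgebra.derivedSeriesOfIdeal F L k I ∧
      h ∈ LieAlgebra.derivedSeriesOfIdeal F L k I := by
    intro k
    induction k with
    | zero =>
      refine ⟨he, hf, ?_⟩
      rw [← ht.lie_e_f]
      exact I.lie_mem hf
    | succ k ih =>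
      obtain ⟨h1, h2, h3⟩ := ih
      rw [LieAlgebra.derivedSeriesOfIdeal_succ]
      refine ⟨?_, ?_, ?_⟩
      · have := LieSubmodule.lie_mem_lie h3 h1
        rw [ht.lie_h_e_nsmul, ← Nat.cast_smul_eq_nsmul F] at this
        exact (Submodule.smul_mem_iff _ (by norm_num)).1 this
      · have := LieSubmodule.lie_mem_lie h3 h2
        rw [ht.lie_h_f_nsmul, ← Nat.cast_smul_eq_nsmul F, neg_mem_iff] at this
        exact (Submodule.smul_mem_iff _ (by norm_num)).1 this
      · rw [← ht.lie_e_f]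
        exact LieSubmodule.lie_mem_lie h1 h2
  have := (key k).2.2
  rw [hk] at this
  exact (LieSubmodule.mem_bot _).1 this

namespace RootReductive

variable {K g} (S : RootReductive K g) {t : Set g} {F : Finset (Module.Dual K S.h)}

variable {S} in
theorem genSub_le_cosetSum (ht : t ⊆ S.h) : (S.genSub t F).toSubmodule ≤ S.cosetSum F 0 := by
  have hW : ∀ {χ : Module.Dual K S.h} {x : g}, x ∈ S.W χ → χ ∈ Submodule.span ℤ
      (F : Set (Module.Dual K S.h)) → x ∈ S.cosetSum F 0 :=
    fun hx hχ => S.W_le_cosetSum (by rwa [sub_zero]) hx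
  let L : LieSubalgebra K g :=
    { stabSub (S.cosetSum F 0) with
      carrier := {x | x ∈ S.cosetSum F 0 ∧ x ∈ stabSub (S.cosetSum F 0)}
      add_mem' := fun ha hb => ⟨add_mem ha.1 hb.1, add_mem ha.2 hb.2⟩
      zero_mem' := ⟨zero_mem _, zero_mem _⟩
      smul_mem' := fun c x hx => ⟨Submodule.smul_mem _ c hx.1, Submodule.smul_mem _ c hx.2⟩
      lie_mem' := fun hx hy => ⟨hx.2 _ hy.1, LieSubalgebra.lie_mem _ hx.2 hy.2⟩ }
  have : S.genSub t F ≤ L := S.genSub_le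
    (fun x hx => ⟨hW (S.h_le_W_zero (ht hx)) (zero_mem _),
      S.lie_mem_cosetSum (S.h_le_W_zero (ht hx)) (zero_mem _)⟩)
    (fun σ hσ => ⟨hW (S.e_mem σ) (Submodule.subset_span hσ),
      S.lie_mem_cosetSum (S.e_mem σ) (Submodule.subset_span hσ)⟩)
    (fun σ hσ => ⟨hW (S.f_mem σ) (neg_mem (Submodule.subset_span hσ)),
      S.lie_mem_cosetSum (S.f_mem σ) (neg_mem (Submodule.subset_span hσ))⟩)
  exact fun x hx => (this hx).1

variable {S} in
/-- Subspaces of `S.genSub t F` stable under its coroots are homogeneous. -/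
theorem isHomog_of_le_genSub (ht : t ⊆ S.h) (hF : ∀ σ ∈ F, σ ∈ S.Φ) {N : Submodule K g}
    (hN : N ≤ (S.genSub t F).toSubmodule) (hst : ∀ σ ∈ F, ∀ v ∈ N, ⁅(S.hc σ : g), v⁆ ∈ N) :
    S.IsHomog N :=
  S.isHomog_of_le_cosetSum hF hst (hN.trans (genSub_le_cosetSum ht))

variable {S} in
theorem isHomog_genSub (ht : t ⊆ S.h) (hF : ∀ σ ∈ F, σ ∈ S.Φ) :
    S.IsHomog (S.genSub t F).toSubmodule :=
  isHomog_of_le_genSub ht hF le_rfl fun _ hσ _ hv =>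
    (S.genSub t F).lie_mem (S.hc_mem_genSub hσ) hv

variable {S} in
theorem IsHomog.rootdec {N : Submodule K g} (h : S.IsHomog N) :
    N = (N ⊓ S.h.toSubmodule) ⊔ (⨆ α ∈ S.Φ, (N ⊓ rootSp K g S.h α)) := by
  refine le_antisymm (h.trans (iSup_le fun χ x hx => ?_))
    (sup_le inf_le_left (iSup₂_le fun _ _ => inf_le_left))
  by_cases h0 : x = 0
  · rw [h0]; exact zero_mem _
  by_cases hχ : χ = 0
  · subst hχ
    exact Submodule.mem_sup_left ⟨hx.1, S.mem_h_of_W_zero hx.2⟩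
  · exact Submodule.mem_sup_right ((le_iSup₂ (f := fun α (_ : α ∈ S.Φ) => N ⊓ rootSp K g S.h α) χ
      (S.root_of_mem hx.2 h0 hχ)) hx)

variable {S} in
/-- The roots of `S.genSub t F` are separated from zero by its coroots. -/
theorem exists_hc_ne_zero (ht : t ⊆ S.h) (hF : ∀ σ ∈ F, σ ∈ S.Φ) {χ : Module.Dual K S.h}
    (hχ : χ ≠ 0) {x : g} (hx : x ∈ S.genSub t F) (hxχ : x ∈ S.W χ) (h0 : x ≠ 0) :
    ∃ τ ∈ F, χ (S.hc τ) ≠ 0 := by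
  by_contra! hcon
  refine hχ (S.span_int_eq_zero hF ?_ hcon)
  by_contra hns
  have h1 : x ∈ Submodule.span K (⋃ ψ ∈ {ψ : Module.Dual K S.h |
      ψ ∈ Submodule.span ℤ (F : Set (Module.Dual K S.h))}, (S.W ψ : Set g)) := by
    refine (?_ : S.cosetSum F 0 ≤ _) (genSub_le_cosetSum ht hx)
    refine iSup_le fun ψ y hy => Submodule.subset_span (Set.mem_biUnion ?_ hy)
    simpa using ψ.2
  have h2 := mem_span_inter_of_iSupIndep S.iSupIndep_W (by
    intro v hv
    obtain ⟨ψ, -, hv⟩ := Set.mem_iUnion₂.1 hv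
    exact ⟨ψ, hv⟩) hxχ h1
  refine h0 ((Submodule.span_le.2 ?_ : Submodule.span K _ ≤ (⊥ : Submodule K g)) h2)
  rintro v ⟨hv, hvχ⟩
  obtain ⟨ψ, hψ, hv⟩ := Set.mem_iUnion₂.1 hv
  exact S.W_inter hv hvχ fun h => hns (h ▸ hψ)

variable {S} in
theorem mem_h_of_homog {N : Submodule K g} (hN : S.IsHomog N)
    (h : ∀ χ ≠ 0, ∀ x ∈ N, x ∈ S.W χ → x = 0) : N ≤ S.h.toSubmodule := by
  refine hN.trans (iSup_le fun χ x hx => ?_)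
  by_cases hχ : χ = 0
  · subst hχ; exact S.mem_h_of_W_zero hx.2
  · rw [h χ hχ x hx.1 hx.2]; exact zero_mem _

variable {S} in
theorem exists_cartan_genSub (ht : t ⊆ S.h) (hF : ∀ σ ∈ F, σ ∈ S.Φ) :
    ∃ hc : LieSubalgebra K (S.genSub t F),
      ((hc : Set (S.genSub t F)) = ((↑) : (S.genSub t F) → g) ⁻¹' (S.h : Set g)) ∧
        hc.IsCartanSubalgebra := by
  refine ⟨S.h.comap (S.genSub t F).incl, rfl, ?_, ?_⟩
  · have : IsLieAbelian (S.h.comap (S.genSub t F).incl) :=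
      ⟨fun x y => Subtype.ext (Subtype.ext (S.h_abelian x.2 y.2))⟩
    infer_instance
  · refine le_antisymm (fun x hx => ?_) (LieSubalgebra.le_normalizer _)
    rw [LieSubalgebra.mem_normalizer_iff'] at hx
    have hx' : ∀ τ ∈ F, ⁅(S.hc τ : g), (x : g)⁆ ∈ S.h := fun τ hτ =>
      hx ⟨_, S.hc_mem_genSub hτ⟩ (S.hc τ).2
    let N : Submodule K g := (S.genSub t F).toSubmodule ⊓
      ⨅ τ ∈ F, S.h.toSubmodule.comap (LieAlgebra.ad K g (S.hc τ) : g →ₗ[K] g)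
    have hNmem : ∀ y, y ∈ N ↔ y ∈ S.genSub t F ∧ ∀ τ ∈ F, ⁅(S.hc τ : g), y⁆ ∈ S.h := by
      intro y
      simp only [N, Submodule.mem_inf, Submodule.mem_iInf]
      rfl
    have hN : N ≤ S.h.toSubmodule := by
      refine mem_h_of_homog (isHomog_of_le_genSub ht hF inf_le_left fun σ hσ v hv => ?_) ?_
      · rw [hNmem] at hv ⊢
        refine ⟨(S.genSub t F).lie_mem (S.hc_mem_genSub hσ) hv.1, fun τ hτ => ?_⟩
        rw [S.h_abelian (S.hc τ).2 (hv.2 σ hσ)]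
        exact zero_mem _
      · intro χ hχ y hy hyχ
        rw [hNmem] at hy
        by_contra h0
        obtain ⟨τ, hτ, hτ0⟩ := exists_hc_ne_zero ht hF hχ hy.1 hyχ h0
        have h1 := hy.2 τ hτ
        rw [hyχ (S.hc τ)] at h1
        have h2 := (S.h.toSubmodule.smul_mem_iff hτ0).1 h1
        exact h0 (S.W_inter (S.h_le_W_zero h2) hyχ hχ.symm)
    exact hN ((hNmem _).2 ⟨x.2, hx'⟩)

variable {S} in
theorem τ_mem_genSub (ht : t ⊆ S.h) (hF : ∀ σ ∈ F, σ ∈ S.Φ) {x : g} (hx : x ∈ S.genSub t F) :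
    S.τ x ∈ S.genSub t F := by
  let L : LieSubalgebra K g :=
    { (S.genSub t F).toSubmodule.comap S.τ with
      lie_mem' := fun {x y} hx hy => by
        change S.τ ⁅x, y⁆ ∈ S.genSub t F
        rw [S.τ_anti]
        exact (S.genSub t F).lie_mem hy hx }
  refine (S.genSub_le (L := L) (fun x hx => ?_) (fun σ hσ => ?_) fun σ hσ => ?_) hx
  · change S.τ x ∈ S.genSub t F
    rw [S.τ_h x (ht hx)]
    exact S.subset_genSub hx
  · change S.τ (S.e σ) ∈ S.genSub t F
    obtain ⟨c, hc⟩ := W_eq_smul_f (hF σ hσ) (S.τ_root σ _ (S.e_mem σ))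
    rw [hc]
    exact (S.genSub t F).smul_mem c (S.f_mem_genSub hσ)
  · change S.τ (S.f σ) ∈ S.genSub t F
    have h1 := S.τ_root (-σ) _ (S.f_mem σ)
    rw [neg_neg] at h1
    obtain ⟨c, hc⟩ := W_eq_smul_e (hF σ hσ) h1
    rw [hc]
    exact (S.genSub t F).smul_mem c (S.e_mem_genSub hσ)

variable {S} in
theorem radical_genSub (ht : t ⊆ S.h) (hF : ∀ σ ∈ F, σ ∈ S.Φ)
    [FiniteDimensional K (S.genSub t F)] :
    LieAlgebra.radical K (S.genSub t F) = LieAlgebra.center K (S.genSub t F) := by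
  set R := LieAlgebra.radical K (S.genSub t F) with hR
  have hsolv : LieAlgebra.IsSolvable R := LieAlgebra.radicalIsSolvable K _
  let N : Submodule K g := R.toSubmodule.map (S.genSub t F).toSubmodule.subtype
  have hNG : N ≤ (S.genSub t F).toSubmodule := by
    rintro _ ⟨x, -, rfl⟩; exact x.2
  have hNmem : ∀ {x : g} (hx : x ∈ S.genSub t F), x ∈ N ↔ (⟨x, hx⟩ : S.genSub t F) ∈ R := by
    intro x hx
    constructor
    · rintro ⟨y, hy, rfl⟩; exact hy
    · exact fun h => ⟨_, h, rfl⟩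
  have hNlie : ∀ x ∈ S.genSub t F, ∀ v ∈ N, ⁅x, v⁆ ∈ N := by
    rintro x hx _ ⟨y, hy, rfl⟩
    exact ⟨⁅⟨x, hx⟩, y⁆, R.lie_mem hy, rfl⟩
  have hNh : N ≤ S.h.toSubmodule := by
    refine mem_h_of_homog (isHomog_of_le_genSub ht hF hNG
      fun σ hσ v hv => hNlie _ (S.hc_mem_genSub hσ) v hv) fun χ hχ x hx hxχ => ?_
    by_contra h0
    have hχΦ := S.root_of_mem hxχ h0 hχ
    have he : S.e χ ∈ N := by
      obtain ⟨c, hc⟩ := S.W_eq_smul hχΦ hxχ h0 (S.e_mem χ)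
      rw [hc]; exact N.smul_mem c hx
    have hf : S.f χ ∈ S.genSub t F := by
      have h1 := τ_mem_genSub ht hF (hNG he)
      have h2 : S.τ (S.e χ) ≠ 0 := fun h => e_ne hχΦ (by rw [← S.τ_invol (S.e χ), h, map_zero])
      obtain ⟨c, hc⟩ := S.W_eq_smul (S.neg_root hχΦ) (S.τ_root χ _ (S.e_mem χ)) h2 (S.f_mem χ)
      rw [hc]; exact (S.genSub t F).smul_mem c h1
    have hh : (S.hc χ : g) ∈ N := by
      rw [← S.lie_e_f, ← lie_skew]
      exact N.neg_mem (hNlie _ hf _ he)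
    have hfN : S.f χ ∈ N := by
      have h1 := hNlie _ hf _ hh
      rw [← lie_skew, S.f_mem χ, LinearMap.neg_apply, root_hc hχΦ, neg_smul, neg_neg] at h1
      exact (N.smul_mem_iff two_ne_zero).1 h1
    have htr := triple hχΦ
    have h1 : IsSl2Triple (⟨_, hNG hh⟩ : S.genSub t F) ⟨_, hNG he⟩ ⟨_, hf⟩ :=
      { h_ne_zero := fun h => htr.h_ne_zero (congrArg Subtype.val h)
        lie_e_f := Subtype.ext htr.lie_e_f
        lie_h_e_nsmul := Subtype.ext htr.lie_h_e_nsmul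
        lie_h_f_nsmul := Subtype.ext htr.lie_h_f_nsmul }
    exact h1.h_ne_zero (LieIdeal.IsSolvable.eq_zero_of_lie hsolv h1
      ((hNmem _).1 he) ((hNmem _).1 hfN))
  refine le_antisymm (fun x hx => ?_) (LieAlgebra.center_le_radical _ _)
  have hxN : (x : g) ∈ N := (hNmem x.2).2 hx
  rw [LieModule.mem_maxTrivSubmodule]
  intro y
  refine Subtype.ext ?_
  change ⁅(y : g), (x : g)⁆ = 0
  have hker : (S.genSub t F).toSubmodule ≤ LinearMap.ker (LieAlgebra.ad K g (x : g)) := by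
    refine (isHomog_genSub ht hF).trans (iSup_le fun χ v hv => ?_)
    rw [LinearMap.mem_ker, LieAlgebra.ad_apply]
    have h1 : ⁅(x : g), v⁆ = χ ⟨x, hNh hxN⟩ • v := hv.2 ⟨x, hNh hxN⟩
    by_cases hχ : χ = 0
    · rw [h1, hχ, LinearMap.zero_apply, zero_smul]
    · have h2 : ⁅(x : g), v⁆ ∈ N := by
        rw [← lie_skew]
        exact N.neg_mem (hNlie _ hv.1 _ hxN)
      refine S.W_inter (S.h_le_W_zero (hNh h2)) ?_ (Ne.symm hχ)
      rw [h1]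
      exact (S.W χ).smul_mem _ hv.2
  rw [← lie_skew, show ⁅(x : g), (y : g)⁆ = 0 from hker y.2, neg_zero]

variable {S} in
/-- Submodules have complements inside larger subalgebras. -/
theorem exists_compl_genSub (ht : t ⊆ S.h) (hF : ∀ σ ∈ F, σ ∈ S.simples) {L : LieSubalgebra K g}
    (hL : S.genSub t F ≤ L) {N : Submodule K g} (hN : N ≤ L.toSubmodule)
    (hst : ∀ x ∈ S.genSub t F, ∀ v ∈ N, ⁅x, v⁆ ∈ N) :
    ∃ N' : Submodule K g, N' ≤ L.toSubmodule ∧ (∀ x ∈ S.genSub t F, ∀ v ∈ N', ⁅x, v⁆ ∈ N') ∧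
      N ⊓ N' = ⊥ ∧ N ⊔ N' = L.toSubmodule := by
  have := S.complementedLattice_lieSubmodule ht hF
  let M : LieSubmodule K (S.genSub t F) g := { N with lie_mem := fun {x m} hm => hst x x.2 m hm }
  obtain ⟨C, hC⟩ := exists_isCompl M
  have h1 : N ⊓ C.toSubmodule = ⊥ := by
    have := congrArg LieSubmodule.toSubmodule hC.inf_eq_bot
    rwa [LieSubmodule.inf_toSubmodule, LieSubmodule.bot_toSubmodule] at this
  have h2 : N ⊔ C.toSubmodule = ⊤ := by
    have := congrArg LieSubmodule.toSubmodule hC.sup_eq_top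
    rwa [LieSubmodule.sup_toSubmodule, LieSubmodule.top_toSubmodule] at this
  refine ⟨C.toSubmodule ⊓ L.toSubmodule, inf_le_right, fun x hx v hv =>
    ⟨S.lie_mem_of_mem_genSub hx hv.1, L.lie_mem (hL hx) hv.2⟩, ?_, ?_⟩
  · rw [← inf_assoc, h1, bot_inf_eq]
  · rw [← sup_inf_assoc_of_le _ hN, h2, top_inf_eq]

variable {S} in
theorem exists_genSub_sup_b (ht : t ⊆ S.h) (hF : ∀ σ ∈ F, σ ∈ S.simples) :
    ∃ p : LieSubalgebra K g, p.toSubmodule = (S.genSub t F).toSubmodule ⊔ S.b.toSubmodule := by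
  set G := S.genSub t F
  set T := G.toSubmodule ⊔ S.b.toSubmodule with hT
  have hTle : ∀ {x : g}, (∀ v ∈ G, ⁅x, v⁆ ∈ T) → (∀ v ∈ S.b, ⁅x, v⁆ ∈ T) → x ∈ stabSub T := by
    intro x h1 h2
    have : T ≤ T.comap (LieAlgebra.ad K g x : g →ₗ[K] g) := by
      conv_lhs => rw [hT]
      exact sup_le h1 h2
    exact this
  have hG : ∀ {v : g}, v ∈ G → v ∈ T := fun h => Submodule.mem_sup_left h
  have hb : ∀ {v : g}, v ∈ S.b → v ∈ T := fun h => Submodule.mem_sup_right h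
  have hW : ∀ {β : Module.Dual K S.h}, β ∈ S.Φp → S.W β ≤ S.b.toSubmodule := fun hβ => by
    rw [S.b_def]
    exact le_sup_of_le_right (le_iSup₂ (f := fun α (_ : α ∈ S.Φp) => rootSp K g S.h α) _ hβ)
  have hGT : G ≤ stabSub T := by
    refine S.genSub_le (fun x hx => ?_) (fun σ hσ => ?_) (fun σ hσ => ?_)
    · exact hTle (fun v hv => hG (G.lie_mem (S.subset_genSub hx) hv))
        (fun v hv => hb (S.b.lie_mem (S.h_le_b (ht hx)) hv))
    · exact hTle (fun v hv => hG (G.lie_mem (S.e_mem_genSub hσ) hv))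
        (fun v hv => hb (S.b.lie_mem (hW (hF σ hσ).1 (S.e_mem σ)) hv))
    · refine hTle (fun v hv => hG (G.lie_mem (S.f_mem_genSub hσ) hv)) ?_
      have hle : S.b.toSubmodule ≤ T.comap (LieAlgebra.ad K g (S.f σ) : g →ₗ[K] g) := by
        rw [S.b_def]
        refine sup_le (fun x hx => ?_) (iSup₂_le fun β hβ x hx => ?_)
        · change ⁅S.f σ, x⁆ ∈ T
          have h1 : ⁅x, S.f σ⁆ = (-σ) ⟨x, hx⟩ • S.f σ := S.f_mem σ ⟨x, hx⟩
          rw [← lie_skew, h1]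
          exact T.neg_mem (T.smul_mem _ (hG (S.f_mem_genSub hσ)))
        · change ⁅S.f σ, x⁆ ∈ T
          have h1 := lie_mem_W (S.f_mem σ) hx
          by_cases h0 : ⁅S.f σ, x⁆ = 0
          · rw [h0]; exact T.zero_mem
          by_cases hβσ : -σ + β = 0
          · rw [hβσ] at h1
            exact hb (S.h_le_b (S.mem_h_of_W_zero h1))
          · rcases S.pos_or_neg (S.root_of_mem h1 h0 hβσ) with h | h
            · exact hb (hW h h1)
            · exact absurd ⟨_, h, β, hβ, by abel⟩ (hF σ hσ).2
      exact hle
  have hbT : S.b ≤ stabSub T := fun x hx => hTle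
    (fun v hv => by
      rw [← lie_skew]
      exact T.neg_mem (hGT hv x (hb hx)))
    (fun v hv => hb (S.b.lie_mem hx hv))
  have hTT : T ≤ (stabSub T).toSubmodule := sup_le hGT hbT
  exact ⟨{ T with lie_mem' := fun {x y} hx hy => hTT hx y hy }, rfl⟩

/-- The simple roots whose root vectors lie in the `n`-th step of the chain. -/
def levelSimples (n : ℕ) : Set (Module.Dual K S.h) :=
  {σ ∈ S.simples | S.e σ ∈ S.gc n ∧ S.f σ ∈ S.gc n}

theorem finite_levelSimples (n : ℕ) : (S.levelSimples n).Finite := by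
  have := S.gc_findim n
  have : FiniteDimensional K (S.gc n).toSubmodule := ‹_›
  exact (finite_setOf_inter_ne S.iSupIndep_W (S.gc n).toSubmodule).subset fun σ hσ =>
    ⟨S.e σ, hσ.2.1, S.e_mem σ, e_ne (S.pos_subset hσ.1.1)⟩

/-- The subalgebra of the `n`-th step of the chain generated by its part of the Cartan subalgebra
and its simple root vectors. -/
def dynkinChain (n : ℕ) : LieSubalgebra K g :=
  S.genSub ((S.h : Set g) ∩ S.gc n) (S.finite_levelSimples n).toFinset

theorem dynkinChain_le (n : ℕ) : S.dynkinChain n ≤ S.gc n :=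
  S.genSub_le Set.inter_subset_right
    (fun _ hσ => ((S.finite_levelSimples n).mem_toFinset.1 hσ).2.1)
    (fun _ hσ => ((S.finite_levelSimples n).mem_toFinset.1 hσ).2.2)

theorem dynkinChain_mono : Monotone S.dynkinChain := by
  intro m n hmn
  have h : ∀ {σ}, σ ∈ (S.finite_levelSimples m).toFinset →
      σ ∈ (S.finite_levelSimples n).toFinset := by
    intro σ hσ
    rw [Set.Finite.mem_toFinset] at hσ ⊢
    exact ⟨hσ.1, S.gc_mono hmn hσ.2.1, S.gc_mono hmn hσ.2.2⟩
  exact S.genSub_le (fun x hx => S.subset_genSub ⟨hx.1, S.gc_mono hmn hx.2⟩)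
    (fun σ hσ => S.e_mem_genSub (h hσ)) (fun σ hσ => S.f_mem_genSub (h hσ))

variable {S} in
theorem exists_mem_dynkinChain (h : S.SimplyGenerated) (x : g) : ∃ n, x ∈ S.dynkinChain n := by
  have hmono : ∀ {m n : ℕ} {y : g}, m ≤ n → y ∈ S.dynkinChain m → y ∈ S.dynkinChain n :=
    fun hmn hy => S.dynkinChain_mono hmn hy
  let L : LieSubalgebra K g :=
    { carrier := {x | ∃ n, x ∈ S.dynkinChain n}
      add_mem' := by
        rintro a b ⟨m, hm⟩ ⟨n, hn⟩
        exact ⟨max m n, add_mem (hmono (le_max_left _ _) hm) (hmono (le_max_right _ _) hn)⟩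
      zero_mem' := ⟨0, zero_mem _⟩
      smul_mem' := by
        rintro c a ⟨m, hm⟩
        exact ⟨m, (S.dynkinChain m).smul_mem c hm⟩
      lie_mem' := by
        rintro a b ⟨m, hm⟩ ⟨n, hn⟩
        exact ⟨max m n, (S.dynkinChain _).lie_mem (hmono (le_max_left _ _) hm)
          (hmono (le_max_right _ _) hn)⟩ }
  have hσ : ∀ σ ∈ S.simples, ∃ n, σ ∈ (S.finite_levelSimples n).toFinset := by
    intro σ hσ
    obtain ⟨n, hn⟩ := S.exists_level (s := {S.e σ, S.f σ}) (by simp)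
    refine ⟨n, ?_⟩
    rw [Set.Finite.mem_toFinset]
    exact ⟨hσ, hn (by simp), hn (by simp)⟩
  have hL : L = ⊤ := h.le L
    (fun H hH => by
      obtain ⟨n, hn⟩ := S.h_exhaust H hH
      exact ⟨n, S.subset_genSub ⟨hH, hn⟩⟩)
    (fun σ hs => by
      obtain ⟨n, hn⟩ := hσ σ hs
      exact ⟨n, S.e_mem_genSub hn⟩)
    (fun σ hs => by
      obtain ⟨n, hn⟩ := hσ σ hs
      exact ⟨n, S.f_mem_genSub hn⟩)
  have hx : x ∈ L := by rw [hL]; trivial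
  exact hx

end RootReductive

/-- the equivalent characterizations of Dynkin Borel subalgebras. -/
theorem dynkin_borel_tfae (S : RootReductive K g) :
    List.TFAE
      [ -- (i) every element of `Γ⁺` is a finite sum of simple roots
        S.Γp = AddSubmonoid.closure S.simples,
        -- (ii) `g` is exhausted by a chain of nested finite-dimensional reductive
        -- subalgebras, each reductive in the next with compatible Cartan subalgebras
        -- and root vectors, such that `g̃_n + b` is a subalgebra for every `n`
        (∃ gc' : ℕ → LieSubalgebra K g, Monotone gc' ∧
          (∀ n, FiniteDimensional K (gc' n)) ∧
          (∀ x : g, ∃ n, x ∈ gc' n) ∧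
          (∀ n, LieAlgebra.radical K (gc' n) = LieAlgebra.center K (gc' n)) ∧
          (∀ n, ∀ N : Submodule K g, N ≤ (gc' (n+1)).toSubmodule →
            (∀ x ∈ gc' n, ∀ v ∈ N, ⁅x, v⁆ ∈ N) →
            ∃ N' : Submodule K g, N' ≤ (gc' (n+1)).toSubmodule ∧
              (∀ x ∈ gc' n, ∀ v ∈ N', ⁅x, v⁆ ∈ N') ∧
              N ⊓ N' = ⊥ ∧ N ⊔ N' = (gc' (n+1)).toSubmodule) ∧
          (∀ n, ∃ hc : LieSubalgebra K (gc' n),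
            ((hc : Set (gc' n)) = ((↑) : (gc' n) → g) ⁻¹' (S.h : Set g)) ∧
              hc.IsCartanSubalgebra) ∧
          (∀ n, (gc' n).toSubmodule =
            ((gc' n).toSubmodule ⊓ S.h.toSubmodule) ⊔
              (⨆ α ∈ S.Φ, ((gc' n).toSubmodule ⊓ rootSp K g S.h α))) ∧
          (∀ n, ∃ p : LieSubalgebra K g,
            p.toSubmodule = (gc' n).toSubmodule ⊔ S.b.toSubmodule)),
        -- (iii) the order `≤` on `h^*` is interval finite
        (∀ μ lam : Module.Dual K S.h, {ν | S.wle μ ν ∧ S.wle ν lam}.Finite),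
        -- (iv) `g` is generated by `h` and the simple positive and negative root spaces
        (LieSubalgebra.lieSpan K g
            ((S.h : Set g) ∪
              ⋃ α ∈ S.simples,
                ((rootSp K g S.h α : Set g) ∪ (rootSp K g S.h (-α) : Set g))) = ⊤),
        -- (v) every Verma module is locally `U(b)`-finite
        (∀ lam : Module.Dual K S.h, S.IsLocFin (S.Verma lam)),
        -- (vi) every Verma module has finite-dimensional weight spaces
        (∀ lam : Module.Dual K S.h, S.HasFinDimWt (S.Verma lam)) ] := by
  rw [← S.isDynkin_iff]
  tfae_have 1 → 2 := by
    intro h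
    have ht : ∀ n, ((S.h : Set g) ∩ S.gc n) ⊆ S.h := fun n => Set.inter_subset_left
    have hF : ∀ n, ∀ σ ∈ (S.finite_levelSimples n).toFinset, σ ∈ S.simples := fun n σ hσ =>
      ((S.finite_levelSimples n).mem_toFinset.1 hσ).1
    have hFΦ : ∀ n, ∀ σ ∈ (S.finite_levelSimples n).toFinset, σ ∈ S.Φ := fun n σ hσ =>
      S.pos_subset (hF n σ hσ).1
    have hfd : ∀ n, FiniteDimensional K (S.dynkinChain n) := fun n => by
      have := S.gc_findim n
      have : FiniteDimensional K (S.gc n).toSubmodule := ‹_›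
      exact Submodule.finiteDimensional_of_le (S.dynkinChain_le n :
        (S.dynkinChain n).toSubmodule ≤ (S.gc n).toSubmodule)
    exact ⟨S.dynkinChain, S.dynkinChain_mono, hfd,
      RootReductive.exists_mem_dynkinChain (S.simplyGenerated_of_isDynkin h),
      fun n => by
        have : FiniteDimensional K (S.genSub ((S.h : Set g) ∩ S.gc n)
          (S.finite_levelSimples n).toFinset) := hfd n
        exact RootReductive.radical_genSub (ht n) (hFΦ n),
      fun n N hN hst => RootReductive.exists_compl_genSub (ht n) (hF n)
        (S.dynkinChain_mono n.le_succ) hN hst,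
      fun n => RootReductive.exists_cartan_genSub (ht n) (hFΦ n),
      fun n => (RootReductive.isHomog_genSub (ht n) (hFΦ n)).rootdec,
      fun n => RootReductive.exists_genSub_sup_b (ht n) (hF n)⟩
  tfae_have 2 → 1 := by
    rintro ⟨gc', -, hfd, hex, -, -, -, hdec, hp⟩
    exact S.isDynkin_of_exists_chain gc' hfd hex (fun n => S.isHomog_of_rootdec (hdec n)) hp
  tfae_have 1 → 3 := S.intervalFinite_of_isDynkin
  tfae_have 3 → 1 := S.isDynkin_of_intervalFinite
  tfae_have 1 → 4 := S.simplyGenerated_of_isDynkin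
  tfae_have 1 → 5 := fun h => S.isLocFin_of_isDynkin h (S.simplyGenerated_of_isDynkin h)
  tfae_have 4 → 6 := S.hasFinDimWt_of_simplyGenerated
  tfae_have 5 → 1 := fun h => S.isDynkin_of_isLocFin (h 0)
  tfae_have 6 → 1 := fun h => S.isDynkin_of_hasFinDimWt (h 0)
  tfae_finish
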